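/- Let U be a nonnegative solution of the global extension problem, and suppose the origin is non-removable for U. Then U is cylindrically symmetric and strictly decreasing in the radial horizontal variable: U(x,t) = U(x',t) whenever |x| = |x'| and t ≥ 0, and U(x,t) > U(x',t) whenever 0 < |x| < |x'| and t ≥ 0. -/

import Mathlib

open scoped Topology MeasureTheory RealInnerProductSpace
open Filter MeasureTheory

noncomputable section

/-- Points of `ℝ^{n+1}`, written `X = (x, t)` with `x ∈ ℝⁿ` and `t ∈ ℝ`. -/
abbrev Pt (n : ℕ) := EuclideanSpace ℝ (Fin n) × ℝ

/-- The Euclidean norm on `ℝ^{n+1} = ℝⁿ × ℝ`. -/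
def enorm' {n : ℕ} (X : Pt n) : ℝ := Real.sqrt (‖X.1‖ ^ 2 + X.2 ^ 2)

/-- Partial derivative in the last (`t`) direction. -/
def dt {n : ℕ} (U : Pt n → ℝ) (X : Pt n) : ℝ := fderiv ℝ U X (0, 1)

/-- Second derivative in the direction `v`. -/
def d2 {n : ℕ} (U : Pt n → ℝ) (X v : Pt n) : ℝ :=
  fderiv ℝ (fun Y => fderiv ℝ U Y v) X v

/-- The Laplacian on `ℝ^{n+1}`. -/
def lapl {n : ℕ} (U : Pt n → ℝ) (X : Pt n) : ℝ :=
  (∑ i : Fin n, d2 U X (EuclideanSpace.single i (1 : ℝ), (0 : ℝ))) + d2 U X (0, 1)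

/-- `U` is a nonnegative solution of the extension problem on the punctured half-ball
`𝔅_R^+`: it is nonnegative and continuous on `{|X| ≤ R, t ≥ 0} \ {0}`, `C²` on `𝔅_R^+`,
satisfies `ΔU + ((1-2σ)/t) ∂_t U = 0` there, and satisfies the nonlinear Neumann condition
`lim_{t→0⁺} t^{1-2σ} ∂_t U(x,t) = -u(x)^{(n+2σ)/(n-2σ)}` for `x ∈ B_R \ {0}`. -/
def ExtSol (n : ℕ) (σ R : ℝ) (U : Pt n → ℝ) : Prop :=
  (∀ X : Pt n, enorm' X ≤ R → 0 ≤ X.2 → X ≠ 0 → 0 ≤ U X) ∧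
  ContinuousOn U ({X : Pt n | enorm' X ≤ R ∧ 0 ≤ X.2} \ {0}) ∧
  ContDiffOn ℝ 2 U {X : Pt n | enorm' X < R ∧ 0 < X.2} ∧
  (∀ X : Pt n, enorm' X < R → 0 < X.2 →
    lapl U X + ((1 - 2 * σ) / X.2) * dt U X = 0) ∧
  (∀ x : EuclideanSpace ℝ (Fin n), ‖x‖ < R → x ≠ 0 →
    Tendsto (fun t : ℝ => t ^ (1 - 2 * σ) * dt U (x, t)) (𝓝[>] 0)
      (𝓝 (-(U (x, 0) ^ (((n : ℝ) + 2 * σ) / ((n : ℝ) - 2 * σ))))))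

/-- `U` is a nonnegative solution of the global extension problem: nonnegative and
continuous on `{t ≥ 0} \ {0}`, `C²` on `ℝ^{n+1}_+`, satisfying the degenerate equation
there and the nonlinear Neumann condition on `ℝⁿ \ {0}`. -/
def GlobalExtSol (n : ℕ) (σ : ℝ) (U : Pt n → ℝ) : Prop :=
  (∀ X : Pt n, 0 ≤ X.2 → X ≠ 0 → 0 ≤ U X) ∧
  ContinuousOn U ({X : Pt n | 0 ≤ X.2} \ {0}) ∧
  ContDiffOn ℝ 2 U {X : Pt n | 0 < X.2} ∧
  (∀ X : Pt n, 0 < X.2 → lapl U X + ((1 - 2 * σ) / X.2) * dt U X = 0) ∧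
  (∀ x : EuclideanSpace ℝ (Fin n), x ≠ 0 →
    Tendsto (fun t : ℝ => t ^ (1 - 2 * σ) * dt U (x, t)) (𝓝[>] 0)
      (𝓝 (-(U (x, 0) ^ (((n : ℝ) + 2 * σ) / ((n : ℝ) - 2 * σ))))))


/-- The operator `Δ + ((1-2σ)/t) ∂_t`. -/
def extOp {n : ℕ} (σ : ℝ) (w : Pt n → ℝ) (X : Pt n) : ℝ :=
  lapl w X + ((1 - 2 * σ) / X.2) * dt w X

/-- The weighted normal derivative of `w` at `(x, 0)`, as the limit of the quotients
`(w (x, t) - w (x, 0)) / t ^ (2σ)`, is `l`. -/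
def HasNormalQuot {n : ℕ} (σ : ℝ) (w : Pt n → ℝ) (x : EuclideanSpace ℝ (Fin n)) (l : ℝ) : Prop :=
  Tendsto (fun t : ℝ => (w (x, t) - w (x, 0)) / t ^ (2 * σ)) (𝓝[>] 0) (𝓝 l)

section Calculus

variable {n : ℕ} {σ : ℝ}

theorem line_hasDerivAt (P e : Pt n) (s : ℝ) : HasDerivAt (fun s : ℝ => P + s • e) e s := by
  simpa using ((hasDerivAt_id s).smul_const e).const_add P

theorem ContDiffAt.eventually_hasDerivAt_curve {U : Pt n → ℝ} {T T1 : ℝ → Pt n}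
    (hU : ContDiffAt ℝ 2 U (T 0)) (hT : ∀ᶠ s in 𝓝 (0 : ℝ), HasDerivAt T (T1 s) s) :
    ∀ᶠ s in 𝓝 (0 : ℝ), HasDerivAt (fun s => U (T s)) (fderiv ℝ U (T s) (T1 s)) s := by
  have h1 : ∀ᶠ Y in 𝓝 (T 0), DifferentiableAt ℝ U Y :=
    (hU.eventually (by simp)).mono fun Y hY => hY.differentiableAt (by simp)
  have hc : ContinuousAt T 0 := hT.self_of_nhds.continuousAt
  filter_upwards [hc.eventually h1, hT] with s hs hTs
  exact hs.hasFDerivAt.comp_hasDerivAt s hTs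

theorem ContDiffAt.differentiableAt_fderiv_two {U : Pt n → ℝ} {P : Pt n}
    (hU : ContDiffAt ℝ 2 U P) : DifferentiableAt ℝ (fderiv ℝ U) P :=
  (hU.fderiv_right (m := 1) (by norm_num)).differentiableAt (by simp)

theorem d2_eq_fderiv_fderiv {U : Pt n → ℝ} {P : Pt n} (hU : ContDiffAt ℝ 2 U P) (v : Pt n) :
    d2 U P v = fderiv ℝ (fderiv ℝ U) P v v := by
  unfold d2
  have h := hU.differentiableAt_fderiv_two.hasFDerivAt.clm_apply (hasFDerivAt_const v P)
  rw [h.fderiv]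
  simp

theorem ContDiffAt.hasDerivAt_fderiv_curve {U : Pt n → ℝ} {T T1 : ℝ → Pt n} {T2 : Pt n}
    (hU : ContDiffAt ℝ 2 U (T 0)) (hT : HasDerivAt T (T1 0) 0) (hT1 : HasDerivAt T1 T2 0) :
    HasDerivAt (fun s => fderiv ℝ U (T s) (T1 s))
      (fderiv ℝ (fderiv ℝ U) (T 0) (T1 0) (T1 0) + fderiv ℝ U (T 0) T2) 0 :=
  (hU.differentiableAt_fderiv_two.hasFDerivAt.comp_hasDerivAt (0 : ℝ) hT).clm_apply hT1

theorem fderiv_eq_of_line {v : Pt n → ℝ} {P e : Pt n} (hv : ContDiffAt ℝ 2 v P) {g : ℝ}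
    (h : HasDerivAt (fun s : ℝ => v (P + s • e)) g 0) : fderiv ℝ v P e = g := by
  have h0 : P + (0 : ℝ) • e = P := by simp
  have hv' : ContDiffAt ℝ 2 v (P + (0 : ℝ) • e) := by rwa [h0]
  have := (hv'.eventually_hasDerivAt_curve (T := fun s : ℝ => P + s • e) (T1 := fun _ => e)
    (Eventually.of_forall fun s => line_hasDerivAt P e s)).self_of_nhds
  simp only [h0] at this
  exact this.unique h

theorem d2_eq_of_line {v : Pt n → ℝ} {P e : Pt n} (hv : ContDiffAt ℝ 2 v P) {g1 : ℝ → ℝ} {g2 : ℝ}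
    (h1 : ∀ᶠ s in 𝓝 (0 : ℝ), HasDerivAt (fun s : ℝ => v (P + s • e)) (g1 s) s)
    (h2 : HasDerivAt g1 g2 0) : d2 v P e = g2 := by
  have h0 : P + (0 : ℝ) • e = P := by simp
  have hv' : ContDiffAt ℝ 2 v (P + (0 : ℝ) • e) := by rwa [h0]
  have h3 := hv'.eventually_hasDerivAt_curve (T := fun s : ℝ => P + s • e) (T1 := fun _ => e)
    (Eventually.of_forall fun s => line_hasDerivAt P e s)
  have h4 := hv'.hasDerivAt_fderiv_curve (T := fun s : ℝ => P + s • e) (T1 := fun _ => e)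
    (line_hasDerivAt P e 0) (hasDerivAt_const (0 : ℝ) e)
  have h5 : g1 =ᶠ[𝓝 0] fun s => fderiv ℝ v (P + s • e) e := by
    filter_upwards [h1, h3] with s hs hs'
    exact hs.unique hs'
  have h6 := (h5.hasDerivAt_iff).1 h2
  have := h4.unique h6
  simp only [h0] at this
  rw [d2_eq_fderiv_fderiv hv, ← this]
  simp

/-- First and second derivatives along a line of a function of the form `k * U ∘ T`. -/
theorem d2_eq_of_mul_curve {V U : Pt n → ℝ} {P e : Pt n} {k k1 : ℝ → ℝ} {k2 : ℝ}
    {T T1 : ℝ → Pt n} {T2 : Pt n} (hV : ContDiffAt ℝ 2 V P) (hU : ContDiffAt ℝ 2 U (T 0))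
    (hVU : ∀ᶠ s in 𝓝 (0 : ℝ), V (P + s • e) = k s * U (T s))
    (hk : ∀ᶠ s in 𝓝 (0 : ℝ), HasDerivAt k (k1 s) s) (hk1 : HasDerivAt k1 k2 0)
    (hT : ∀ᶠ s in 𝓝 (0 : ℝ), HasDerivAt T (T1 s) s) (hT1 : HasDerivAt T1 T2 0) :
    fderiv ℝ V P e = k1 0 * U (T 0) + k 0 * fderiv ℝ U (T 0) (T1 0) ∧
    d2 V P e = k2 * U (T 0) + 2 * (k1 0 * fderiv ℝ U (T 0) (T1 0)) +
      k 0 * (fderiv ℝ (fderiv ℝ U) (T 0) (T1 0) (T1 0) + fderiv ℝ U (T 0) T2) := by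
  have hUT := hU.eventually_hasDerivAt_curve hT
  have h1 : ∀ᶠ s in 𝓝 (0 : ℝ), HasDerivAt (fun s : ℝ => V (P + s • e))
      (k1 s * U (T s) + k s * fderiv ℝ U (T s) (T1 s)) s := by
    filter_upwards [hUT, hk, hVU.eventually_nhds] with s h1 h2 h3
    exact (h2.mul h1).congr_of_eventuallyEq h3
  refine ⟨fderiv_eq_of_line hV h1.self_of_nhds, ?_⟩
  have h2 : HasDerivAt (fun s => k1 s * U (T s) + k s * fderiv ℝ U (T s) (T1 s)) _ 0 :=
    (hk1.mul hUT.self_of_nhds).add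
      (hk.self_of_nhds.mul (hU.hasDerivAt_fderiv_curve hT.self_of_nhds hT1))
  rw [d2_eq_of_line hV h1 h2]
  ring

theorem d2_add {v w : Pt n → ℝ} {P : Pt n} (hv : ContDiffAt ℝ 2 v P) (hw : ContDiffAt ℝ 2 w P)
    (e : Pt n) : d2 (fun Y => v Y + w Y) P e = d2 v P e + d2 w P e := by
  have h0 : P + (0 : ℝ) • e = P := by simp
  have key : ∀ u : Pt n → ℝ, ContDiffAt ℝ 2 u P →
      (∀ᶠ s in 𝓝 (0 : ℝ), HasDerivAt (fun s : ℝ => u (P + s • e)) (fderiv ℝ u (P + s • e) e) s) ∧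
      HasDerivAt (fun s : ℝ => fderiv ℝ u (P + s • e) e) (d2 u P e) 0 := by
    intro u hu
    have hu' : ContDiffAt ℝ 2 u (P + (0 : ℝ) • e) := by rwa [h0]
    refine ⟨hu'.eventually_hasDerivAt_curve (T := fun s : ℝ => P + s • e) (T1 := fun _ => e)
      (Eventually.of_forall fun s => line_hasDerivAt P e s), ?_⟩
    have h4 := hu'.hasDerivAt_fderiv_curve (T := fun s : ℝ => P + s • e) (T1 := fun _ => e)
      (line_hasDerivAt P e 0) (hasDerivAt_const (0 : ℝ) e)
    simpa [h0, d2_eq_fderiv_fderiv hu] using h4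
  obtain ⟨a1, a2⟩ := key v hv
  obtain ⟨b1, b2⟩ := key w hw
  refine d2_eq_of_line (hv.add hw) ?_ (a2.add b2)
  filter_upwards [a1, b1] with s h1 h2
  exact h1.add h2

theorem extOp_add {v w : Pt n → ℝ} {P : Pt n} (hv : ContDiffAt ℝ 2 v P)
    (hw : ContDiffAt ℝ 2 w P) :
    extOp σ (fun Y => v Y + w Y) P = extOp σ v P + extOp σ w P := by
  have h : fderiv ℝ (fun Y => v Y + w Y) P = fderiv ℝ v P + fderiv ℝ w P :=
    fderiv_add (hv.differentiableAt (by simp)) (hw.differentiableAt (by simp))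
  simp only [extOp, lapl, dt, d2_add hv hw, h, Finset.sum_add_distrib, add_apply]
  ring

theorem d2_const_mul (c : ℝ) {v : Pt n → ℝ} {P : Pt n} (hv : ContDiffAt ℝ 2 v P)
    (e : Pt n) : d2 (fun Y => c * v Y) P e = c * d2 v P e := by
  have h0 : P + (0 : ℝ) • e = P := by simp
  have hv' : ContDiffAt ℝ 2 v (P + (0 : ℝ) • e) := by rwa [h0]
  have := (d2_eq_of_mul_curve (V := fun Y => c * v Y) (U := v) (P := P) (e := e) (k := fun _ => c)
    (k1 := fun _ => 0) (T := fun s : ℝ => P + s • e) (T1 := fun _ => e) (contDiffAt_const.mul hv)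
    hv' (Eventually.of_forall fun s => rfl)
    (Eventually.of_forall fun s => hasDerivAt_const s c) (hasDerivAt_const _ _)
    (Eventually.of_forall fun s => line_hasDerivAt P e s) (hasDerivAt_const _ _)).2
  simpa [h0, d2_eq_fderiv_fderiv hv] using this

theorem extOp_const_mul (c : ℝ) {v : Pt n → ℝ} {P : Pt n} (hv : ContDiffAt ℝ 2 v P) :
    extOp σ (fun Y => c * v Y) P = c * extOp σ v P := by
  have h : fderiv ℝ (fun Y => c * v Y) P = c • fderiv ℝ v P :=
    fderiv_const_mul (hv.differentiableAt (by simp)) c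
  simp only [extOp, lapl, dt, d2_const_mul c hv, h, ← Finset.mul_sum, smul_apply,
    smul_eq_mul]
  ring

theorem extOp_sub {v w : Pt n → ℝ} {P : Pt n} (hv : ContDiffAt ℝ 2 v P)
    (hw : ContDiffAt ℝ 2 w P) :
    extOp σ (fun Y => v Y - w Y) P = extOp σ v P - extOp σ w P := by
  have h1 : (fun Y => v Y - w Y) = fun Y => v Y + (-1) * w Y := by ext; ring
  rw [h1, extOp_add hv (contDiffAt_const.mul hw), extOp_const_mul _ hw]
  ring

theorem extOp_const (c : ℝ) (P : Pt n) : extOp σ (fun _ => c) P = 0 := by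
  simp [extOp, lapl, dt, d2]

theorem HasNormalQuot.add {v w : Pt n → ℝ} {x : EuclideanSpace ℝ (Fin n)} {l m : ℝ}
    (hv : HasNormalQuot σ v x l) (hw : HasNormalQuot σ w x m) :
    HasNormalQuot σ (fun Y => v Y + w Y) x (l + m) :=
  (Tendsto.add hv hw).congr fun t => by ring

theorem HasNormalQuot.const_mul {v : Pt n → ℝ} {x : EuclideanSpace ℝ (Fin n)} {l : ℝ} (c : ℝ)
    (hv : HasNormalQuot σ v x l) : HasNormalQuot σ (fun Y => c * v Y) x (c * l) :=
  (Tendsto.const_mul c hv).congr fun t => by ring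

theorem HasNormalQuot.sub {v w : Pt n → ℝ} {x : EuclideanSpace ℝ (Fin n)} {l m : ℝ}
    (hv : HasNormalQuot σ v x l) (hw : HasNormalQuot σ w x m) :
    HasNormalQuot σ (fun Y => v Y - w Y) x (l - m) :=
  (Tendsto.sub hv hw).congr fun t => by ring

theorem hasNormalQuot_of_horizontal (f : EuclideanSpace ℝ (Fin n) → ℝ)
    (x : EuclideanSpace ℝ (Fin n)) : HasNormalQuot σ (fun Y => f Y.1) x 0 := by
  simp [HasNormalQuot]

theorem hasNormalQuot_rpow (hσ : 0 < σ) (x : EuclideanSpace ℝ (Fin n)) :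
    HasNormalQuot σ (fun Y => Y.2 ^ (2 * σ)) x 1 := by
  refine tendsto_const_nhds.congr' ?_
  filter_upwards [self_mem_nhdsWithin] with t ht
  have : (0 : ℝ) < t ^ (2 * σ) := Real.rpow_pos_of_pos ht _
  simp [Real.zero_rpow (by positivity : 2 * σ ≠ 0), this.ne']

/-- Functions that are differentiable in `t ^ 2` have vanishing weighted normal derivative. -/
theorem tendsto_even_quot (hσ : σ ∈ Set.Ioo (0 : ℝ) 1) {K : ℝ → ℝ} (hK : DifferentiableAt ℝ K 0) :
    Tendsto (fun t : ℝ => (K (t ^ 2) - K 0) / t ^ (2 * σ)) (𝓝[>] 0) (𝓝 0) := by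
  have h1 : Tendsto (fun t : ℝ => t ^ 2) (𝓝[>] 0) (𝓝[≠] 0) := by
    refine tendsto_nhdsWithin_of_tendsto_nhds_of_eventually_within _ ?_ ?_
    · have : Tendsto (fun t : ℝ => t ^ 2) (𝓝 0) (𝓝 (0 ^ 2)) := (continuous_pow 2).tendsto 0
      simpa using this.mono_left nhdsWithin_le_nhds
    · filter_upwards [self_mem_nhdsWithin] with t ht
      have : (0 : ℝ) < t := ht
      simp [this.ne']
  have h2 := hK.hasDerivAt.tendsto_slope.comp h1
  have h3 : Tendsto (fun t : ℝ => t ^ (2 - 2 * σ)) (𝓝[>] 0) (𝓝 0) := by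
    have hp : 0 < 2 - 2 * σ := by linarith [hσ.2]
    have := (Real.continuous_rpow_const hp.le).tendsto 0
    rw [Real.zero_rpow hp.ne'] at this
    exact this.mono_left nhdsWithin_le_nhds
  have h4 := h2.mul h3
  rw [mul_zero] at h4
  refine h4.congr' ?_
  filter_upwards [self_mem_nhdsWithin] with t ht
  have ht : (0 : ℝ) < t := ht
  simp only [Function.comp, slope_def_field, sub_zero]
  rw [Real.rpow_sub ht]
  have : (t : ℝ) ^ (2 * σ) ≠ 0 := (Real.rpow_pos_of_pos ht _).ne'
  norm_cast
  field_simp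

theorem hasNormalQuot_sq (hσ : σ ∈ Set.Ioo (0 : ℝ) 1) (x : EuclideanSpace ℝ (Fin n)) :
    HasNormalQuot σ (fun Y => Y.2 ^ 2) x 0 := by
  have := tendsto_even_quot hσ (K := id) differentiableAt_id
  simpa [HasNormalQuot] using this

theorem sum_single_apply (l : Pt n →L[ℝ] ℝ) (X : Pt n) :
    (∑ i : Fin n, X.1 i * l (EuclideanSpace.single i 1, 0)) + X.2 * l (0, 1) = l X := by
  have h : X = (∑ i : Fin n, X.1 i • ((EuclideanSpace.single i (1 : ℝ), (0 : ℝ)) : Pt n)) +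
      X.2 • (0, 1) := by
    refine Prod.ext ?_ ?_
    · ext j
      simp [Prod.fst_sum, Finset.sum_apply, Pi.single_apply]
    · simp [Prod.snd_sum]
  conv_rhs => rw [h]
  rw [map_add, map_sum]
  simp only [map_smul, smul_eq_mul]

end Calculus

section Comparison

variable {n : ℕ} {σ : ℝ}

theorem IsLocalMin.d2_nonneg {v : Pt n → ℝ} {P : Pt n} (hmin : IsLocalMin v P)
    (hv : ContDiffAt ℝ 2 v P) (e : Pt n) : 0 ≤ d2 v P e := by
  have h0 : P + (0 : ℝ) • e = P := by simp
  have hv' : ContDiffAt ℝ 2 v (P + (0 : ℝ) • e) := by rwa [h0]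
  have h3 := hv'.eventually_hasDerivAt_curve (T := fun s : ℝ => P + s • e) (T1 := fun _ => e)
    (Eventually.of_forall fun s => line_hasDerivAt P e s)
  have h4 := hv'.hasDerivAt_fderiv_curve (T := fun s : ℝ => P + s • e) (T1 := fun _ => e)
    (line_hasDerivAt P e 0) (hasDerivAt_const (0 : ℝ) e)
  simp only [h0, map_zero, add_zero, ← d2_eq_fderiv_fderiv hv] at h4
  have hlm : ∀ᶠ s in 𝓝 (0 : ℝ), v P ≤ v (P + s • e) := by
    have hc : Tendsto (fun s : ℝ => P + s • e) (𝓝 0) (𝓝 P) := by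
      simpa [h0] using (line_hasDerivAt P e 0).continuousAt.tendsto
    exact hc.eventually hmin
  set g : ℝ → ℝ := fun s => v (P + s • e) with hg
  have hg0 : g 0 = v P := by simp [hg]
  have hmin' : IsLocalMin g 0 := by
    filter_upwards [hlm] with s hs
    rw [hg0]; exact hs
  by_contra! hneg
  have hd1 : deriv g =ᶠ[𝓝 0] fun s => fderiv ℝ v (P + s • e) e := by
    filter_upwards [h3] with s hs using hs.deriv
  have hd2 : deriv (deriv g) 0 = d2 v P e := by
    rw [hd1.deriv_eq]; exact h4.deriv
  have hmax : IsLocalMax g 0 :=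
    isLocalMax_of_deriv_deriv_neg (by rw [hd2]; exact hneg) hmin'.deriv_eq_zero
      h3.self_of_nhds.continuousAt
  have hconst : g =ᶠ[𝓝 0] fun _ => g 0 := by
    filter_upwards [hmin', hmax] with s h1 h2 using le_antisymm h2 h1
  have : deriv (deriv g) 0 = 0 := by
    rw [hconst.deriv.deriv_eq]; simp
  linarith

theorem IsLocalMin.extOp_nonneg {v : Pt n → ℝ} {P : Pt n} (hmin : IsLocalMin v P)
    (hv : ContDiffAt ℝ 2 v P) : 0 ≤ extOp σ v P := by
  have h : dt v P = 0 := by simp [dt, hmin.fderiv_eq_zero]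
  rw [extOp, h, mul_zero, add_zero]
  exact add_nonneg (Finset.sum_nonneg fun i _ => hmin.d2_nonneg hv _) (hmin.d2_nonneg hv _)

theorem HasNormalQuot.nonneg_of_min {v : Pt n → ℝ} {x : EuclideanSpace ℝ (Fin n)} {l : ℝ}
    (hl : HasNormalQuot σ v x l) (hmin : ∀ᶠ t in 𝓝[>] (0 : ℝ), v (x, 0) ≤ v (x, t)) : 0 ≤ l := by
  refine ge_of_tendsto hl ?_
  filter_upwards [hmin, self_mem_nhdsWithin] with t h1 h2
  exact div_nonneg (by linarith) (Real.rpow_nonneg (le_of_lt h2) _)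

/-- Comparison principle relative to a positive supersolution `φ`. -/
theorem nonneg_of_comparison {K : Set (Pt n)} (hK : IsCompact K) {w φ : Pt n → ℝ}
    (hw : ContinuousOn w K) (hφ : ContinuousOn φ K) (hpos : ∀ P ∈ K, 0 < φ P)
    (h : ∀ P ∈ K, w P < 0 →
      (K ∈ 𝓝 P ∧ ContDiffAt ℝ 2 w P ∧ ContDiffAt ℝ 2 φ P ∧ extOp σ w P ≤ 0 ∧ extOp σ φ P < 0) ∨
      (P.2 = 0 ∧ (∀ᶠ t in 𝓝[>] (0 : ℝ), (P.1, t) ∈ K) ∧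
        ∃ l m, HasNormalQuot σ w P.1 l ∧ HasNormalQuot σ φ P.1 m ∧ l * φ P < m * w P)) :
    ∀ P ∈ K, 0 ≤ w P := by
  intro P0 hP0
  by_contra! hneg
  obtain ⟨P, hP, hmin⟩ := hK.exists_isMinOn ⟨P0, hP0⟩ (hw.div hφ fun Q hQ => (hpos Q hQ).ne')
  set m := w P / φ P with hm
  have hm0 : m < 0 := lt_of_le_of_lt (hmin hP0) (div_neg_of_neg_of_pos hneg (hpos P0 hP0))
  have hwP : w P = m * φ P := by rw [hm]; field_simp [(hpos P hP).ne']
  have hge : ∀ Q ∈ K, m * φ Q ≤ w Q := fun Q hQ => by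
    have : m ≤ w Q / φ Q := hmin hQ
    exact (le_div_iff₀ (hpos Q hQ)).1 this
  have hwneg : w P < 0 := by rw [hwP]; exact mul_neg_of_neg_of_pos hm0 (hpos P hP)
  rcases h P hP hwneg with ⟨hKP, hcw, hcφ, h1, h2⟩ | ⟨hP2, hKP, l, l', h1, h2, h3⟩
  · have hlm : IsLocalMin (fun Y => w Y - m * φ Y) P := by
      filter_upwards [hKP] with Q hQ
      linarith [hge Q hQ]
    have := hlm.extOp_nonneg (σ := σ) (hcw.sub (contDiffAt_const.mul hcφ))
    rw [extOp_sub hcw (contDiffAt_const.mul hcφ), extOp_const_mul m hcφ] at this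
    nlinarith
  · have h4 := h1.sub (h2.const_mul m)
    have hPe : P = (P.1, 0) := Prod.ext rfl hP2
    have h5 := h4.nonneg_of_min (by
      filter_upwards [hKP] with t ht
      have := hge _ ht
      rw [hPe] at hwP
      linarith)
    have hφP := hpos P hP
    rw [hwP] at h3
    nlinarith

end Comparison

section Explicit

variable {n : ℕ} {σ : ℝ}

/-- The Euclidean inner product on `ℝⁿ × ℝ`. -/
def euclInner (X Y : Pt n) : ℝ := ⟪X.1, Y.1⟫ + X.2 * Y.2

/-- The square of the Euclidean distance on `ℝⁿ × ℝ`. -/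
def sqDist (Y X : Pt n) : ℝ := ‖X.1 - Y.1‖ ^ 2 + (X.2 - Y.2) ^ 2

theorem euclInner_single (X : Pt n) (i : Fin n) :
    euclInner X (EuclideanSpace.single i 1, 0) = X.1 i := by
  simp [euclInner, EuclideanSpace.inner_single_right]

theorem euclInner_vert (X : Pt n) : euclInner X (0, 1) = X.2 := by
  simp [euclInner]

theorem euclInner_self_eq_sum (X : Pt n) :
    (∑ i : Fin n, X.1 i ^ 2) + X.2 ^ 2 = euclInner X X := by
  rw [euclInner, real_inner_self_eq_norm_sq, EuclideanSpace.real_norm_sq_eq]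
  ring

theorem sqDist_eq (Y X : Pt n) : sqDist Y X = euclInner (X - Y) (X - Y) := by
  simp [sqDist, euclInner, pow_two]

theorem sqDist_nonneg (Y X : Pt n) : 0 ≤ sqDist Y X := by unfold sqDist; positivity

theorem sqDist_pos {Y X : Pt n} (h : X ≠ Y) : 0 < sqDist Y X := by
  rcases (sqDist_nonneg Y X).lt_or_eq with h1 | h1
  · exact h1
  · exfalso
    apply h
    unfold sqDist at h1
    have h2 : ‖X.1 - Y.1‖ ^ 2 = 0 := by nlinarith [sq_nonneg ‖X.1 - Y.1‖, sq_nonneg (X.2 - Y.2)]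
    have h3 : (X.2 - Y.2) ^ 2 = 0 := by nlinarith [sq_nonneg ‖X.1 - Y.1‖, sq_nonneg (X.2 - Y.2)]
    refine Prod.ext ?_ ?_
    · simpa [sub_eq_zero] using h2
    · simpa [sub_eq_zero] using h3

theorem continuous_sqDist (Y : Pt n) : Continuous (sqDist Y) := by
  unfold sqDist; fun_prop

theorem contDiff_sqDist (Y : Pt n) {k : WithTop ℕ∞} : ContDiff ℝ k (sqDist Y) := by
  unfold sqDist
  exact ((contDiff_fst.sub contDiff_const).norm_sq ℝ).add ((contDiff_snd.sub contDiff_const).pow 2)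

theorem sqDist_line (Y P e : Pt n) (s : ℝ) :
    sqDist Y (P + s • e) = sqDist Y P + 2 * s * euclInner (P - Y) e + s ^ 2 * euclInner e e := by
  simp only [sqDist_eq, euclInner, Prod.fst_add, Prod.snd_add, Prod.smul_fst, Prod.smul_snd,
    Prod.fst_sub, Prod.snd_sub, add_sub_right_comm, inner_add_left, inner_add_right,
    real_inner_smul_left, real_inner_smul_right, smul_eq_mul, real_inner_comm e.1 (P.1 - Y.1)]
  ring

theorem hasDerivAt_sqDist_line (Y P e : Pt n) (s : ℝ) :
    HasDerivAt (fun s : ℝ => sqDist Y (P + s • e))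
      (2 * euclInner (P - Y) e + 2 * s * euclInner e e) s := by
  simp only [sqDist_line]
  have h1 := ((hasDerivAt_id s).const_mul 2).mul_const (euclInner (P - Y) e)
  have h2 := ((hasDerivAt_id s).pow 2).mul_const (euclInner e e)
  refine ((h1.const_add (sqDist Y P)).add h2).congr_deriv ?_
  simp

theorem hasDerivAt_affine (a b s : ℝ) : HasDerivAt (fun s : ℝ => a + s * b) b s := by
  simpa using ((hasDerivAt_id s).mul_const b).const_add a

theorem extOp_radial (Y P : Pt n) {F F1 : ℝ → ℝ} {F2 : ℝ} (hF : ContDiffAt ℝ 2 F (sqDist Y P))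
    (h1 : ∀ᶠ y in 𝓝 (sqDist Y P), HasDerivAt F (F1 y) y) (h2 : HasDerivAt F1 F2 (sqDist Y P)) :
    extOp σ (fun X => F (sqDist Y X)) P = 4 * sqDist Y P * F2 + 2 * (n + 1) * F1 (sqDist Y P) +
      (1 - 2 * σ) / P.2 * (2 * (P.2 - Y.2) * F1 (sqDist Y P)) := by
  have hc : ContDiffAt ℝ 2 (fun X => F (sqDist Y X)) P := hF.comp P (contDiff_sqDist Y).contDiffAt
  have h0 : ∀ e : Pt n, sqDist Y (P + (0 : ℝ) • e) = sqDist Y P := fun e => by simp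
  have hd : ∀ e : Pt n, fderiv ℝ (fun X => F (sqDist Y X)) P e =
        2 * euclInner (P - Y) e * F1 (sqDist Y P) ∧
      d2 (fun X => F (sqDist Y X)) P e = 4 * F2 * euclInner (P - Y) e ^ 2 +
        2 * F1 (sqDist Y P) * euclInner e e := by
    intro e
    have hq := hasDerivAt_sqDist_line Y P e
    have e1 : ∀ᶠ s in 𝓝 (0 : ℝ), HasDerivAt (fun s : ℝ => F (sqDist Y (P + s • e)))
        (F1 (sqDist Y (P + s • e)) * (2 * euclInner (P - Y) e + 2 * s * euclInner e e)) s := by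
      have : Tendsto (fun s : ℝ => sqDist Y (P + s • e)) (𝓝 0) (𝓝 (sqDist Y P)) := by
        simpa [h0] using (hq 0).continuousAt.tendsto
      filter_upwards [this.eventually h1] with s hs
      exact hs.comp s (hq s)
    have h2' : HasDerivAt F1 F2 (sqDist Y (P + (0 : ℝ) • e)) := by rwa [h0]
    have e2 := (h2'.comp (0 : ℝ) (hq 0)).mul
      (hasDerivAt_affine (2 * euclInner (P - Y) e) (2 * euclInner e e) 0)
    constructor
    · rw [fderiv_eq_of_line hc e1.self_of_nhds]
      simp
      ring
    · rw [d2_eq_of_line (g2 := 4 * F2 * euclInner (P - Y) e ^ 2 +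
        2 * F1 (sqDist Y P) * euclInner e e) hc e1]
      refine (e2.congr_deriv ?_).congr_of_eventuallyEq (Eventually.of_forall fun s => ?_)
      · simp
        ring
      · simp only [Function.comp, Pi.mul_apply]
        ring
  have hsum := euclInner_self_eq_sum (P - Y)
  rw [← sqDist_eq] at hsum
  simp only [extOp, lapl, dt, (hd _).1, (hd _).2, euclInner_single, euclInner_vert,
    Finset.sum_add_distrib, ← Finset.mul_sum]
  have h3 : (∑ i : Fin n, (EuclideanSpace.single i (1 : ℝ) : EuclideanSpace ℝ (Fin n)) i) = n := by
    simp
  rw [h3, ← hsum, Prod.snd_sub]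
  ring

theorem extOp_vertical (P : Pt n) {F F1 : ℝ → ℝ} {F2 : ℝ} (hF : ContDiffAt ℝ 2 F P.2)
    (h1 : ∀ᶠ y in 𝓝 P.2, HasDerivAt F (F1 y) y) (h2 : HasDerivAt F1 F2 P.2) :
    extOp σ (fun X : Pt n => F X.2) P = F2 + (1 - 2 * σ) / P.2 * F1 P.2 := by
  have hc : ContDiffAt ℝ 2 (fun X : Pt n => F X.2) P := hF.comp P contDiff_snd.contDiffAt
  have hd : ∀ e : Pt n, fderiv ℝ (fun X : Pt n => F X.2) P e = F1 P.2 * e.2 ∧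
      d2 (fun X : Pt n => F X.2) P e = F2 * e.2 ^ 2 := by
    intro e
    have e1 : ∀ᶠ s in 𝓝 (0 : ℝ), HasDerivAt (fun s : ℝ => F (P + s • e).2)
        (F1 (P.2 + s * e.2) * e.2) s := by
      have : Tendsto (fun s : ℝ => P.2 + s * e.2) (𝓝 0) (𝓝 P.2) := by
        simpa using (hasDerivAt_affine P.2 e.2 0).continuousAt.tendsto
      filter_upwards [this.eventually h1] with s hs
      exact hs.comp s (hasDerivAt_affine P.2 e.2 s)
    have h2' : HasDerivAt F1 F2 (P.2 + 0 * e.2) := by simpa using h2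
    have e2 := (h2'.comp (0 : ℝ) (hasDerivAt_affine P.2 e.2 0)).mul_const e.2
    constructor
    · rw [fderiv_eq_of_line hc e1.self_of_nhds]
      simp
    · rw [d2_eq_of_line hc e1 e2]
      ring
  simp [extOp, lapl, dt, (hd _).1, (hd _).2]

theorem extOp_rpow (P : Pt n) (hP : 0 < P.2) :
    extOp σ (fun X : Pt n => X.2 ^ (2 * σ)) P = 0 := by
  have h1 : ∀ p : ℝ, ∀ᶠ y in 𝓝 P.2, HasDerivAt (fun y : ℝ => y ^ p) (p * y ^ (p - 1)) y := by
    intro p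
    filter_upwards [lt_mem_nhds hP] with y hy
    exact Real.hasDerivAt_rpow_const (Or.inl hy.ne')
  have h2 := (h1 (2 * σ - 1)).self_of_nhds.const_mul (2 * σ)
  rw [extOp_vertical (F := fun y => y ^ (2 * σ)) P (contDiffAt_id.rpow_const_of_ne hP.ne') (h1 _) h2]
  rw [show P.2 ^ (2 * σ - 1) = P.2 ^ (2 * σ - 1 - 1) * P.2 by
    rw [← Real.rpow_add_one hP.ne']; ring_nf]
  field_simp
  ring

theorem contDiffAt_rpow_snd (P : Pt n) (hP : 0 < P.2) (p : ℝ) :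
    ContDiffAt ℝ 2 (fun X : Pt n => X.2 ^ p) P :=
  contDiff_snd.contDiffAt.rpow_const_of_ne hP.ne'

theorem extOp_sq (P : Pt n) (hP : 0 < P.2) :
    extOp σ (fun X : Pt n => X.2 ^ 2) P = 4 - 4 * σ := by
  rw [extOp_vertical (F := fun y => y ^ 2) (F1 := fun y => 2 * y) (F2 := 2) P
    (contDiffAt_id.pow 2) (Eventually.of_forall fun y => by simpa using hasDerivAt_pow 2 y)
    (by simpa using (hasDerivAt_id P.2).const_mul 2)]
  field_simp
  ring

theorem extOp_sqDist (x : EuclideanSpace ℝ (Fin n)) (P : Pt n) (hP : 0 < P.2) :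
    extOp σ (sqDist (x, 0)) P = 2 * n + 4 - 4 * σ := by
  have := extOp_radial (σ := σ) (F := id) (F1 := fun _ => 1) (F2 := 0) ((x, 0) : Pt n) P
    contDiffAt_id (Eventually.of_forall fun y => hasDerivAt_id y) (hasDerivAt_const _ _)
  simp only [id] at this
  rw [show (fun X => sqDist ((x, 0) : Pt n) X) = sqDist (x, 0) from rfl] at this
  rw [this]
  field_simp
  ring

theorem contDiff_affine (e : EuclideanSpace ℝ (Fin n)) (c : ℝ) {k : WithTop ℕ∞} :
    ContDiff ℝ k (fun X : Pt n => ⟪e, X.1⟫ - c) :=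
  (contDiff_const.inner ℝ contDiff_fst).sub contDiff_const

theorem hasDerivAt_affine_line (e : EuclideanSpace ℝ (Fin n)) (c : ℝ) (P v : Pt n) (s : ℝ) :
    HasDerivAt (fun s : ℝ => ⟪e, (P + s • v).1⟫ - c) ⟪e, v.1⟫ s := by
  have : (fun s : ℝ => ⟪e, (P + s • v).1⟫ - c) = fun s : ℝ => (⟪e, P.1⟫ - c) + s * ⟪e, v.1⟫ := by
    ext s
    simp [inner_add_right, real_inner_smul_right]
    ring
  rw [this]
  exact hasDerivAt_affine _ _ s

theorem extOp_affine (e : EuclideanSpace ℝ (Fin n)) (c : ℝ) (P : Pt n) :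
    extOp σ (fun X => ⟪e, X.1⟫ - c) P = 0 := by
  have hd : ∀ v, fderiv ℝ (fun X : Pt n => ⟪e, X.1⟫ - c) P v = ⟪e, v.1⟫ ∧
      d2 (fun X : Pt n => ⟪e, X.1⟫ - c) P v = 0 := fun v =>
    ⟨fderiv_eq_of_line (contDiff_affine e c).contDiffAt (hasDerivAt_affine_line e c P v 0),
      d2_eq_of_line (contDiff_affine e c).contDiffAt
        (Eventually.of_forall fun s => hasDerivAt_affine_line e c P v s) (hasDerivAt_const _ _)⟩
  simp [extOp, lapl, dt, (hd _).1, (hd _).2]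

theorem extOp_affine_sq (e : EuclideanSpace ℝ (Fin n)) (c : ℝ) (P : Pt n) :
    extOp σ (fun X => (⟪e, X.1⟫ - c) ^ 2) P = 2 * ‖e‖ ^ 2 := by
  have hd : ∀ v, fderiv ℝ (fun X : Pt n => (⟪e, X.1⟫ - c) ^ 2) P v = 2 * (⟪e, P.1⟫ - c) * ⟪e, v.1⟫ ∧
      d2 (fun X : Pt n => (⟪e, X.1⟫ - c) ^ 2) P v = 2 * ⟪e, v.1⟫ * ⟪e, v.1⟫ := by
    intro v
    have hc : ContDiffAt ℝ 2 (fun X : Pt n => (⟪e, X.1⟫ - c) ^ 2) P :=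
      ((contDiff_affine e c).pow 2).contDiffAt
    have h1 : ∀ s : ℝ, HasDerivAt (fun s : ℝ => (⟪e, (P + s • v).1⟫ - c) ^ 2)
        (2 * (⟪e, (P + s • v).1⟫ - c) * ⟪e, v.1⟫) s := fun s =>
      ((hasDerivAt_affine_line e c P v s).pow 2).congr_deriv (by simp)
    constructor
    · rw [fderiv_eq_of_line hc (h1 0)]
      simp
    · exact d2_eq_of_line hc (Eventually.of_forall h1)
        (((hasDerivAt_affine_line e c P v 0).const_mul 2).mul_const _)
  have hs : ∑ i : Fin n, ⟪e, EuclideanSpace.single i (1 : ℝ)⟫ * ⟪e, EuclideanSpace.single i (1 : ℝ)⟫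
      = ‖e‖ ^ 2 := by
    rw [EuclideanSpace.real_norm_sq_eq]
    exact Finset.sum_congr rfl fun i _ => by simp [EuclideanSpace.inner_single_right]; ring
  simp only [extOp, lapl, dt, (hd _).1, (hd _).2]
  simp only [mul_assoc, ← Finset.mul_sum, hs]
  simp

end Explicit

section Transformations

variable {n : ℕ} {σ : ℝ}

/-- Reflection in the vertical hyperplane `{⟪e, x⟫ = a}` (for a unit vector `e`). -/
def reflPt (e : EuclideanSpace ℝ (Fin n)) (a : ℝ) (X : Pt n) : Pt n :=
  (X.1 - (2 * (⟪e, X.1⟫ - a)) • e, X.2)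

theorem contDiff_reflPt (e : EuclideanSpace ℝ (Fin n)) (a : ℝ) {k : WithTop ℕ∞} :
    ContDiff ℝ k (reflPt (n := n) e a) :=
  (contDiff_fst.sub ((contDiff_const.mul (contDiff_affine e a)).smul contDiff_const)).prodMk
    contDiff_snd

theorem extOp_comp_reflPt {e : EuclideanSpace ℝ (Fin n)} (he : ‖e‖ = 1) (a : ℝ) {U : Pt n → ℝ}
    {P : Pt n} (hU : ContDiffAt ℝ 2 U (reflPt e a P)) :
    extOp σ (fun X => U (reflPt e a X)) P = extOp σ U (reflPt e a P) := by
  set L := fderiv ℝ U (reflPt e a P) with hL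
  set B := fderiv ℝ (fderiv ℝ U) (reflPt e a P) with hB
  set E : Pt n := (e, 0) with hE
  have hc : ContDiffAt ℝ 2 (fun X => U (reflPt e a X)) P :=
    ContDiffAt.comp P hU (contDiff_reflPt e a).contDiffAt
  have hd : ∀ v : Pt n, fderiv ℝ (fun X => U (reflPt e a X)) P v = L v - 2 * (⟪e, v.1⟫ * L E) ∧
      d2 (fun X => U (reflPt e a X)) P v = B v v - 2 * (⟪e, v.1⟫ * B E v) - 2 * (⟪e, v.1⟫ * B v E)
        + 4 * B E E * ⟪e, v.1⟫ ^ 2 := by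
    intro v
    have hline : ∀ s : ℝ, reflPt e a (P + s • v) =
        reflPt e a P + s • (v - (2 * ⟪e, v.1⟫) • E) := by
      intro s
      refine Prod.ext ?_ ?_
      · simp only [reflPt, hE, Prod.fst_add, Prod.smul_fst, inner_add_right, real_inner_smul_right,
          Prod.fst_sub]
        module
      · simp [reflPt, hE]
    have h0 : reflPt e a P + (0 : ℝ) • (v - (2 * ⟪e, v.1⟫) • E) = reflPt e a P := by simp
    obtain ⟨h1, h2⟩ := d2_eq_of_mul_curve (V := fun X => U (reflPt e a X)) (U := U) (P := P)
      (e := v) (k := fun _ => 1) (k1 := fun _ => 0) (k2 := 0)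
      (T := fun s : ℝ => reflPt e a P + s • (v - (2 * ⟪e, v.1⟫) • E))
      (T1 := fun _ => v - (2 * ⟪e, v.1⟫) • E) (T2 := 0) hc (by rwa [h0])
      (Eventually.of_forall fun s => by rw [hline, one_mul])
      (Eventually.of_forall fun s => hasDerivAt_const s 1) (hasDerivAt_const _ _)
      (Eventually.of_forall fun s => line_hasDerivAt _ _ s) (hasDerivAt_const _ _)
    simp only [h0, ← hL, ← hB] at h1 h2
    constructor
    · rw [h1]
      simp
      ring
    · rw [h2]
      simp
      ring
  have s1 := sum_single_apply (B E) E
  have s2 := sum_single_apply (B.flip E) E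
  have s3 := euclInner_self_eq_sum E
  have hEE : euclInner E E = 1 := by simp [euclInner, hE, he]
  simp only [ContinuousLinearMap.flip_apply] at s2
  have hi : ∀ i : Fin n, ⟪e, EuclideanSpace.single i (1 : ℝ)⟫ = e i := fun i => by
    simp [EuclideanSpace.inner_single_right]
  rw [hEE] at s3
  simp only [hE, zero_mul, add_zero] at s1 s2 s3
  simp only [extOp, lapl, dt, (hd _).1, (hd _).2, d2_eq_fderiv_fderiv hU, ← hL, ← hB, hi,
    Finset.sum_add_distrib, Finset.sum_sub_distrib, ← Finset.mul_sum, inner_zero_right, hE, s1, s2]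
  have : ∑ i : Fin n, e i ^ 2 = 1 := by simpa using s3
  rw [this]
  simp [reflPt]
  ring

theorem hasNormalQuot_comp_reflPt {e : EuclideanSpace ℝ (Fin n)} {a : ℝ} {U : Pt n → ℝ}
    {x : EuclideanSpace ℝ (Fin n)} {l : ℝ}
    (h : HasNormalQuot σ U (reflPt e a (x, 0)).1 l) :
    HasNormalQuot σ (fun X => U (reflPt e a X)) x l := h

/-- Inversion in the sphere of radius `r` centred at `(c, 0)`. -/
def invPt (c : EuclideanSpace ℝ (Fin n)) (r : ℝ) (X : Pt n) : Pt n :=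
  (c, 0) + (r ^ 2 / sqDist (c, 0) X) • (X - (c, 0))

/-- The Kelvin transform with respect to the sphere of radius `r` centred at `(c, 0)`. -/
def kelvin (σ : ℝ) (c : EuclideanSpace ℝ (Fin n)) (r : ℝ) (U : Pt n → ℝ) (X : Pt n) : ℝ :=
  (r ^ 2 / sqDist (c, 0) X) ^ (((n : ℝ) - 2 * σ) / 2) * U (invPt c r X)

theorem contDiffAt_kelvin {c : EuclideanSpace ℝ (Fin n)} {r : ℝ} (hr : 0 < r) {U : Pt n → ℝ}
    {P : Pt n} (hP : P ≠ (c, 0)) (hU : ContDiffAt ℝ 2 U (invPt c r P)) :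
    ContDiffAt ℝ 2 (kelvin σ c r U) P := by
  have hq := sqDist_pos hP
  have hf : ContDiffAt ℝ 2 (fun X => r ^ 2 / sqDist (c, 0) X) P :=
    contDiffAt_const.div (contDiff_sqDist _).contDiffAt hq.ne'
  have hT : ContDiffAt ℝ 2 (invPt c r) P :=
    contDiffAt_const.add (hf.smul (contDiffAt_id.sub contDiffAt_const))
  exact (hf.rpow_const_of_ne (by positivity)).mul (hU.comp P hT)

theorem extOp_kelvin {c : EuclideanSpace ℝ (Fin n)} {r : ℝ} (hr : 0 < r) {U : Pt n → ℝ}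
    {P : Pt n} (hP : 0 < P.2) (hU : ContDiffAt ℝ 2 U (invPt c r P)) :
    extOp σ (kelvin σ c r U) P =
      (r ^ 2 / sqDist (c, 0) P) ^ (((n : ℝ) - 2 * σ) / 2) * (r ^ 2 / sqDist (c, 0) P) ^ 2 *
        extOp σ U (invPt c r P) := by
  have hPc : P ≠ (c, 0) := fun h => by rw [h] at hP; exact lt_irrefl _ hP
  have hc := contDiffAt_kelvin (σ := σ) hr hPc hU
  set γ : ℝ := (n : ℝ) - 2 * σ with hγ
  set L := fderiv ℝ U (invPt c r P) with hL
  set B := fderiv ℝ (fderiv ℝ U) (invPt c r P) with hB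
  set q := sqDist (c, 0) P with hqdef
  have hq : 0 < q := sqDist_pos hPc
  set f : ℝ := r ^ 2 / q with hf
  set κ : ℝ := f ^ (γ / 2) with hκ
  set u := U (invPt c r P) with hu
  set Z : Pt n := P - (c, 0) with hZ
  have hfpos : 0 < f := by positivity
  have hd : ∀ v : Pt n, fderiv ℝ (kelvin σ c r U) P v =
        κ * (-γ * (euclInner Z v / q) * u + f * (L v - 2 * (euclInner Z v / q) * L Z)) ∧
      d2 (kelvin σ c r U) P v =
        κ * (γ * (γ + 2) / q ^ 2 * u + 4 * γ * f / q ^ 2 * L Z + 4 * f ^ 2 / q ^ 2 * B Z Z +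
          8 * f / q ^ 2 * L Z) * euclInner Z v ^ 2 +
        κ * (-γ / q * u - 2 * f / q * L Z) * euclInner v v +
        κ * (-2 * γ * f / q - 4 * f / q) * (euclInner Z v * L v) +
        κ * f ^ 2 * B v v +
        κ * (-2 * f ^ 2 / q) * (euclInner Z v * B Z v) +
        κ * (-2 * f ^ 2 / q) * (euclInner Z v * B v Z) := by
    intro v
    set b := euclInner Z v with hb
    set N := euclInner v v with hN
    set Q : ℝ → ℝ := fun s => sqDist (c, 0) (P + s • v) with hQ
    have hQ0 : Q 0 = q := by simp [hQ, hqdef]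
    have hQd : ∀ s, HasDerivAt Q (2 * b + 2 * s * N) s := fun s =>
      hasDerivAt_sqDist_line (c, 0) P v s
    have hQpos : ∀ᶠ s in 𝓝 (0 : ℝ), 0 < Q s :=
      (hQd 0).continuousAt.eventually (lt_mem_nhds (by rw [hQ0]; exact hq))
    have hQ1 : HasDerivAt (fun s : ℝ => 2 * b + 2 * s * N) (2 * N) 0 := by
      have := hasDerivAt_affine (2 * b) (2 * N) 0
      refine this.congr_of_eventuallyEq (Eventually.of_forall fun s => ?_)
      simp only
      ring
    have hfd : ∀ s, 0 < Q s → HasDerivAt (fun s => r ^ 2 / Q s)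
        (-(r ^ 2 * (2 * b + 2 * s * N)) / Q s ^ 2) s := fun s hs => by
      refine ((hasDerivAt_const s (r ^ 2)).div (hQd s) hs.ne').congr_deriv ?_
      simp
    have hf1 : HasDerivAt (fun s => -(r ^ 2 * (2 * b + 2 * s * N)) / Q s ^ 2)
        (f * (-2 * N / q + 8 * b ^ 2 / q ^ 2)) 0 := by
      refine ((hQ1.const_mul (r ^ 2)).neg.div ((hQd 0).pow 2)
        (pow_ne_zero 2 (by rw [hQ0]; exact hq.ne'))).congr_deriv ?_
      simp [hQ0, hf]
      field_simp
      ring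
    have hkd : ∀ s, 0 < Q s → HasDerivAt (fun s => (r ^ 2 / Q s) ^ (γ / 2))
        (-(γ / 2) * ((r ^ 2 / Q s) ^ (γ / 2) * ((2 * b + 2 * s * N) / Q s))) s := fun s hs => by
      have hpos : 0 < r ^ 2 / Q s := by positivity
      refine ((hfd s hs).rpow_const (p := γ / 2) (Or.inl hpos.ne')).congr_deriv ?_
      rw [Real.rpow_sub_one hpos.ne']
      field_simp
    have hk1 : HasDerivAt (fun s => -(γ / 2) *
        ((r ^ 2 / Q s) ^ (γ / 2) * ((2 * b + 2 * s * N) / Q s)))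
        (κ * (γ * (γ + 2) * b ^ 2 / q ^ 2 - γ * N / q)) 0 := by
      have hQ0pos : 0 < Q 0 := by rw [hQ0]; exact hq
      refine (((hkd 0 hQ0pos).mul (hQ1.div (hQd 0) hQ0pos.ne')).const_mul (-(γ / 2))).congr_deriv ?_
      simp only [Pi.div_apply, hQ0, mul_zero, zero_mul, add_zero, ← hf, ← hκ]
      field_simp
      ring
    have hlin : ∀ s, HasDerivAt (fun s : ℝ => Z + s • v) v s := fun s => line_hasDerivAt Z v s
    have hT : ∀ s, 0 < Q s → HasDerivAt (fun s => ((c, 0) : Pt n) + (r ^ 2 / Q s) • (Z + s • v))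
        ((r ^ 2 / Q s) • v + (-(r ^ 2 * (2 * b + 2 * s * N)) / Q s ^ 2) • (Z + s • v)) s :=
      fun s hs => ((hfd s hs).smul (hlin s)).const_add _
    have hT1 : HasDerivAt (fun s => (r ^ 2 / Q s) • v +
        (-(r ^ 2 * (2 * b + 2 * s * N)) / Q s ^ 2) • (Z + s • v))
        ((-4 * f * b / q) • v + (f * (-2 * N / q + 8 * b ^ 2 / q ^ 2)) • Z) 0 := by
      have hQ0pos : 0 < Q 0 := by rw [hQ0]; exact hq
      refine (((hfd 0 hQ0pos).smul_const v).add (hf1.smul (hlin 0))).congr_deriv ?_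
      simp only [hQ0, mul_zero, zero_mul, add_zero, zero_smul, hf]
      module
    have hZ0 : ((c, 0) : Pt n) + (r ^ 2 / Q 0) • (Z + (0 : ℝ) • v) = invPt c r P := by
      simp [hQ0, invPt, hZ, hqdef]
    obtain ⟨h1, h2⟩ := d2_eq_of_mul_curve (V := kelvin σ c r U) (U := U) (P := P)
      (e := v) (k := fun s => (r ^ 2 / Q s) ^ (γ / 2))
      (T := fun s => ((c, 0) : Pt n) + (r ^ 2 / Q s) • (Z + s • v)) hc (by rw [hZ0]; exact hU)
      (Eventually.of_forall fun s => by
        simp only [kelvin, invPt, hQ, hZ, hγ]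
        congr 4
        abel)
      (hQpos.mono hkd) hk1 (hQpos.mono hT) hT1
    simp only [hZ0, ← hL, ← hB, ← hu] at h1 h2
    simp only [hQ0, ← hf, ← hκ, mul_zero, zero_mul, add_zero, zero_smul]
      at h1 h2
    have hfr : r ^ 2 = f * q := by rw [hf]; field_simp
    constructor
    · rw [h1, hfr]
      simp only [map_add, map_smul, smul_eq_mul]
      field_simp
      ring
    · rw [h2, hfr]
      simp only [map_add, map_smul, smul_eq_mul, add_apply, smul_apply]
      field_simp
      ring
  have s0 := sum_single_apply L Z
  have s1 := sum_single_apply (B Z) Z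
  have s2 := sum_single_apply (B.flip Z) Z
  have s3 := euclInner_self_eq_sum Z
  have s4 : euclInner Z Z = q := (sqDist_eq _ _).symm
  rw [s4] at s3
  have hZ2 : Z.2 = P.2 := by simp [hZ]
  simp only [ContinuousLinearMap.flip_apply] at s2
  have hNN : ∀ i : Fin n, euclInner ((EuclideanSpace.single i (1 : ℝ), 0) : Pt n)
      (EuclideanSpace.single i 1, 0) = 1 := fun i => by simp [euclInner_single]
  have hN1 : euclInner ((0, 1) : Pt n) (0, 1) = 1 := by simp [euclInner_vert]
  simp only [extOp, lapl, dt, (hd _).1, (hd _).2, d2_eq_fderiv_fderiv hU, ← hL, ← hB,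
    Finset.sum_add_distrib, ← Finset.mul_sum, hNN, hN1, euclInner_single, euclInner_vert]
  rw [eq_sub_of_add_eq s0, eq_sub_of_add_eq s1, eq_sub_of_add_eq s2, eq_sub_of_add_eq s3, hZ2]
  have hT2 : (invPt c r P).2 = f * P.2 := by simp [invPt, hf, hqdef]
  rw [hT2]
  simp only [Finset.sum_const, Finset.card_univ, Fintype.card_fin, nsmul_eq_mul, mul_one]
  have hn : (n : ℝ) = γ + 2 * σ := by rw [hγ]; ring
  rw [hn]
  field_simp
  ring

end Transformations

section Super

variable {n : ℕ} {σ : ℝ}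

/-- `w` is twice differentiable at `P` and the extension operator takes the value `c` there. -/
def HasExtOp {n : ℕ} (σ : ℝ) (w : Pt n → ℝ) (P : Pt n) (c : ℝ) : Prop :=
  ContDiffAt ℝ 2 w P ∧ extOp σ w P = c

theorem HasExtOp.add {v w : Pt n → ℝ} {P : Pt n} {a b : ℝ} (hv : HasExtOp σ v P a)
    (hw : HasExtOp σ w P b) : HasExtOp σ (fun X => v X + w X) P (a + b) :=
  ⟨hv.1.add hw.1, by rw [extOp_add hv.1 hw.1, hv.2, hw.2]⟩

theorem HasExtOp.sub {v w : Pt n → ℝ} {P : Pt n} {a b : ℝ} (hv : HasExtOp σ v P a)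
    (hw : HasExtOp σ w P b) : HasExtOp σ (fun X => v X - w X) P (a - b) :=
  ⟨hv.1.sub hw.1, by rw [extOp_sub hv.1 hw.1, hv.2, hw.2]⟩

theorem HasExtOp.const_mul (c : ℝ) {v : Pt n → ℝ} {P : Pt n} {a : ℝ} (hv : HasExtOp σ v P a) :
    HasExtOp σ (fun X => c * v X) P (c * a) :=
  ⟨contDiffAt_const.mul hv.1, by rw [extOp_const_mul c hv.1, hv.2]⟩

theorem hasExtOp_const (c : ℝ) (P : Pt n) : HasExtOp σ (fun _ => c) P 0 :=
  ⟨contDiffAt_const, extOp_const c P⟩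

theorem hasExtOp_rpow {P : Pt n} (hP : 0 < P.2) : HasExtOp σ (fun X => X.2 ^ (2 * σ)) P 0 :=
  ⟨contDiffAt_rpow_snd P hP _, extOp_rpow P hP⟩

theorem hasExtOp_sq {P : Pt n} (hP : 0 < P.2) : HasExtOp σ (fun X => X.2 ^ 2) P (4 - 4 * σ) :=
  ⟨(contDiff_snd.pow 2).contDiffAt, extOp_sq P hP⟩

theorem hasExtOp_sqDist (x : EuclideanSpace ℝ (Fin n)) {P : Pt n} (hP : 0 < P.2) :
    HasExtOp σ (sqDist (x, 0)) P (2 * n + 4 - 4 * σ) :=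
  ⟨(contDiff_sqDist _).contDiffAt, extOp_sqDist x P hP⟩

theorem hasNormalQuot_sqDist (hσ : σ ∈ Set.Ioo (0 : ℝ) 1) (c x : EuclideanSpace ℝ (Fin n)) :
    HasNormalQuot σ (sqDist (c, 0)) x 0 := by
  have := (hasNormalQuot_of_horizontal (σ := σ) (fun y => ‖y - c‖ ^ 2) x).add
    (hasNormalQuot_sq hσ x)
  simpa [sqDist, HasNormalQuot] using this

theorem hasNormalQuot_const (c : ℝ) (x : EuclideanSpace ℝ (Fin n)) :
    HasNormalQuot σ (fun _ => c) x 0 :=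
  hasNormalQuot_of_horizontal (fun _ => c) x

theorem eventually_vertical_mem {C : Set (Pt n)} {P : Pt n} (hC : C ∈ 𝓝 P) (hP : P.2 = 0) :
    ∀ᶠ t in 𝓝[>] (0 : ℝ), ((P.1, t) : Pt n) ∈ C := by
  have h : Tendsto (fun t : ℝ => ((P.1, t) : Pt n)) (𝓝[>] 0) (𝓝 P) := by
    have : Continuous fun t : ℝ => ((P.1, t) : Pt n) := by fun_prop
    have h2 := this.tendsto 0
    rw [show ((P.1, (0 : ℝ)) : Pt n) = P from Prod.ext rfl hP.symm] at h2
    exact h2.mono_left nhdsWithin_le_nhds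
  exact h hC

theorem isClosed_upper : IsClosed {X : Pt n | 0 ≤ X.2} := isClosed_le continuous_const continuous_snd

/-- Comparison principle on a compact piece `C ∩ {t ≥ 0}` of the closed half-space, relative to a
positive supersolution `φ`. -/
theorem nonneg_of_comparison_half {C : Set (Pt n)} (hC : IsCompact (C ∩ {X | 0 ≤ X.2}))
    {w φ : Pt n → ℝ} (hw : ContinuousOn w (C ∩ {X | 0 ≤ X.2}))
    (hφ : ContinuousOn φ (C ∩ {X | 0 ≤ X.2})) (hpos : ∀ P ∈ C, 0 ≤ P.2 → 0 < φ P)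
    (h : ∀ P ∈ C, 0 ≤ P.2 → w P < 0 → C ∈ 𝓝 P ∧
      (0 < P.2 → ∃ a b, HasExtOp σ w P a ∧ HasExtOp σ φ P b ∧ a ≤ 0 ∧ b < 0) ∧
      (P.2 = 0 → ∃ l m, HasNormalQuot σ w P.1 l ∧ HasNormalQuot σ φ P.1 m ∧ l * φ P < m * w P))
    {P : Pt n} (hP : P ∈ C) (hP2 : 0 ≤ P.2) : 0 ≤ w P := by
  refine nonneg_of_comparison (σ := σ) hC hw hφ (fun P hP => hpos P hP.1 hP.2) ?_ P ⟨hP, hP2⟩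
  rintro P ⟨hP, hP2⟩ hlt
  obtain ⟨h1, h2, h3⟩ := h P hP hP2 hlt
  rcases (show (0 : ℝ) ≤ P.2 from hP2).lt_or_eq with ht | ht
  · obtain ⟨a, b, ha, hb, ha0, hb0⟩ := h2 ht
    refine Or.inl ⟨inter_mem h1 ?_, ha.1, hb.1, ha.2 ▸ ha0, hb.2 ▸ hb0⟩
    filter_upwards [(continuous_snd (X := EuclideanSpace ℝ (Fin n)) (Y := ℝ)).continuousAt.eventually
      (lt_mem_nhds ht)] with X hX using le_of_lt hX
  · refine Or.inr ⟨ht.symm, ?_, h3 ht.symm⟩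
    filter_upwards [eventually_vertical_mem h1 ht.symm, self_mem_nhdsWithin] with t h4 h5
    exact ⟨h4, show (0 : ℝ) ≤ t from le_of_lt h5⟩

/-- Weak minimum principle for supersolutions. -/
theorem nonneg_of_super (hσ : σ ∈ Set.Ioo (0 : ℝ) 1) {C : Set (Pt n)}
    (hC : IsCompact (C ∩ {X | 0 ≤ X.2})) {w : Pt n → ℝ} (hw : ContinuousOn w (C ∩ {X | 0 ≤ X.2}))
    (h : ∀ P ∈ C, 0 ≤ P.2 → w P < 0 → C ∈ 𝓝 P ∧ (0 < P.2 → ∃ a, HasExtOp σ w P a ∧ a ≤ 0) ∧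
      (P.2 = 0 → ∃ l, HasNormalQuot σ w P.1 l ∧ l ≤ 0))
    {P : Pt n} (hP : P ∈ C) (hP2 : 0 ≤ P.2) : 0 ≤ w P := by
  set ψ : Pt n → ℝ := fun X => sqDist (0, 0) X + X.2 ^ (2 * σ) with hψ
  have hψc : Continuous ψ := (continuous_sqDist _).add
    (continuous_snd.rpow_const fun X => Or.inr (by linarith [hσ.1]))
  obtain ⟨C0, hC0⟩ := hC.bddAbove_image hψc.continuousOn
  have hb : ∀ X ∈ C, 0 ≤ X.2 → ψ X ≤ C0 := fun X h1 h2 => hC0 ⟨X, ⟨h1, h2⟩, rfl⟩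
  refine nonneg_of_comparison_half (σ := σ) (φ := fun X => C0 + 1 - ψ X) hC hw
    (continuous_const.sub hψc).continuousOn (fun X h1 h2 => by linarith [hb X h1 h2]) ?_ hP hP2
  intro X hX hX2 hlt
  obtain ⟨h1, h2, h3⟩ := h X hX hX2 hlt
  refine ⟨h1, fun ht => ?_, fun ht => ?_⟩
  · obtain ⟨a, ha, ha0⟩ := h2 ht
    refine ⟨a, _, ha, (hasExtOp_const _ _).sub ((hasExtOp_sqDist 0 ht).add (hasExtOp_rpow ht)),
      ha0, ?_⟩
    have : (0 : ℝ) ≤ n := Nat.cast_nonneg n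
    linarith [hσ.2]
  · obtain ⟨l, hl, hl0⟩ := h3 ht
    refine ⟨l, _, hl, (hasNormalQuot_const _ _).sub ((hasNormalQuot_sqDist hσ 0 _).add
      (hasNormalQuot_rpow hσ.1 _)), ?_⟩
    have := hb X hX hX2
    nlinarith

end Super

section Annulus

variable {n : ℕ} {σ : ℝ}

theorem norm_sub_sq_le_sqDist (Y X : Pt n) : ‖X.1 - Y.1‖ ^ 2 ≤ sqDist Y X := by
  simp only [sqDist]
  nlinarith [sq_nonneg (X.2 - Y.2)]

theorem sq_snd_le_sqDist (Y X : Pt n) : (X.2 - Y.2) ^ 2 ≤ sqDist Y X := by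
  simp only [sqDist]
  nlinarith [sq_nonneg ‖X.1 - Y.1‖]

theorem dist_le_sqrt_sqDist (Y X : Pt n) : dist X Y ≤ Real.sqrt (sqDist Y X) := by
  rw [Prod.dist_eq, max_le_iff, dist_eq_norm, Real.dist_eq]
  exact ⟨Real.le_sqrt_of_sq_le (norm_sub_sq_le_sqDist Y X),
    Real.abs_le_sqrt (sq_snd_le_sqDist Y X)⟩

theorem exists_sqDist_subset {N : Set (Pt n)} {Y : Pt n} (hN : N ∈ 𝓝 Y) :
    ∃ ρ, 0 < ρ ∧ ∀ X, sqDist Y X ≤ ρ → X ∈ N := by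
  obtain ⟨ε, hε, h⟩ := Metric.mem_nhds_iff.1 hN
  refine ⟨(ε / 2) ^ 2, by positivity, fun X hX => h ?_⟩
  have h1 := (dist_le_sqrt_sqDist Y X).trans (Real.sqrt_le_sqrt hX)
  rw [Real.sqrt_sq (by positivity)] at h1
  exact Metric.mem_ball.2 (by linarith)

theorem sqDist_triangle (X Y Z : Pt n) : sqDist X Z ≤ 2 * sqDist X Y + 2 * sqDist Y Z := by
  have h : ‖Z.1 - X.1‖ ≤ ‖Z.1 - Y.1‖ + ‖Y.1 - X.1‖ := by
    simpa using norm_add_le (Z.1 - Y.1) (Y.1 - X.1)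
  have h2 : ‖Z.1 - X.1‖ ^ 2 ≤ (‖Z.1 - Y.1‖ + ‖Y.1 - X.1‖) ^ 2 := by gcongr
  simp only [sqDist]
  nlinarith [sq_nonneg (‖Z.1 - Y.1‖ - ‖Y.1 - X.1‖), sq_nonneg (Z.2 - Y.2 - (Y.2 - X.2))]

theorem isCompact_sqDist_le (Y : Pt n) (R : ℝ) : IsCompact {X : Pt n | sqDist Y X ≤ R} := by
  refine (isCompact_closedBall Y (Real.sqrt R)).of_isClosed_subset
    (isClosed_le (continuous_sqDist _) continuous_const) fun X hX => ?_
  exact Metric.mem_closedBall.2 ((dist_le_sqrt_sqDist Y X).trans (Real.sqrt_le_sqrt hX))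

theorem isCompact_annulus (Y : Pt n) (a b : ℝ) :
    IsCompact ({X : Pt n | a ≤ sqDist Y X ∧ sqDist Y X ≤ b} ∩ {X | 0 ≤ X.2}) := by
  refine (isCompact_sqDist_le Y b).of_isClosed_subset ?_ ?_
  · exact ((isClosed_le continuous_const (continuous_sqDist _)).inter
      (isClosed_le (continuous_sqDist _) continuous_const)).inter isClosed_upper
  · rintro X ⟨⟨h1, h2⟩, h3⟩
    exact h2

theorem annulus_mem_nhds {Y : Pt n} {a b : ℝ} {P : Pt n} (h1 : a < sqDist Y P)
    (h2 : sqDist Y P < b) : {X : Pt n | a ≤ sqDist Y X ∧ sqDist Y X ≤ b} ∈ 𝓝 P := by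
  have hc := (continuous_sqDist Y).continuousAt (x := P)
  filter_upwards [hc.eventually (lt_mem_nhds h1), hc.eventually (gt_mem_nhds h2)] with X h3 h4
  exact ⟨h3.le, h4.le⟩

theorem exists_rpow_le_one_add_sq (hσ : σ ∈ Set.Ioo (0 : ℝ) 1) {K : ℝ} (hK : 0 < K) :
    ∃ A, 0 < A ∧ ∀ t : ℝ, 0 ≤ t → K * t ^ (2 * σ) ≤ 1 + A * t ^ 2 := by
  have hs : 0 < 2 * σ := by linarith [hσ.1]
  set t1 : ℝ := (1 / K) ^ (1 / (2 * σ)) with ht1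
  have ht1p : 0 < t1 := Real.rpow_pos_of_pos (by positivity) _
  have h1 : t1 ^ (2 * σ) = 1 / K := by
    rw [ht1, ← Real.rpow_mul (by positivity), one_div_mul_cancel hs.ne', Real.rpow_one]
  refine ⟨K * t1 ^ (2 * σ - 2), by positivity, fun t ht => ?_⟩
  rcases le_total t t1 with h | h
  · have h2 : t ^ (2 * σ) ≤ 1 / K := h1 ▸ Real.rpow_le_rpow ht h hs.le
    have h3 : K * t ^ (2 * σ) ≤ 1 := by
      calc K * t ^ (2 * σ) ≤ K * (1 / K) := by gcongr
        _ = 1 := by field_simp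
    have : 0 ≤ K * t1 ^ (2 * σ - 2) * t ^ 2 := by positivity
    linarith
  · have htp : 0 < t := ht1p.trans_le h
    have h2 : t ^ (2 * σ) = t ^ (2 * σ - 2) * t ^ 2 := by
      rw [← Real.rpow_natCast t 2, ← Real.rpow_add htp]
      norm_num
    have h3 : t ^ (2 * σ - 2) ≤ t1 ^ (2 * σ - 2) :=
      Real.rpow_le_rpow_of_nonpos ht1p h (by linarith [hσ.2])
    have h4 : K * t ^ (2 * σ) ≤ K * t1 ^ (2 * σ - 2) * t ^ 2 := by
      rw [h2, ← mul_assoc]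
      gcongr
    linarith

/-- Minimum principle in narrow half annuli for a linear Robin boundary condition. -/
theorem exists_narrow_annulus_nonneg (n : ℕ) (hσ : σ ∈ Set.Ioo (0 : ℝ) 1) {C0 : ℝ} (hC0 : 0 ≤ C0) :
    ∃ δ, 0 < δ ∧ ∀ (c : EuclideanSpace ℝ (Fin n)) (a b : ℝ) (w : Pt n → ℝ), b - a ≤ δ →
      ContinuousOn w ({X : Pt n | a ≤ sqDist (c, 0) X ∧ sqDist (c, 0) X ≤ b} ∩ {X | 0 ≤ X.2}) →
      (∀ P, a ≤ sqDist (c, 0) P → sqDist (c, 0) P ≤ b → 0 ≤ P.2 → w P < 0 →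
        a < sqDist (c, 0) P ∧ sqDist (c, 0) P < b ∧
        (0 < P.2 → ∃ k, HasExtOp σ w P k ∧ k ≤ 0) ∧
        (P.2 = 0 → ∃ l, HasNormalQuot σ w P.1 l ∧ l ≤ -(C0 * w P))) →
      ∀ P, a ≤ sqDist (c, 0) P → sqDist (c, 0) P ≤ b → 0 ≤ P.2 → 0 ≤ w P := by
  obtain ⟨A, hA, hKA⟩ := exists_rpow_le_one_add_sq hσ (K := 2 * C0 + 1) (by linarith)
  have hd : 0 < 2 * (n : ℝ) + 4 - 4 * σ := by
    have : (0 : ℝ) ≤ n := Nat.cast_nonneg n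
    linarith [hσ.2]
  obtain ⟨M, hM0, hM⟩ : ∃ M, 0 < M ∧ A * (4 - 4 * σ) < M * (2 * (n : ℝ) + 4 - 4 * σ) := by
    have h4 : 0 ≤ A * (4 - 4 * σ) := mul_nonneg hA.le (by linarith [hσ.2])
    refine ⟨(A * (4 - 4 * σ) + 1) / (2 * (n : ℝ) + 4 - 4 * σ), by positivity, ?_⟩
    rw [div_mul_cancel₀ _ hd.ne']
    linarith
  refine ⟨1 / (2 * M), by positivity, fun c a b w hab hw h P h1 h2 h3 => ?_⟩
  set φ : Pt n → ℝ := fun X => 2 - (2 * C0 + 1) * X.2 ^ (2 * σ) + A * X.2 ^ 2 -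
    M * (sqDist (c, 0) X - a) with hφ
  have hφc : Continuous φ := by
    have h5 : Continuous fun X : Pt n => X.2 ^ (2 * σ) :=
      continuous_snd.rpow_const fun X => Or.inr (by linarith [hσ.1])
    have h6 := continuous_sqDist (n := n) (c, 0)
    fun_prop
  have hpos : ∀ X : Pt n, sqDist (c, 0) X ≤ b → 0 ≤ X.2 → 0 < φ X := by
    intro X h5 h6
    have h7 := hKA X.2 h6
    have h8 : M * (sqDist (c, 0) X - a) ≤ M * (1 / (2 * M)) := by
      gcongr
      linarith
    have h9 : M * (1 / (2 * M)) = 1 / 2 := by field_simp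
    simp only [hφ]
    linarith
  refine nonneg_of_comparison_half (σ := σ) (isCompact_annulus (c, 0) a b) hw hφc.continuousOn
    (fun X hX => hpos X hX.2) ?_ ⟨h1, h2⟩ h3
  rintro X ⟨h5, h6⟩ h7 hlt
  obtain ⟨h8, h9, h10, h11⟩ := h X h5 h6 h7 hlt
  refine ⟨annulus_mem_nhds h8 h9, fun ht => ?_, fun ht => ?_⟩
  · obtain ⟨k, hk, hk0⟩ := h10 ht
    refine ⟨k, _, hk, (((hasExtOp_const 2 X).sub ((hasExtOp_rpow ht).const_mul _)).add
      ((hasExtOp_sq ht).const_mul A)).sub (((hasExtOp_sqDist c ht).sub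
      (hasExtOp_const a X)).const_mul M), hk0, ?_⟩
    linarith
  · obtain ⟨l, hl, hl0⟩ := h11 ht
    refine ⟨l, _, hl, (((hasNormalQuot_const 2 _).sub ((hasNormalQuot_rpow hσ.1 _).const_mul
      (2 * C0 + 1))).add ((hasNormalQuot_sq hσ _).const_mul A)).sub
      (((hasNormalQuot_sqDist hσ c _).sub (hasNormalQuot_const a _)).const_mul M), ?_⟩
    have hp := hpos X h6 h7
    have h12 : φ X ≤ 2 := by
      have : 0 ≤ M * (sqDist (c, 0) X - a) := mul_nonneg hM0.le (by linarith)
      simp only [hφ, ht, Real.zero_rpow (by linarith [hσ.1] : 2 * σ ≠ 0)]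
      linarith
    have h13 : l * φ X ≤ -(C0 * w X) * φ X := by gcongr
    have h14 : 0 ≤ -(C0 * w X) := by nlinarith
    have h15 : -(C0 * w X) * φ X ≤ -(C0 * w X) * 2 := by gcongr
    linarith

end Annulus

section StrongMax

variable {n : ℕ} {σ : ℝ}

theorem hasExtOp_exp_sqDist (Y P : Pt n) (α : ℝ) :
    HasExtOp σ (fun X => Real.exp (-(α * sqDist Y X))) P
      (α * Real.exp (-(α * sqDist Y P)) * (4 * α * sqDist Y P - 2 * (n + 1) -
        (1 - 2 * σ) / P.2 * (2 * (P.2 - Y.2)))) := by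
  have h1 : ∀ y, HasDerivAt (fun y => Real.exp (-(α * y))) (-α * Real.exp (-(α * y))) y := by
    intro y
    have := ((hasDerivAt_id y).const_mul α).neg.exp
    simpa [mul_comm] using this
  have hc : ContDiff ℝ 2 fun y => Real.exp (-(α * y)) := by fun_prop
  refine ⟨(hc.comp (contDiff_sqDist Y)).contDiffAt, ?_⟩
  rw [extOp_radial Y P hc.contDiffAt (Eventually.of_forall h1) ((h1 _).const_mul (-α))]
  ring

theorem eventually_eq_zero_of_super (hσ : σ ∈ Set.Ioo (0 : ℝ) 1) {Ω : Set (Pt n)}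
    (hΩ : IsOpen Ω) (hpos : ∀ X ∈ Ω, 0 < X.2) {w : Pt n → ℝ} (hw : ∀ X ∈ Ω, 0 ≤ w X)
    (h : ∀ X ∈ Ω, ∃ k, HasExtOp σ w X k ∧ k ≤ 0) {X0 : Pt n} (hX0 : X0 ∈ Ω) (h0 : w X0 = 0) :
    ∀ᶠ X in 𝓝 X0, w X = 0 := by
  have hcont : ContinuousOn w Ω := fun X hX => by
    obtain ⟨k, hk, -⟩ := h X hX
    exact hk.1.continuousAt.continuousWithinAt
  set τ := X0.2 / 2 with hτ
  have hX0p := hpos X0 hX0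
  have hN : Ω ∩ {X : Pt n | τ < X.2 ∧ X.2 < 4 * τ} ∈ 𝓝 X0 := by
    refine inter_mem (hΩ.mem_nhds hX0) ?_
    have hc := (continuous_snd (X := EuclideanSpace ℝ (Fin n)) (Y := ℝ)).continuousAt (x := X0)
    exact (hc.eventually (lt_mem_nhds (by linarith))).and
      (hc.eventually (gt_mem_nhds (by linarith)))
  obtain ⟨η, hη, hball⟩ := exists_sqDist_subset hN
  have hnear : ∀ᶠ X in 𝓝 X0, sqDist X0 X < η / 10 ∧ sqDist X X0 < η / 10 := by
    have hc1 := (continuous_sqDist X0).continuousAt (x := X0)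
    have hs : ∀ X : Pt n, sqDist X X0 = sqDist X0 X := fun X => by
      simp only [sqDist, norm_sub_rev]
      ring
    have h00 : sqDist X0 X0 = 0 := by simp [sqDist]
    filter_upwards [hc1.eventually (gt_mem_nhds (show sqDist X0 X0 < η / 10 by
      rw [h00]; positivity))] with X hX
    exact ⟨hX, hs X ▸ hX⟩
  filter_upwards [hnear] with Y hY
  by_contra hne
  have hYΩ := hball Y (by linarith [hY.1])
  have hYpos : 0 < w Y := lt_of_le_of_ne (hw Y hYΩ.1) (Ne.symm hne)
  have hlow : {X | w Y / 2 < w X} ∈ 𝓝 Y :=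
    (hcont.continuousAt (hΩ.mem_nhds hYΩ.1)).eventually (lt_mem_nhds (by linarith))
  obtain ⟨ρ0, hρ0, hball2⟩ := exists_sqDist_subset hlow
  set m := w Y / 2 with hm
  have hmp : 0 < m := by positivity
  set R := 4 * (η / 10) with hR
  have hRin : ∀ X, sqDist Y X ≤ R → X ∈ Ω ∩ {X : Pt n | τ < X.2 ∧ X.2 < 4 * τ} := fun X hX =>
    hball X (by linarith [sqDist_triangle X0 Y X, hY.1])
  set α : ℝ := (2 * (n + 1) + 8) / (4 * ρ0) with hα
  have hαp : 0 < α := by positivity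
  have hα2 : 4 * α * ρ0 = 2 * (n + 1) + 8 := by rw [hα]; field_simp
  have hX0d : 0 < w X0 := by
    rcases le_or_gt (sqDist Y X0) ρ0 with hle | hgt
    · exact hmp.trans (hball2 X0 hle)
    have hkey := nonneg_of_super (σ := σ) hσ (isCompact_annulus Y ρ0 R)
      (w := fun X => w X - m * (Real.exp (-(α * sqDist Y X)) - Real.exp (-(α * R)))) (P := X0)
      ?_ ?_ ⟨hgt.le, by linarith [hY.2]⟩ hX0p.le
    · have h1 : Real.exp (-(α * R)) < Real.exp (-(α * sqDist Y X0)) :=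
        Real.exp_lt_exp.2 (by nlinarith [hY.2])
      nlinarith
    · have h1 : Continuous fun X : Pt n =>
          m * (Real.exp (-(α * sqDist Y X)) - Real.exp (-(α * R))) := by
        have := continuous_sqDist Y
        fun_prop
      exact (hcont.mono fun X hX => (hRin X hX.1.2).1).sub h1.continuousOn
    · rintro X ⟨h1, h2⟩ h3 hlt
      obtain ⟨hXΩ, hX1, hX2⟩ := hRin X h2
      have hX3 := hpos X hXΩ
      have h4 : ρ0 < sqDist Y X := by
        refine lt_of_le_of_ne h1 fun heq => ?_
        have h5 := hball2 X heq.ge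
        simp only [Set.mem_ofPred_eq] at h5
        have h6 : Real.exp (-(α * sqDist Y X)) ≤ 1 :=
          Real.exp_le_one_iff.2 (by nlinarith [sqDist_nonneg Y X])
        have h7 := Real.exp_pos (-(α * R))
        nlinarith
      have h5 : sqDist Y X < R := by
        refine lt_of_le_of_ne h2 fun heq => ?_
        rw [heq, sub_self, mul_zero, sub_zero] at hlt
        exact absurd hlt (not_lt.2 (hw X hXΩ))
      refine ⟨annulus_mem_nhds h4 h5, fun _ => ?_, fun ht => absurd ht hX3.ne'⟩
      obtain ⟨k, hk, hk0⟩ := h X hXΩ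
      refine ⟨_, hk.sub (((hasExtOp_exp_sqDist Y X α).sub (hasExtOp_const _ X)).const_mul m), ?_⟩
      have h6 : (1 - 2 * σ) / X.2 * (2 * (X.2 - Y.2)) ≤ 8 := by
        rw [div_mul_eq_mul_div, div_le_iff₀ hX3]
        have h8 := hYΩ.2.1
        have h9 := hYΩ.2.2
        have h10 := hσ.1
        have h11 := hσ.2
        have : |X.2 - Y.2| ≤ 4 * X.2 := abs_le.2 ⟨by linarith, by linarith⟩
        have h12 : |1 - 2 * σ| ≤ 1 := abs_le.2 ⟨by linarith, by linarith⟩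
        calc (1 - 2 * σ) * (2 * (X.2 - Y.2)) ≤ |(1 - 2 * σ) * (2 * (X.2 - Y.2))| := le_abs_self _
          _ = |1 - 2 * σ| * (2 * |X.2 - Y.2|) := by rw [abs_mul, abs_mul, abs_two]
          _ ≤ 1 * (2 * (4 * X.2)) := by gcongr
          _ = 8 * X.2 := by ring
      have h7 : 0 ≤ α * Real.exp (-(α * sqDist Y X)) * (4 * α * sqDist Y X - 2 * (n + 1) -
          (1 - 2 * σ) / X.2 * (2 * (X.2 - Y.2))) := by
        refine mul_nonneg (by positivity) ?_
        have : 4 * α * ρ0 ≤ 4 * α * sqDist Y X := by gcongr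
        linarith
      nlinarith
  linarith

/-- Strong minimum principle. -/
theorem eq_zero_or_pos_of_super (hσ : σ ∈ Set.Ioo (0 : ℝ) 1) {Ω : Set (Pt n)}
    (hΩ : IsOpen Ω) (hΩc : IsPreconnected Ω) (hpos : ∀ X ∈ Ω, 0 < X.2) {w : Pt n → ℝ}
    (hw : ∀ X ∈ Ω, 0 ≤ w X) (h : ∀ X ∈ Ω, ∃ k, HasExtOp σ w X k ∧ k ≤ 0) :
    (∀ X ∈ Ω, w X = 0) ∨ ∀ X ∈ Ω, 0 < w X := by
  by_contra! hcon
  obtain ⟨⟨A, hA, hA0⟩, ⟨B, hB, hB0⟩⟩ := hcon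
  have hcont : ContinuousOn w Ω := fun X hX => by
    obtain ⟨k, hk, -⟩ := h X hX
    exact hk.1.continuousAt.continuousWithinAt
  have ho1 : IsOpen (Ω ∩ w ⁻¹' Set.Ioi 0) := hcont.isOpen_inter_preimage hΩ isOpen_Ioi
  have ho2 : IsOpen {X | ∀ᶠ Z in 𝓝 X, w Z = 0} := isOpen_setOfPred_eventually_nhds
  have hcov : Ω ⊆ Ω ∩ w ⁻¹' Set.Ioi 0 ∪ {X | ∀ᶠ Z in 𝓝 X, w Z = 0} := fun X hX => by
    rcases (hw X hX).lt_or_eq with h1 | h1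
    · exact Or.inl ⟨hX, h1⟩
    · exact Or.inr (eventually_eq_zero_of_super hσ hΩ hpos hw h hX h1.symm)
  obtain ⟨Z, hZ, hZ1, hZ2⟩ := hΩc _ _ ho1 ho2 hcov
    ⟨A, hA, hA, lt_of_le_of_ne (hw A hA) (Ne.symm hA0)⟩
    ⟨B, hB, eventually_eq_zero_of_super hσ hΩ hpos hw h hB (le_antisymm hB0 (hw B hB))⟩
  have hZ3 : w Z = 0 := (show ∀ᶠ Z in 𝓝 Z, w Z = 0 from hZ2).self_of_nhds
  exact hZ1.2.ne' hZ3

end StrongMax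

section Hopf

variable {n : ℕ} {σ : ℝ}

/-- Boundary point lemma on the flat part `{t = 0}`. -/
theorem pos_of_super_boundary (hσ : σ ∈ Set.Ioo (0 : ℝ) 1) {N : Set (Pt n)}
    {x0 : EuclideanSpace ℝ (Fin n)} (hN : N ∈ 𝓝 ((x0, 0) : Pt n)) {w : Pt n → ℝ}
    (hc : ContinuousOn w (N ∩ {X | 0 ≤ X.2})) (h0 : ∀ X ∈ N, 0 ≤ X.2 → 0 ≤ w X)
    (hw : ∀ X ∈ N, 0 < X.2 → 0 < w X) (h : ∀ X ∈ N, 0 < X.2 → ∃ k, HasExtOp σ w X k ∧ k ≤ 0)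
    {l : ℝ} (hl : HasNormalQuot σ w x0 l) (hl0 : l ≤ 0) : 0 < w (x0, 0) := by
  have hx0N : ((x0, 0) : Pt n) ∈ N := mem_of_mem_nhds hN
  refine lt_of_le_of_ne (h0 _ hx0N le_rfl) fun hzero => ?_
  obtain ⟨r, hr, hball⟩ := Metric.mem_nhds_iff.1 hN
  have hd : 0 < 4 - 4 * σ := by linarith [hσ.2]
  set B : ℝ := (2 * n + 4 - 4 * σ) / (4 - 4 * σ) with hB
  have hBd : B * (4 - 4 * σ) = 2 * n + 4 - 4 * σ := div_mul_cancel₀ _ hd.ne'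
  have hB0 : 0 < B := by
    have : (0 : ℝ) ≤ n := Nat.cast_nonneg n
    rw [hB]
    exact div_pos (by linarith) hd
  set g : ℝ → ℝ := fun t => t ^ (2 * σ) + B * t ^ 2 with hg
  have hgc : Continuous g := by
    have : Continuous fun t : ℝ => t ^ (2 * σ) :=
      continuous_id.rpow_const fun X => Or.inr (by linarith [hσ.1])
    fun_prop
  have hg0 : g 0 = 0 := by simp [hg, Real.zero_rpow (by linarith [hσ.1] : 2 * σ ≠ 0)]
  have hgm : ∀ s t : ℝ, 0 ≤ s → s ≤ t → g s ≤ g t := by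
    intro s t hs hst
    have := Real.rpow_le_rpow hs hst (by linarith [hσ.1] : 0 ≤ 2 * σ)
    simp only [hg]
    gcongr
  obtain ⟨t1, ht1, hgt1⟩ : ∃ t1, 0 < t1 ∧ g t1 < (r / 2) ^ 2 := by
    have h1 : ∀ᶠ t in 𝓝 (0 : ℝ), g t < (r / 2) ^ 2 :=
      hgc.continuousAt.eventually (gt_mem_nhds (by rw [hg0]; positivity))
    obtain ⟨t1, h2, h3⟩ := ((h1.filter_mono nhdsWithin_le_nhds).and
      (self_mem_nhdsWithin (a := (0 : ℝ)) (s := Set.Ioi 0))).exists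
    exact ⟨t1, h3, h2⟩
  set τ := min t1 (r / 2) with hτ
  have hτ0 : 0 < τ := by positivity
  have hgτ : g τ < (r / 2) ^ 2 := (hgm _ _ hτ0.le (min_le_left _ _)).trans_lt hgt1
  have hin : ∀ X : Pt n, ‖X.1 - x0‖ ≤ r / 2 → 0 ≤ X.2 → X.2 ≤ τ → X ∈ N := by
    intro X h1 h2 h3
    refine hball ?_
    rw [Metric.mem_ball, Prod.dist_eq, max_lt_iff, dist_eq_norm, Real.dist_eq]
    refine ⟨by linarith, ?_⟩
    rw [show X.2 - ((x0, 0) : Pt n).2 = X.2 from sub_zero _, abs_of_nonneg h2]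
    linarith [min_le_right t1 (r / 2)]
  obtain ⟨m, hm, hmw⟩ : ∃ m, 0 < m ∧ ∀ y, ‖y - x0‖ ≤ r / 2 → m ≤ w (y, τ) := by
    have hcomp : IsCompact (Metric.closedBall x0 (r / 2)) := isCompact_closedBall _ _
    have hcw : ContinuousOn (fun y => w (y, τ)) (Metric.closedBall x0 (r / 2)) := by
      refine hc.comp (by fun_prop) fun y hy => ?_
      exact ⟨hin _ (by simpa [dist_eq_norm] using hy) hτ0.le le_rfl, hτ0.le⟩
    obtain ⟨y, hy, hmin⟩ := hcomp.exists_isMinOn ⟨x0, Metric.mem_closedBall_self (by positivity)⟩ hcw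
    refine ⟨w (y, τ), hw _ (hin _ (by simpa [dist_eq_norm] using hy) hτ0.le le_rfl) hτ0,
      fun z hz => hmin (by simpa [dist_eq_norm] using hz)⟩
  obtain ⟨ε, hε, hεm⟩ : ∃ ε, 0 < ε ∧ ε * g τ ≤ m := by
    have hgp : 0 ≤ g τ := hg0 ▸ hgm 0 τ le_rfl hτ0.le
    refine ⟨m / (g τ + 1), by positivity, ?_⟩
    rw [div_mul_eq_mul_div, div_le_iff₀ (by positivity)]
    nlinarith
  set v : Pt n → ℝ := fun X => w X - ε * (X.2 ^ (2 * σ) + B * X.2 ^ 2 - sqDist (x0, 0) X + X.2 ^ 2)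
    with hv
  have hCc : IsCompact ({X : Pt n | ‖X.1 - x0‖ ≤ r / 2 ∧ X.2 ≤ τ} ∩ {X | 0 ≤ X.2}) := by
    have h1 : {X : Pt n | ‖X.1 - x0‖ ≤ r / 2 ∧ X.2 ≤ τ} ∩ {X | 0 ≤ X.2} =
        Metric.closedBall x0 (r / 2) ×ˢ Set.Icc 0 τ := by
      ext X
      simp only [Set.mem_inter_iff, Set.mem_ofPred_eq, Set.mem_prod, Metric.mem_closedBall,
        dist_eq_norm, Set.mem_Icc]
      tauto
    rw [h1]
    exact (isCompact_closedBall _ _).prod isCompact_Icc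
  have hqc : Continuous fun X : Pt n =>
      ε * (X.2 ^ (2 * σ) + B * X.2 ^ 2 - sqDist (x0, 0) X + X.2 ^ 2) := by
    have h1 : Continuous fun X : Pt n => X.2 ^ (2 * σ) :=
      continuous_snd.rpow_const fun X => Or.inr (by linarith [hσ.1])
    have h2 := continuous_sqDist (n := n) (x0, 0)
    fun_prop
  have hbar : ∀ X : Pt n, X.2 ^ (2 * σ) + B * X.2 ^ 2 - sqDist (x0, 0) X + X.2 ^ 2 =
      g X.2 - ‖X.1 - x0‖ ^ 2 := fun X => by simp only [hg, sqDist]; ring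
  have hvnn : ∀ X : Pt n, ‖X.1 - x0‖ ≤ r / 2 → X.2 ≤ τ → 0 ≤ X.2 → 0 ≤ v X := by
    intro X hX1 hX2 hX3
    refine nonneg_of_super (σ := σ) hσ hCc (w := v) ?_ ?_ ⟨hX1, hX2⟩ hX3
    · exact (hc.mono fun X hX => ⟨hin X hX.1.1 hX.2 hX.1.2, hX.2⟩).sub hqc.continuousOn
    · rintro X ⟨h1, h2⟩ h3 hlt
      have hXN := hin X h1 h3 h2
      have hwX := h0 X hXN h3
      simp only [hv, hbar] at hlt
      have b1 : 0 < X.2 := by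
        refine lt_of_le_of_ne h3 fun heq => ?_
        rw [← heq, hg0] at hlt
        nlinarith [sq_nonneg ‖X.1 - x0‖]
      have b2 : X.2 < τ := by
        refine lt_of_le_of_ne h2 fun heq => ?_
        have h4 : m ≤ w X := by
          rw [show X = (X.1, τ) from Prod.ext rfl heq]
          exact hmw _ h1
        rw [heq] at hlt
        nlinarith [sq_nonneg ‖X.1 - x0‖]
      have b3 : ‖X.1 - x0‖ < r / 2 := by
        refine lt_of_le_of_ne h1 fun heq => ?_
        rw [heq] at hlt
        nlinarith [hgm _ _ h3 h2]
      refine ⟨?_, fun _ => ?_, fun ht => absurd ht b1.ne'⟩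
      · have c1 : Continuous fun X : Pt n => ‖X.1 - x0‖ := by fun_prop
        filter_upwards [c1.continuousAt.eventually (gt_mem_nhds b3),
          (continuous_snd (X := EuclideanSpace ℝ (Fin n)) (Y := ℝ)).continuousAt.eventually
            (gt_mem_nhds b2)] with Y h4 h5 using ⟨h4.le, h5.le⟩
      · obtain ⟨k, hk, hk0⟩ := h X hXN b1
        refine ⟨_, hk.sub (((((hasExtOp_rpow b1).add ((hasExtOp_sq b1).const_mul B)).sub
          (hasExtOp_sqDist x0 b1)).add (hasExtOp_sq b1)).const_mul ε), ?_⟩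
        rw [hBd]
        nlinarith [hσ.2]
  refine absurd (ge_of_tendsto hl (b := ε) ?_) (by linarith)
  filter_upwards [Ioo_mem_nhdsGT hτ0] with t ht
  have ht2 : 0 < t ^ (2 * σ) := Real.rpow_pos_of_pos ht.1 _
  have h1 := hvnn (x0, t) (by simpa using (half_pos hr).le) ht.2.le ht.1.le
  simp only [hv, hbar, sub_self, norm_zero] at h1
  rw [le_div_iff₀ ht2, ← hzero, sub_zero]
  have h2 : t ^ (2 * σ) ≤ g t := by
    simp only [hg]
    have : 0 ≤ B * t ^ 2 := by positivity
    linarith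
  nlinarith

/-- The function `(r / |X - (c, 0)|) ^ (n - 2σ)`. -/
def sphereFund {n : ℕ} (σ : ℝ) (c : EuclideanSpace ℝ (Fin n)) (r : ℝ) (X : Pt n) : ℝ :=
  (r ^ 2 / sqDist (c, 0) X) ^ (((n : ℝ) - 2 * σ) / 2)

theorem hasExtOp_sphereFund (c : EuclideanSpace ℝ (Fin n)) {r : ℝ} (hr : 0 < r) {P : Pt n}
    (hP : 0 < P.2) : HasExtOp σ (sphereFund σ c r) P 0 := by
  have h : sphereFund σ c r = kelvin (n := n) σ c r (fun _ => 1) := by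
    ext X
    simp [sphereFund, kelvin]
  rw [h]
  refine ⟨contDiffAt_kelvin hr (fun h => ?_) contDiffAt_const, ?_⟩
  · rw [h] at hP
    exact lt_irrefl _ hP
  · rw [extOp_kelvin hr hP contDiffAt_const, extOp_const, mul_zero]

theorem hasNormalQuot_sphereFund (hσ : σ ∈ Set.Ioo (0 : ℝ) 1) {c x : EuclideanSpace ℝ (Fin n)}
    (hx : x ≠ c) {r : ℝ} (hr : 0 < r) : HasNormalQuot σ (sphereFund σ c r) x 0 := by
  have hp : 0 < ‖x - c‖ ^ 2 := by
    have := norm_pos_iff.2 (sub_ne_zero.2 hx)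
    positivity
  have h1 : DifferentiableAt ℝ (fun s : ℝ => ‖x - c‖ ^ 2 + s) 0 := by fun_prop
  have h2 : DifferentiableAt ℝ
      (fun s : ℝ => (r ^ 2 / (‖x - c‖ ^ 2 + s)) ^ (((n : ℝ) - 2 * σ) / 2)) 0 := by
    refine ((differentiableAt_const _).div h1 (by simpa using hp.ne')).rpow_const (Or.inl ?_)
    simp only [add_zero, Pi.div_apply]
    positivity
  simpa [HasNormalQuot, sphereFund, sqDist] using tendsto_even_quot hσ h2

theorem continuousAt_sphereFund (c : EuclideanSpace ℝ (Fin n)) {r : ℝ} (hr : 0 < r) {P : Pt n}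
    (hP : P ≠ (c, 0)) : ContinuousAt (sphereFund σ c r) P := by
  have hq := sqDist_pos hP
  exact (continuousAt_const.div (continuous_sqDist _).continuousAt hq.ne').rpow_const
    (Or.inl (by simp only [Pi.div_apply]; positivity))

theorem sphereFund_nonneg (c : EuclideanSpace ℝ (Fin n)) (r : ℝ) (X : Pt n) :
    0 ≤ sphereFund σ c r X :=
  Real.rpow_nonneg (div_nonneg (sq_nonneg _) (sqDist_nonneg _ _)) _

/-- Lower bound for supersolutions outside a half ball, in the presence of a possible singularity at
the origin. -/
theorem mul_sphereFund_le_of_super (hσ : σ ∈ Set.Ioo (0 : ℝ) 1) (hn : 2 * σ < n)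
    {c : EuclideanSpace ℝ (Fin n)} {r : ℝ} (hr : 0 < r) {w : Pt n → ℝ}
    (hc : ContinuousOn w ({X : Pt n | r ^ 2 ≤ sqDist (c, 0) X ∧ 0 ≤ X.2 ∧ X ≠ 0}))
    (h0 : ∀ X, r ^ 2 ≤ sqDist (c, 0) X → 0 ≤ X.2 → X ≠ 0 → 0 ≤ w X)
    (h : ∀ X : Pt n, r ^ 2 < sqDist (c, 0) X → 0 < X.2 → ∃ k, HasExtOp σ w X k ∧ k ≤ 0)
    (hb : ∀ x : EuclideanSpace ℝ (Fin n), r ^ 2 < sqDist (c, 0) (x, 0) → x ≠ 0 →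
      ∃ l, HasNormalQuot σ w x l ∧ l ≤ 0)
    {m : ℝ} (hm : 0 ≤ m) (hw : ∀ X, r ^ 2 = sqDist (c, 0) X → 0 ≤ X.2 → X ≠ 0 → m ≤ w X)
    {X : Pt n} (hX : r ^ 2 ≤ sqDist (c, 0) X) (hX2 : 0 ≤ X.2) (hX0 : X ≠ 0) :
    m * sphereFund σ c r X ≤ w X := by
  have hγ : 0 < ((n : ℝ) - 2 * σ) / 2 := by linarith
  have hcne : ∀ X : Pt n, r ^ 2 ≤ sqDist (c, 0) X → X ≠ (c, 0) := by
    rintro X h1 rfl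
    simp [sqDist] at h1
    nlinarith
  have hF1 : ∀ X : Pt n, r ^ 2 ≤ sqDist (c, 0) X → sphereFund σ c r X ≤ 1 := fun X h1 =>
    Real.rpow_le_one (div_nonneg (sq_nonneg _) (sqDist_nonneg _ _))
      (div_le_one_of_le₀ h1 (sqDist_nonneg _ _)) hγ.le
  have key : ∀ ε, 0 < ε → 0 ≤ w X + ε * sphereFund σ 0 1 X + ε - m * sphereFund σ c r X := by
    intro ε hε
    obtain ⟨y, hy1, hy2, hy3⟩ : ∃ y : ℝ, 0 < y ∧ m ≤ ε * y ^ (((n : ℝ) - 2 * σ) / 2) ∧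
        1 / y ≤ sqDist (0, 0) X ∧ sqDist (c, 0) X ≤ r ^ 2 * y := by
      have h1 := ((tendsto_rpow_atTop hγ).const_mul_atTop hε).eventually_ge_atTop m
      have hXp : 0 < sqDist (0, 0) X := sqDist_pos hX0
      obtain ⟨y, h2, h3, h4, h5⟩ := (h1.and ((eventually_gt_atTop 0).and
        ((eventually_ge_atTop (1 / sqDist (0, 0) X)).and
        (eventually_ge_atTop (sqDist (c, 0) X / r ^ 2))))).exists
      refine ⟨y, h3, h2, ?_, ?_⟩
      · rw [div_le_iff₀ h3]
        rwa [div_le_iff₀ hXp, mul_comm] at h4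
      · rwa [div_le_iff₀ (by positivity), mul_comm] at h5
    set C : Set (Pt n) := {Z | r ^ 2 ≤ sqDist (c, 0) Z ∧ sqDist (c, 0) Z ≤ r ^ 2 * y} ∩
      {Z | 1 / y ≤ sqDist (0, 0) Z} with hC
    have hCne : ∀ Z ∈ C, Z ≠ 0 := by
      rintro Z ⟨-, hZ⟩ rfl
      have h1 : 0 < 1 / y := by positivity
      have h2 : sqDist (0, 0) (0 : Pt n) = 0 := by simp [sqDist]
      simp only [Set.mem_ofPred_eq, h2] at hZ
      linarith
    refine nonneg_of_super (σ := σ) hσ (C := C)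
      (w := fun X => w X + ε * sphereFund σ 0 1 X + ε - m * sphereFund σ c r X) ?_ ?_ ?_
      ⟨⟨hX, hy3.2⟩, hy3.1⟩ hX2
    · rw [hC, Set.inter_right_comm]
      exact (isCompact_annulus (c, 0) _ _).inter_right
        (isClosed_le continuous_const (continuous_sqDist _))
    · intro Z hZ
      have h1 := (hc Z ⟨hZ.1.1.1, hZ.2, hCne Z hZ.1⟩).mono
        (s := C ∩ {X | 0 ≤ X.2}) fun Y hY => ⟨hY.1.1.1, hY.2, hCne Y hY.1⟩
      have h2 := continuousAt_sphereFund (σ := σ) 0 one_pos (hCne Z hZ.1)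
      have h3 := continuousAt_sphereFund (σ := σ) c hr (hcne Z hZ.1.1.1)
      exact ((h1.add (h2.continuousWithinAt.const_mul ε)).add continuousWithinAt_const).sub
        (h3.continuousWithinAt.const_mul m)
    · intro Z hZ hZ2 hlt
      have hZ0 := hCne Z hZ
      have hF0 := sphereFund_nonneg (σ := σ) (0 : EuclideanSpace ℝ (Fin n)) 1 Z
      have hmF : m * sphereFund σ c r Z ≤ m := mul_le_of_le_one_right hm (hF1 Z hZ.1.1)
      have hεF : 0 ≤ ε * sphereFund σ 0 1 Z := by positivity
      have hwZ := h0 Z hZ.1.1 hZ2 hZ0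
      have a1 : r ^ 2 < sqDist (c, 0) Z := by
        refine lt_of_le_of_ne hZ.1.1 fun heq => ?_
        linarith [hw Z heq hZ2 hZ0]
      have a2 : sqDist (c, 0) Z < r ^ 2 * y := by
        refine lt_of_le_of_ne hZ.1.2 fun heq => ?_
        have h1 : sphereFund σ c r Z = (y ^ (((n : ℝ) - 2 * σ) / 2))⁻¹ := by
          rw [sphereFund, heq, ← Real.inv_rpow hy1.le]
          congr 1
          field_simp
        have h2 : m * sphereFund σ c r Z ≤ ε := by
          rw [h1, ← div_eq_mul_inv, div_le_iff₀ (Real.rpow_pos_of_pos hy1 _)]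
          exact hy2
        linarith
      have a3 : 1 / y < sqDist (0, 0) Z := by
        refine lt_of_le_of_ne hZ.2 fun heq => ?_
        have h1 : sphereFund σ 0 1 Z = y ^ (((n : ℝ) - 2 * σ) / 2) := by
          rw [sphereFund, ← heq]
          simp
        rw [h1] at hlt
        linarith
      refine ⟨inter_mem (annulus_mem_nhds a1 a2) ?_, fun ht => ?_, fun ht => ?_⟩
      · filter_upwards [(continuous_sqDist (n := n) (0, 0)).continuousAt.eventually
          (lt_mem_nhds a3)] with Y hY using le_of_lt hY
      · obtain ⟨k, hk, hk0⟩ := h Z a1 ht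
        refine ⟨_, ((hk.add ((hasExtOp_sphereFund 0 one_pos ht).const_mul ε)).add
          (hasExtOp_const ε Z)).sub ((hasExtOp_sphereFund c hr ht).const_mul m), ?_⟩
        simpa using hk0
      · have hZe : Z = (Z.1, 0) := Prod.ext rfl ht
        have hz0 : Z.1 ≠ 0 := fun h1 => hZ0 (Prod.ext h1 ht)
        have hzc : Z.1 ≠ c := fun h1 => hcne Z hZ.1.1 (Prod.ext h1 ht)
        obtain ⟨l, hl, hl0⟩ := hb Z.1 (hZe ▸ a1) hz0
        refine ⟨_, ((hl.add ((hasNormalQuot_sphereFund hσ hz0 one_pos).const_mul ε)).add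
          (hasNormalQuot_const ε _)).sub ((hasNormalQuot_sphereFund hσ hzc hr).const_mul m), ?_⟩
        simpa using hl0
  have hF := sphereFund_nonneg (σ := σ) (0 : EuclideanSpace ℝ (Fin n)) 1 X
  refine le_of_forall_pos_le_add fun ε hε => ?_
  have := key (ε / (sphereFund σ 0 1 X + 1)) (by positivity)
  have h2 : ε / (sphereFund σ 0 1 X + 1) * sphereFund σ 0 1 X + ε / (sphereFund σ 0 1 X + 1) = ε := by
    field_simp
  linarith

end Hopf

section Horizontal

variable {n : ℕ} {σ : ℝ}

theorem norm_reflPt_sub {e x y : EuclideanSpace ℝ (Fin n)} {a : ℝ} (he : ‖e‖ = 1)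
    (hy : ⟪e, y⟫ = a) : ‖x - (2 * (⟪e, x⟫ - a)) • e - y‖ = ‖x - y‖ := by
  have h1 : x - (2 * (⟪e, x⟫ - a)) • e - y = (x - y) - (2 * ⟪e, x - y⟫) • e := by
    rw [inner_sub_right, hy]
    abel
  have h2 : ‖(x - y) - (2 * ⟪e, x - y⟫) • e‖ ^ 2 = ‖x - y‖ ^ 2 := by
    rw [norm_sub_sq_real, norm_smul, real_inner_smul_right, real_inner_comm, he, mul_one,
      Real.norm_eq_abs, sq_abs]
    ring
  rw [h1]
  exact (sq_eq_sq₀ (norm_nonneg _) (norm_nonneg _)).1 h2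

theorem sqDist_reflPt {e y : EuclideanSpace ℝ (Fin n)} {a : ℝ} (he : ‖e‖ = 1) (hy : ⟪e, y⟫ = a)
    (X : Pt n) : sqDist (y, 0) (reflPt e a X) = sqDist (y, 0) X := by
  simp only [sqDist, reflPt, norm_reflPt_sub he hy]

theorem rpow_le_add_mul_sq (hσ : σ ∈ Set.Ioo (0 : ℝ) 1) {τ t : ℝ} (hτ : 0 < τ) (ht : 0 ≤ t) :
    t ^ (2 * σ) ≤ τ ^ (2 * σ) + τ ^ (2 * σ - 2) * t ^ 2 := by
  have h0 : 0 ≤ τ ^ (2 * σ - 2) * t ^ 2 := by positivity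
  have h1 : 0 ≤ τ ^ (2 * σ) := by positivity
  rcases le_total t τ with h | h
  · linarith [Real.rpow_le_rpow ht h (by linarith [hσ.1] : 0 ≤ 2 * σ)]
  · have htp := hτ.trans_le h
    have h2 : t ^ (2 * σ) = t ^ (2 * σ - 2) * t ^ 2 := by
      rw [← Real.rpow_natCast t 2, ← Real.rpow_add htp]
      norm_num
    have h3 : t ^ (2 * σ - 2) ≤ τ ^ (2 * σ - 2) :=
      Real.rpow_le_rpow_of_nonpos hτ h (by linarith [hσ.2])
    have h4 : t ^ (2 * σ - 2) * t ^ 2 ≤ τ ^ (2 * σ - 2) * t ^ 2 := by gcongr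
    linarith

/-- Quantitative comparison of a solution with its reflection across a vertical hyperplane. -/
theorem sub_reflPt_le (hσ : σ ∈ Set.Ioo (0 : ℝ) 1) {y e : EuclideanSpace ℝ (Fin n)} (he : ‖e‖ = 1)
    {r M S τ A : ℝ} (hr : 0 < r) (hM : 0 ≤ M) (hS : 0 ≤ S) (hτ : 0 < τ) {U : Pt n → ℝ}
    {ℓ : EuclideanSpace ℝ (Fin n) → ℝ}
    (hc : ContinuousOn U ({X : Pt n | sqDist (y, 0) X ≤ r ^ 2} ∩ {X | 0 ≤ X.2}))
    (hU : ∀ X, sqDist (y, 0) X ≤ r ^ 2 → 0 < X.2 → HasExtOp σ U X 0)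
    (hq : ∀ x, sqDist (y, 0) (x, 0) ≤ r ^ 2 → HasNormalQuot σ U x (ℓ x))
    (hUS : ∀ X, sqDist (y, 0) X ≤ r ^ 2 → 0 ≤ X.2 → |U X| ≤ S)
    (hℓ : ∀ x x', sqDist (y, 0) (x, 0) ≤ r ^ 2 → sqDist (y, 0) (x', 0) ≤ r ^ 2 → ℓ x' - ℓ x ≤ M)
    (hA : 2 * A = M * (τ ^ (2 * σ - 2) * (4 - 4 * σ)) + 2 * S / r ^ 2 * (2 * n + 4 - 4 * σ))
    {X : Pt n} (hX : sqDist (y, 0) X ≤ r ^ 2) (hX2 : 0 ≤ X.2) (hXe : 0 ≤ ⟪e, X.1⟫ - ⟪e, y⟫) :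
    U X - U (reflPt e ⟪e, y⟫ X) ≤
      M * (τ ^ (2 * σ) + τ ^ (2 * σ - 2) * X.2 ^ 2 - X.2 ^ (2 * σ)) +
        (A * r * (⟪e, X.1⟫ - ⟪e, y⟫) - A * (⟪e, X.1⟫ - ⟪e, y⟫) ^ 2) +
          2 * S / r ^ 2 * sqDist (y, 0) X := by
  set c := ⟪e, y⟫ with hcdef
  set φ : Pt n → ℝ := fun X => M * (τ ^ (2 * σ) + τ ^ (2 * σ - 2) * X.2 ^ 2 - X.2 ^ (2 * σ)) +
        (A * r * (⟪e, X.1⟫ - c) - A * (⟪e, X.1⟫ - c) ^ 2) + 2 * S / r ^ 2 * sqDist (y, 0) X with hφ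
  have hn0 : (0 : ℝ) ≤ n := Nat.cast_nonneg n
  have hA0 : 0 ≤ A := by
    have h1 : 0 ≤ M * (τ ^ (2 * σ - 2) * (4 - 4 * σ)) :=
      mul_nonneg hM (mul_nonneg (by positivity) (by linarith [hσ.2]))
    have h2 : 0 ≤ 2 * S / r ^ 2 * (2 * n + 4 - 4 * σ) :=
      mul_nonneg (by positivity) (by linarith [hσ.2])
    linarith
  have hmaps : ∀ Z : Pt n, sqDist (y, 0) Z ≤ r ^ 2 → sqDist (y, 0) (reflPt e c Z) ≤ r ^ 2 :=
    fun Z hZ => (sqDist_reflPt he hcdef.symm Z).trans_le hZ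
  have hs : ∀ Z : Pt n, sqDist (y, 0) Z ≤ r ^ 2 → ⟪e, Z.1⟫ - c ≤ r := by
    intro Z hZ
    have h1 : ‖Z.1 - y‖ ≤ r :=
      le_of_sq_le_sq ((norm_sub_sq_le_sqDist (y, 0) Z).trans hZ) hr.le
    have h2 := real_inner_le_norm e (Z.1 - y)
    rw [he, one_mul, inner_sub_right] at h2
    linarith
  have hφ0 : ∀ Z : Pt n, sqDist (y, 0) Z ≤ r ^ 2 → 0 ≤ Z.2 → 0 ≤ ⟪e, Z.1⟫ - c →
      2 * S / r ^ 2 * sqDist (y, 0) Z ≤ φ Z := by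
    intro Z h1 h2 h3
    have h4 : 0 ≤ M * (τ ^ (2 * σ) + τ ^ (2 * σ - 2) * Z.2 ^ 2 - Z.2 ^ (2 * σ)) :=
      mul_nonneg hM (by linarith [rpow_le_add_mul_sq hσ hτ h2])
    have h5 : 0 ≤ A * r * (⟪e, Z.1⟫ - c) - A * (⟪e, Z.1⟫ - c) ^ 2 := by
      have : 0 ≤ A * ((⟪e, Z.1⟫ - c) * (r - (⟪e, Z.1⟫ - c))) :=
        mul_nonneg hA0 (mul_nonneg h3 (by linarith [hs Z h1]))
      linarith
    simp only [hφ]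
    linarith
  have hφc : Continuous φ := by
    have h1 : Continuous fun X : Pt n => X.2 ^ (2 * σ) :=
      continuous_snd.rpow_const fun X => Or.inr (by linarith [hσ.1])
    have h2 := continuous_sqDist (n := n) (y, 0)
    have h3 := (contDiff_affine e c (n := n) (k := 0)).continuous
    fun_prop
  set C : Set (Pt n) := {Z | sqDist (y, 0) Z ≤ r ^ 2} ∩ {Z | 0 ≤ ⟪e, Z.1⟫ - c} with hC
  have hgoal := nonneg_of_super (σ := σ) hσ (C := C) (w := fun Z => φ Z - (U Z - U (reflPt e c Z)))
    ?_ ?_ ?_ ⟨hX, hXe⟩ hX2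
  · linarith
  · rw [hC, Set.inter_assoc]
    exact (isCompact_sqDist_le _ _).inter_right ((isClosed_le continuous_const
      (contDiff_affine e c (n := n) (k := 0)).continuous).inter isClosed_upper)
  · refine hφc.continuousOn.sub ((hc.mono fun Z hZ => ⟨hZ.1.1, hZ.2⟩).sub (hc.comp
      (contDiff_reflPt e c (k := 0)).continuous.continuousOn fun Z hZ => ⟨hmaps Z hZ.1.1, hZ.2⟩))
  · rintro Z ⟨h1, h2⟩ h3 hlt
    have hZ1 := abs_le.1 (hUS Z h1 h3)
    have hZ2 := abs_le.1 (hUS (reflPt e c Z) (hmaps Z h1) h3)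
    have hφZ := hφ0 Z h1 h3 h2
    have b1 : sqDist (y, 0) Z < r ^ 2 := by
      refine lt_of_le_of_ne h1 fun heq => ?_
      rw [heq, div_mul_cancel₀ _ (by positivity)] at hφZ
      linarith
    have b2 : 0 < ⟪e, Z.1⟫ - c := by
      refine lt_of_le_of_ne h2 fun heq => ?_
      have h4 : reflPt e c Z = Z := by simp [reflPt, ← heq]
      have h5 : 0 ≤ 2 * S / r ^ 2 * sqDist (y, 0) Z :=
        mul_nonneg (by positivity) (sqDist_nonneg _ _)
      rw [h4] at hlt
      linarith
    refine ⟨inter_mem ?_ ?_, fun ht => ?_, fun ht => ?_⟩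
    · filter_upwards [(continuous_sqDist (n := n) (y, 0)).continuousAt.eventually
        (gt_mem_nhds b1)] with Y hY using le_of_lt hY
    · filter_upwards [(contDiff_affine e c (n := n) (k := 0)).continuous.continuousAt.eventually
        (lt_mem_nhds b2)] with Y hY using le_of_lt hY
    · have hUR := hU (reflPt e c Z) (hmaps Z h1) ht
      have hR : HasExtOp σ (fun X => U (reflPt e c X)) Z 0 :=
        ⟨hUR.1.comp Z (contDiff_reflPt e c).contDiffAt, by
          rw [extOp_comp_reflPt he c hUR.1, hUR.2]⟩
      have haff : HasExtOp σ (fun X => ⟪e, X.1⟫ - c) Z 0 :=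
        ⟨(contDiff_affine e c).contDiffAt, extOp_affine e c Z⟩
      have haff2 : HasExtOp σ (fun X => (⟪e, X.1⟫ - c) ^ 2) Z (2 * ‖e‖ ^ 2) :=
        ⟨((contDiff_affine e c).pow 2).contDiffAt, extOp_affine_sq e c Z⟩
      refine ⟨_, ((((((hasExtOp_const _ Z).add ((hasExtOp_sq ht).const_mul _)).sub
        (hasExtOp_rpow ht)).const_mul M).add ((haff.const_mul (A * r)).sub
        (haff2.const_mul A))).add ((hasExtOp_sqDist y ht).const_mul _)).sub
        ((hU Z h1 ht).sub hR), ?_⟩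
      rw [he]
      linarith
    · have hZe : Z = (Z.1, 0) := Prod.ext rfl ht
      have h1' : sqDist (y, 0) (Z.1, 0) ≤ r ^ 2 := hZe ▸ h1
      have h6 : reflPt e c Z = ((reflPt e c (Z.1, 0)).1, 0) := Prod.ext rfl ht
      have h7 : sqDist (y, 0) ((reflPt e c (Z.1, 0)).1, 0) ≤ r ^ 2 := h6 ▸ hmaps Z h1
      have hR := hasNormalQuot_comp_reflPt (hq _ h7)
      refine ⟨_, ((((((hasNormalQuot_const _ Z.1).add ((hasNormalQuot_sq hσ _).const_mul _)).sub
        (hasNormalQuot_rpow hσ.1 _)).const_mul M).add (hasNormalQuot_of_horizontal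
        (fun x => A * r * (⟪e, x⟫ - c) - A * (⟪e, x⟫ - c) ^ 2) Z.1)).add
        ((hasNormalQuot_sqDist hσ y _).const_mul _)).sub ((hq _ h1').sub hR), ?_⟩
      have := hℓ _ _ h1' h7
      linarith

set_option maxHeartbeats 400000 in
/-- Near a boundary point, a solution is almost horizontally constant on horizontal balls of
radius comparable to the square of the height. -/
theorem eventually_abs_sub_le (hσ : σ ∈ Set.Ioo (0 : ℝ) 1) {y : EuclideanSpace ℝ (Fin n)}
    {N : Set (Pt n)} (hN : N ∈ 𝓝 ((y, 0) : Pt n)) {U : Pt n → ℝ}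
    {ℓ : EuclideanSpace ℝ (Fin n) → ℝ} (hc : ContinuousOn U (N ∩ {X | 0 ≤ X.2}))
    (hU : ∀ X ∈ N, 0 < X.2 → HasExtOp σ U X 0)
    (hq : ∀ x, ((x, 0) : Pt n) ∈ N → HasNormalQuot σ U x (ℓ x)) (hℓ : ContinuousAt ℓ y)
    {κ ε : ℝ} (hκ : 0 ≤ κ) (hε : 0 < ε) :
    ∀ᶠ τ in 𝓝[>] (0 : ℝ), ∀ x, ‖x - y‖ ≤ κ * τ ^ 2 → |U (x, τ) - U (y, τ)| ≤ ε * τ ^ (2 * σ) := by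
  set M : ℝ := ε / (4 * (1 + κ)) with hMdef
  have hM : 0 < M := by positivity
  have hMκ : M * (1 + κ) = ε / 4 := by rw [hMdef]; field_simp
  obtain ⟨η, hη, hηM⟩ := Metric.continuousAt_iff.1 hℓ (M / 2) (by positivity)
  obtain ⟨ρ, hρ, hball⟩ := exists_sqDist_subset hN
  obtain ⟨r, hr, hr1, hr2, hr3⟩ : ∃ r : ℝ, 0 < r ∧ r ≤ 1 / 2 ∧ 2 * r < η ∧ 4 * r ^ 2 ≤ ρ := by
    refine ⟨min (1 / 2) (min (η / 4) (min 1 ρ / 4)), by positivity, min_le_left _ _, ?_, ?_⟩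
    · have := (min_le_right (1 / 2) (min (η / 4) (min 1 ρ / 4))).trans (min_le_left _ _)
      linarith
    · set r := min (1 / 2 : ℝ) (min (η / 4) (min 1 ρ / 4))
      have h1 : r ≤ min 1 ρ / 4 := (min_le_right _ _).trans (min_le_right _ _)
      have h2 := min_le_left 1 ρ
      have h3 := min_le_right 1 ρ
      have h4 : 0 ≤ r := by positivity
      nlinarith
  have hbig : ∀ X : Pt n, sqDist (y, 0) X ≤ 4 * r ^ 2 → X ∈ N := fun X hX => hball X (hX.trans hr3)
  obtain ⟨S, hS0, hS⟩ : ∃ S, 0 ≤ S ∧ ∀ X : Pt n, sqDist (y, 0) X ≤ 4 * r ^ 2 → 0 ≤ X.2 →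
      |U X| ≤ S := by
    have hcomp := (isCompact_sqDist_le ((y, 0) : Pt n) (4 * r ^ 2)).inter_right
      (isClosed_upper (n := n))
    obtain ⟨S, hS⟩ := hcomp.exists_bound_of_continuousOn
      (hc.mono fun X hX => ⟨hbig X hX.1, hX.2⟩)
    exact ⟨max S 0, le_max_right _ _, fun X h1 h2 => (hS X ⟨h1, h2⟩).trans (le_max_left _ _)⟩
  set N' : ℝ := 2 * S / r ^ 2 with hN'
  have hN'0 : 0 ≤ N' := by positivity
  have hev : ∀ᶠ τ in 𝓝[>] (0 : ℝ),
      N' * (τ ^ 2 * (κ * (n + 2) + κ ^ 2 * τ ^ 2 + 1)) / τ ^ (2 * σ) < ε / 2 := by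
    have h1 := tendsto_even_quot hσ (K := fun s => N' * (s * (κ * (n + 2) + κ ^ 2 * s + 1)))
      (by fun_prop)
    simp only [zero_mul, mul_zero, sub_zero] at h1
    exact h1.eventually (gt_mem_nhds (by positivity))
  have hev2 : ∀ᶠ τ in 𝓝[>] (0 : ℝ), κ * τ ^ 2 < r / 2 := by
    have h1 : Continuous fun τ : ℝ => κ * τ ^ 2 := by fun_prop
    exact (h1.continuousAt.eventually (gt_mem_nhds (by simpa using half_pos hr))).filter_mono
      nhdsWithin_le_nhds
  filter_upwards [hev, hev2, Ioo_mem_nhdsGT (half_pos hr)] with τ h1 h2 ⟨h3, h4⟩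
  have hτσ : 0 < τ ^ (2 * σ) := Real.rpow_pos_of_pos h3 _
  rw [div_lt_iff₀ hτσ] at h1
  have main : ∀ x x', ‖x - y‖ ≤ κ * τ ^ 2 → ‖x' - y‖ ≤ κ * τ ^ 2 →
      U (x, τ) - U (x', τ) ≤ ε * τ ^ (2 * σ) := by
    intro x x' hx hx'
    by_cases hxx : x = x'
    · rw [hxx, sub_self]
      positivity
    have hd : 0 < ‖x - x'‖ := norm_pos_iff.2 (sub_ne_zero.2 hxx)
    set z := (1 / 2 : ℝ) • (x + x') with hz
    set e := (‖x - x'‖)⁻¹ • (x - x') with he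
    have he1 : ‖e‖ = 1 := by
      rw [he, norm_smul, norm_inv, norm_norm, inv_mul_cancel₀ hd.ne']
    have hde : ‖x - x'‖ • e = x - x' := by
      rw [he, smul_smul, mul_inv_cancel₀ hd.ne', one_smul]
    have hxz : x - z = (‖x - x'‖ / 2) • e := by
      rw [div_eq_inv_mul, ← smul_smul, hde, hz]
      module
    have hsx : ⟪e, x⟫ - ⟪e, z⟫ = ‖x - x'‖ / 2 := by
      rw [← inner_sub_right, hxz, real_inner_smul_right, real_inner_self_eq_norm_sq, he1]
      ring
    have hrefl : reflPt e ⟪e, z⟫ (x, τ) = (x', τ) := by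
      refine Prod.ext ?_ rfl
      simp only [reflPt]
      rw [hsx, mul_div_cancel₀ _ two_ne_zero, hde]
      abel
    have hzy : ‖z - y‖ ≤ κ * τ ^ 2 := by
      have h5 : z - y = (1 / 2 : ℝ) • ((x - y) + (x' - y)) := by
        rw [hz]
        module
      rw [h5, norm_smul]
      have h6 := norm_add_le (x - y) (x' - y)
      norm_num
      linarith
    have hxx' : ‖x - x'‖ ≤ 2 * (κ * τ ^ 2) := by
      have h6 := norm_sub_le (x - y) (x' - y)
      rw [sub_sub_sub_cancel_right] at h6
      linarith
    have hsub : ∀ X : Pt n, sqDist (z, 0) X ≤ r ^ 2 → sqDist (y, 0) X ≤ 4 * r ^ 2 := by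
      intro X hX
      have h5 := sqDist_triangle (y, 0) (z, 0) X
      have h6 : sqDist (y, 0) ((z, 0) : Pt n) ≤ r ^ 2 := by
        simp only [sqDist, sub_zero]
        nlinarith [norm_nonneg (z - y)]
      linarith
    have hℓM : ∀ w, sqDist (z, 0) ((w, 0) : Pt n) ≤ r ^ 2 → |ℓ w - ℓ y| < M / 2 := by
      intro w hw
      have h5 := (norm_sub_sq_le_sqDist (y, 0) ((w, 0) : Pt n)).trans (hsub _ hw)
      have h6 : ‖w - y‖ ≤ 2 * r := le_of_sq_le_sq (by simpa [mul_pow] using (by linarith)) (by positivity)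
      exact hηM (by rw [dist_eq_norm]; linarith)
    have hXd : sqDist (z, 0) (x, τ) = (‖x - x'‖ / 2) ^ 2 + τ ^ 2 := by
      simp only [sqDist, sub_zero]
      rw [hxz, norm_smul, he1, mul_one, Real.norm_of_nonneg (by positivity)]
    have hXd2 : sqDist (z, 0) (x, τ) ≤ r ^ 2 := by
      rw [hXd]
      nlinarith
    have key := sub_reflPt_le hσ (y := z) he1 hr hM.le hS0 h3
      (A := (M * (τ ^ (2 * σ - 2) * (4 - 4 * σ)) + N' * (2 * n + 4 - 4 * σ)) / 2)
      (hc.mono fun X hX => ⟨hbig X (hsub X hX.1), hX.2⟩)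
      (fun X hX => hU X (hbig X (hsub X hX))) (fun w hw => hq w (hbig _ (hsub _ hw)))
      (fun X hX => hS X (hsub X hX)) (fun w w' hw hw' => by
        have h5 := abs_lt.1 (hℓM w hw)
        have h6 := abs_lt.1 (hℓM w' hw')
        linarith) (by rw [← hN']; ring) hXd2 h3.le (by rw [hsx]; positivity)
    rw [hrefl, hsx, hXd, ← hN'] at key
    have hτ2 : τ ^ (2 * σ - 2) * τ ^ 2 = τ ^ (2 * σ) := by
      rw [← Real.rpow_natCast τ 2, ← Real.rpow_add h3]
      norm_num
    simp only [hτ2] at key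
    set D := ‖x - x'‖ / 2 with hD
    have hD0 : 0 ≤ D := by positivity
    have hDκ : D ≤ κ * τ ^ 2 := by linarith
    have hn0 : (0 : ℝ) ≤ n := Nat.cast_nonneg n
    have e1 : M * (τ ^ (2 * σ - 2) * (4 - 4 * σ)) / 2 * r * D ≤ M * κ * τ ^ (2 * σ) := by
      have hτ3 : 0 < τ ^ (2 * σ - 2) := Real.rpow_pos_of_pos h3 _
      calc M * (τ ^ (2 * σ - 2) * (4 - 4 * σ)) / 2 * r * D
          ≤ M * (τ ^ (2 * σ - 2) * 4) / 2 * (1 / 2) * (κ * τ ^ 2) := by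
            gcongr
            linarith [hσ.1]
        _ = M * κ * (τ ^ (2 * σ - 2) * τ ^ 2) := by ring
        _ = M * κ * τ ^ (2 * σ) := by rw [hτ2]
    have e2 : N' * (2 * n + 4 - 4 * σ) / 2 * r * D ≤ N' * (τ ^ 2 * (κ * (n + 2))) := by
      calc N' * (2 * n + 4 - 4 * σ) / 2 * r * D
          ≤ N' * (2 * n + 4) / 2 * 1 * (κ * τ ^ 2) := by
            gcongr
            · linarith [hσ.1]
            · linarith
        _ = N' * (τ ^ 2 * (κ * (n + 2))) := by ring
    have e3 : N' * (D ^ 2 + τ ^ 2) ≤ N' * (τ ^ 2 * (κ ^ 2 * τ ^ 2 + 1)) := by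
      calc N' * (D ^ 2 + τ ^ 2) ≤ N' * ((κ * τ ^ 2) ^ 2 + τ ^ 2) := by gcongr
        _ = N' * (τ ^ 2 * (κ ^ 2 * τ ^ 2 + 1)) := by ring
    have e4 : 0 ≤ (M * (τ ^ (2 * σ - 2) * (4 - 4 * σ)) + N' * (2 * n + 4 - 4 * σ)) / 2 * D ^ 2 := by
      have hτ3 : 0 < τ ^ (2 * σ - 2) := Real.rpow_pos_of_pos h3 _
      have : 0 ≤ 4 - 4 * σ := by linarith [hσ.2]
      have : 0 ≤ 2 * (n : ℝ) + 4 - 4 * σ := by linarith [hσ.2]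
      positivity
    have e5 : M * (τ ^ (2 * σ) + τ ^ (2 * σ) - τ ^ (2 * σ)) + M * κ * τ ^ (2 * σ) =
        ε / 4 * τ ^ (2 * σ) := by rw [← hMκ]; ring
    have e6 : 0 ≤ ε * τ ^ (2 * σ) := by positivity
    linarith
  intro x hx
  have hyy : ‖y - y‖ ≤ κ * τ ^ 2 := by
    rw [sub_self, norm_zero]
    positivity
  exact abs_le.2 ⟨by linarith [main y x hyy hx], main x y hx hyy⟩

end Horizontal

section Solution

variable {n : ℕ} {σ : ℝ} {U : Pt n → ℝ}

theorem tendsto_vertical (x : EuclideanSpace ℝ (Fin n)) :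
    Tendsto (fun t : ℝ => ((x, t) : Pt n)) (𝓝[>] 0) (𝓝[{X | 0 ≤ X.2}] (x, 0)) := by
  refine tendsto_nhdsWithin_of_tendsto_nhds_of_eventually_within _ ?_ ?_
  · have : Continuous fun t : ℝ => ((x, t) : Pt n) := by fun_prop
    exact (this.tendsto 0).mono_left nhdsWithin_le_nhds
  · filter_upwards [self_mem_nhdsWithin] with t ht using le_of_lt (show (0 : ℝ) < t from ht)

theorem hasNormalQuot_of_tendsto_dt (hσ : σ ∈ Set.Ioo (0 : ℝ) 1) {x : EuclideanSpace ℝ (Fin n)}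
    {L : ℝ} (hc : ContinuousWithinAt U {X | 0 ≤ X.2} (x, 0))
    (hd : ∀ X : Pt n, 0 < X.2 → DifferentiableAt ℝ U X)
    (h : Tendsto (fun t : ℝ => t ^ (1 - 2 * σ) * dt U (x, t)) (𝓝[>] 0) (𝓝 L)) :
    HasNormalQuot σ U x (L / (2 * σ)) := by
  have hs : 0 < 2 * σ := by linarith [hσ.1]
  refine HasDerivAt.lhopital_zero_nhdsGT (f' := fun t => dt U (x, t))
    (g' := fun t => 2 * σ * t ^ (2 * σ - 1)) ?_ ?_ ?_ ?_ ?_ ?_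
  · filter_upwards [self_mem_nhdsWithin] with t ht
    have h1 : HasDerivAt (fun t : ℝ => ((x, t) : Pt n)) (0, 1) t :=
      (hasDerivAt_const t x).prodMk (hasDerivAt_id t)
    exact ((hd (x, t) ht).hasFDerivAt.comp_hasDerivAt t h1).sub_const _
  · filter_upwards [self_mem_nhdsWithin] with t ht
    exact Real.hasDerivAt_rpow_const (Or.inl (ne_of_gt ht))
  · filter_upwards [self_mem_nhdsWithin] with t ht
    have := Real.rpow_pos_of_pos ht (2 * σ - 1)
    positivity
  · have := (hc.tendsto.comp (tendsto_vertical x)).sub_const (U (x, 0))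
    simpa using this
  · have h1 : ContinuousAt (fun t : ℝ => t ^ (2 * σ)) 0 :=
      Real.continuousAt_rpow_const _ _ (Or.inr hs.le)
    have h2 : Tendsto (fun t : ℝ => t ^ (2 * σ)) (𝓝 0) (𝓝 0) := by
      simpa [ContinuousAt, Real.zero_rpow hs.ne'] using h1
    exact h2.mono_left nhdsWithin_le_nhds
  · refine (h.div_const (2 * σ)).congr' ?_
    filter_upwards [self_mem_nhdsWithin] with t ht
    have h1 : t ^ (1 - 2 * σ) * t ^ (2 * σ - 1) = 1 := by
      rw [← Real.rpow_add ht]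
      norm_num
    have h2 := Real.rpow_pos_of_pos ht (2 * σ - 1)
    rw [div_eq_div_iff hs.ne' (by positivity)]
    linear_combination (dt U (x, t) * 2 * σ) * h1

theorem GlobalExtSol.hasExtOp (hU : GlobalExtSol n σ U) {X : Pt n} (hX : 0 < X.2) :
    HasExtOp σ U X 0 :=
  ⟨hU.2.2.1.contDiffAt ((isOpen_lt continuous_const continuous_snd).mem_nhds hX),
    hU.2.2.2.1 X hX⟩

theorem GlobalExtSol.continuousWithinAt (hU : GlobalExtSol n σ U) {X : Pt n} (hX : 0 ≤ X.2)
    (hX0 : X ≠ 0) : ContinuousWithinAt U {X | 0 ≤ X.2} X := by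
  refine (hU.2.1 X ⟨hX, hX0⟩).mono_of_mem_nhdsWithin ?_
  exact Filter.inter_mem self_mem_nhdsWithin
    (mem_nhdsWithin_of_mem_nhds (isOpen_compl_singleton.mem_nhds hX0))

theorem GlobalExtSol.hasNormalQuot (hσ : σ ∈ Set.Ioo (0 : ℝ) 1) (hU : GlobalExtSol n σ U)
    {x : EuclideanSpace ℝ (Fin n)} (hx : x ≠ 0) :
    HasNormalQuot σ U x (-(U (x, 0) ^ (((n : ℝ) + 2 * σ) / ((n : ℝ) - 2 * σ))) / (2 * σ)) :=
  hasNormalQuot_of_tendsto_dt hσ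
    (hU.continuousWithinAt le_rfl fun h => hx (congrArg Prod.fst h))
    (fun _ hX => (hU.hasExtOp hX).1.differentiableAt (by simp)) (hU.2.2.2.2 x hx)

theorem GlobalExtSol.continuousAt_trace (hU : GlobalExtSol n σ U) {x : EuclideanSpace ℝ (Fin n)}
    (hx : x ≠ 0) : ContinuousAt (fun y => U (y, 0)) x := by
  have h := hU.continuousWithinAt (X := (x, 0)) le_rfl fun h => hx (congrArg Prod.fst h)
  have h2 : Continuous fun y : EuclideanSpace ℝ (Fin n) => ((y, 0) : Pt n) := by fun_prop
  exact h.tendsto.comp (tendsto_nhdsWithin_of_tendsto_nhds_of_eventually_within _ (h2.tendsto x)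
    (Eventually.of_forall fun y => le_refl (0 : ℝ)))

/-- The origin is a non-removable singularity of the trace of `U`. -/
def NonRemovable {n : ℕ} (U : Pt n → ℝ) : Prop :=
  ¬ ∃ ε : ℝ, 0 < ε ∧ ∃ v : EuclideanSpace ℝ (Fin n) → ℝ,
    ContinuousOn v {x : EuclideanSpace ℝ (Fin n) | ‖x‖ < ε} ∧
    ∀ x : EuclideanSpace ℝ (Fin n), ‖x‖ < ε → x ≠ 0 → v x = U (x, 0)

theorem NonRemovable.false_of_eventually_eq (h : NonRemovable U)
    {V : EuclideanSpace ℝ (Fin n) → ℝ} (hV : ∀ᶠ x in 𝓝 0, ContinuousAt V x)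
    (hVU : ∀ᶠ x in 𝓝 0, x ≠ 0 → V x = U (x, 0)) : False := by
  obtain ⟨ε, hε, hball⟩ := Metric.eventually_nhds_iff.1 (hV.and hVU)
  refine h ⟨ε, hε, V, fun x hx => ?_, fun x hx => ?_⟩
  · exact (hball (by simpa using hx)).1.continuousWithinAt
  · exact (hball (by simpa using hx)).2

theorem convex_halfSpace : Convex ℝ {X : Pt n | 0 < X.2} :=
  (convex_Ioi (0 : ℝ)).linear_preimage (LinearMap.snd ℝ (EuclideanSpace ℝ (Fin n)) ℝ)

theorem trace_eq_of_vertical {V W : Pt n → ℝ} {x : EuclideanSpace ℝ (Fin n)}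
    (hV : ContinuousWithinAt V {X | 0 ≤ X.2} (x, 0))
    (hW : ContinuousWithinAt W {X | 0 ≤ X.2} (x, 0))
    (h : ∀ᶠ t in 𝓝[>] (0 : ℝ), V (x, t) = W (x, t)) : V (x, 0) = W (x, 0) :=
  tendsto_nhds_unique ((hV.tendsto.comp (tendsto_vertical x)).congr' h)
    (hW.tendsto.comp (tendsto_vertical x))

theorem GlobalExtSol.pos (hσ : σ ∈ Set.Ioo (0 : ℝ) 1) (hU : GlobalExtSol n σ U)
    (hnr : NonRemovable U) {X : Pt n} (hX : 0 ≤ X.2) (hX0 : X ≠ 0) : 0 < U X := by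
  have hne : ∀ Z : Pt n, 0 < Z.2 → Z ≠ 0 := fun Z hZ h => by
    rw [h] at hZ
    exact lt_irrefl _ hZ
  have hpos : ∀ X ∈ {X : Pt n | 0 < X.2}, 0 < U X := by
    refine (eq_zero_or_pos_of_super hσ (isOpen_lt continuous_const continuous_snd)
      convex_halfSpace.isPreconnected (fun X hX => hX)
      (fun X hX => hU.1 X (le_of_lt hX) (hne X hX))
      (fun X hX => ⟨0, hU.hasExtOp hX, le_rfl⟩)).resolve_left fun hz => ?_
    refine hnr.false_of_eventually_eq (V := fun _ => 0)
      (Eventually.of_forall fun x => continuousAt_const) (Eventually.of_forall fun x hx => ?_)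
    refine trace_eq_of_vertical (V := fun _ => 0) continuousWithinAt_const
      (hU.continuousWithinAt le_rfl fun h => hx (congrArg Prod.fst h)) ?_
    filter_upwards [self_mem_nhdsWithin] with t ht using (hz (x, t) ht).symm
  rcases hX.lt_or_eq with h | h
  · exact hpos X h
  · have hXe : X = (X.1, 0) := Prod.ext rfl h.symm
    have hx0 : X.1 ≠ 0 := fun h1 => hX0 (by rw [hXe, h1]; rfl)
    rw [hXe]
    refine pos_of_super_boundary hσ (N := {0}ᶜ) (isOpen_compl_singleton.mem_nhds (hXe ▸ hX0)) ?_
      (fun Z hZ hZ2 => hU.1 Z hZ2 hZ) (fun Z _ => hpos Z)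
      (fun Z _ hZ2 => ⟨0, hU.hasExtOp hZ2, le_rfl⟩) (hU.hasNormalQuot hσ hx0) ?_
    · exact hU.2.1.mono fun Z hZ => ⟨hZ.2, hZ.1⟩
    · have := Real.rpow_nonneg (hU.1 (X.1, 0) le_rfl (hXe ▸ hX0))
        (((n : ℝ) + 2 * σ) / ((n : ℝ) - 2 * σ))
      exact div_nonpos_of_nonpos_of_nonneg (by linarith) (by linarith [hσ.1])

theorem HasNormalQuot.kelvin (hσ : σ ∈ Set.Ioo (0 : ℝ) 1) {c x : EuclideanSpace ℝ (Fin n)}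
    (hx : x ≠ c) {r : ℝ} (hr : 0 < r) {N : Set (Pt n)} (hN : N ∈ 𝓝 (invPt c r (x, 0)))
    {ℓ : EuclideanSpace ℝ (Fin n) → ℝ} (hc : ContinuousOn U (N ∩ {X | 0 ≤ X.2}))
    (hU : ∀ X ∈ N, 0 < X.2 → HasExtOp σ U X 0)
    (hq : ∀ x, ((x, 0) : Pt n) ∈ N → HasNormalQuot σ U x (ℓ x))
    (hℓ : ContinuousAt ℓ (invPt c r (x, 0)).1) :
    HasNormalQuot σ (kelvin σ c r U) x
      ((r ^ 2 / sqDist (c, 0) (x, 0)) ^ (((n : ℝ) - 2 * σ) / 2) *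
        (r ^ 2 / sqDist (c, 0) (x, 0)) ^ (2 * σ) * ℓ (invPt c r (x, 0)).1) := by
  set d := ‖x - c‖ with hd
  have hdp : 0 < d := norm_pos_iff.2 (sub_ne_zero.2 hx)
  have hqt : ∀ t : ℝ, sqDist (c, 0) ((x, t) : Pt n) = d ^ 2 + t ^ 2 := fun t => by
    simp [sqDist, hd]
  set f : ℝ → ℝ := fun s => r ^ 2 / (d ^ 2 + s) with hf
  have hfq : ∀ t : ℝ, r ^ 2 / sqDist (c, 0) ((x, t) : Pt n) = f (t ^ 2) := fun t => by rw [hqt]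
  have hf0 : r ^ 2 / sqDist (c, 0) ((x, 0) : Pt n) = f 0 := by rw [hfq]; norm_num
  have hfpos : ∀ s, 0 ≤ s → 0 < f s := fun s hs => by simp only [hf]; positivity
  have hinv : ∀ t : ℝ, invPt c r ((x, t) : Pt n) = (c + f (t ^ 2) • (x - c), f (t ^ 2) * t) := by
    intro t
    simp only [invPt, hfq]
    ext <;> simp
  set y0 := c + f 0 • (x - c) with hy0
  have hinv0 : invPt c r ((x, 0) : Pt n) = (y0, 0) := by rw [hinv]; simp [hy0]
  rw [hinv0] at hN hℓ ⊢
  rw [hf0]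
  simp only at hℓ ⊢
  set γ := ((n : ℝ) - 2 * σ) / 2 with hγ
  have hdf : DifferentiableAt ℝ f 0 := by
    refine (differentiableAt_const _).div (by fun_prop) ?_
    simp only [add_zero]
    positivity
  have hdk : DifferentiableAt ℝ (fun s => f s ^ γ) 0 :=
    hdf.rpow_const (Or.inl (hfpos 0 le_rfl).ne')
  have hsq : Tendsto (fun t : ℝ => t ^ 2) (𝓝[>] 0) (𝓝 0) := by
    have : Continuous fun t : ℝ => t ^ 2 := by fun_prop
    simpa using (this.tendsto 0).mono_left nhdsWithin_le_nhds
  have hft : Tendsto (fun t : ℝ => f (t ^ 2)) (𝓝[>] 0) (𝓝 (f 0)) :=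
    hdf.continuousAt.tendsto.comp hsq
  have hτ : Tendsto (fun t : ℝ => f (t ^ 2) * t) (𝓝[>] 0) (𝓝[>] 0) := by
    refine tendsto_nhdsWithin_of_tendsto_nhds_of_eventually_within _ ?_ ?_
    · have : Tendsto (fun t : ℝ => t) (𝓝[>] 0) (𝓝 0) := tendsto_id.mono_left nhdsWithin_le_nhds
      simpa using hft.mul this
    · filter_upwards [self_mem_nhdsWithin] with t ht
      exact mul_pos (hfpos _ (sq_nonneg t)) ht
  have hratio : ∀ t : ℝ, 0 < t → (f (t ^ 2) * t) ^ (2 * σ) / t ^ (2 * σ) = f (t ^ 2) ^ (2 * σ) := by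
    intro t ht
    rw [Real.mul_rpow (hfpos _ (sq_nonneg t)).le ht.le,
      mul_div_cancel_right₀ _ (Real.rpow_pos_of_pos ht _).ne']
  have hf2 : Tendsto (fun t : ℝ => f (t ^ 2) ^ (2 * σ)) (𝓝[>] 0) (𝓝 (f 0 ^ (2 * σ))) :=
    hft.rpow_const (Or.inl (hfpos 0 le_rfl).ne')
  have t1 : Tendsto (fun t : ℝ => (f (t ^ 2) ^ γ - f 0 ^ γ) / t ^ (2 * σ)) (𝓝[>] 0) (𝓝 0) :=
    tendsto_even_quot hσ hdk
  have hN0 : ContinuousWithinAt U (N ∩ {X | 0 ≤ X.2}) (y0, 0) :=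
    hc _ ⟨mem_of_mem_nhds hN, le_refl (0 : ℝ)⟩
  have hY : Tendsto (fun t : ℝ => U (invPt c r (x, t))) (𝓝[>] 0) (𝓝 (U (y0, 0))) := by
    refine hN0.tendsto.comp ?_
    have h1 : Tendsto (fun t : ℝ => invPt c r ((x, t) : Pt n)) (𝓝[>] 0) (𝓝 (y0, 0)) := by
      simp only [hinv]
      exact ((hft.smul_const _).const_add c).prodMk_nhds (hτ.mono_right nhdsWithin_le_nhds)
    refine tendsto_nhdsWithin_of_tendsto_nhds_of_eventually_within _ h1 ?_
    filter_upwards [h1.eventually hN, hτ.eventually self_mem_nhdsWithin] with t h2 h3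
    refine ⟨h2, ?_⟩
    rw [hinv]
    exact le_of_lt (show (0 : ℝ) < f (t ^ 2) * t from h3)
  have hy0q := hq y0 (mem_of_mem_nhds hN)
  have t3 : Tendsto (fun t : ℝ => (U (y0, f (t ^ 2) * t) - U (y0, 0)) / t ^ (2 * σ)) (𝓝[>] 0)
      (𝓝 (ℓ y0 * f 0 ^ (2 * σ))) := by
    refine ((Tendsto.comp hy0q hτ).mul hf2).congr' ?_
    filter_upwards [self_mem_nhdsWithin] with t ht
    have h1 : 0 < (f (t ^ 2) * t) ^ (2 * σ) :=
      Real.rpow_pos_of_pos (mul_pos (hfpos _ (sq_nonneg t)) ht) _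
    rw [← hratio t ht]
    exact div_mul_div_cancel₀ h1.ne'
  have t2 : Tendsto (fun t : ℝ => (U (invPt c r (x, t)) - U (y0, f (t ^ 2) * t)) / t ^ (2 * σ))
      (𝓝[>] 0) (𝓝 0) := by
    rw [Metric.tendsto_nhds]
    intro ε hε
    have hFb : ∀ᶠ t in 𝓝[>] (0 : ℝ), f (t ^ 2) ^ (2 * σ) < f 0 ^ (2 * σ) + 1 :=
      hf2.eventually (gt_mem_nhds (by linarith))
    have hf0p : 0 ≤ f 0 ^ (2 * σ) := Real.rpow_nonneg (hfpos 0 le_rfl).le _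
    have hev := hτ.eventually (eventually_abs_sub_le hσ hN hc hU hq hℓ (κ := 2 * d / r ^ 2)
      (ε := ε / (2 * (f 0 ^ (2 * σ) + 1))) (by positivity) (by positivity))
    filter_upwards [hev, hFb, Ioo_mem_nhdsGT hdp] with t h1 h2 ⟨h3, h4⟩
    have htσ : 0 < t ^ (2 * σ) := Real.rpow_pos_of_pos h3 _
    have h5 : ‖c + f (t ^ 2) • (x - c) - y0‖ ≤ 2 * d / r ^ 2 * (f (t ^ 2) * t) ^ 2 := by
      rw [hy0, add_sub_add_left_eq_sub, ← sub_smul, norm_smul, ← hd, Real.norm_eq_abs,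
        abs_sub_comm, abs_of_nonneg]
      · have h6 : (f 0 - f (t ^ 2)) * d = r ^ 2 * t ^ 2 / (d * (d ^ 2 + t ^ 2)) := by
          simp only [hf]
          field_simp
          ring
        have h7 : 2 * d / r ^ 2 * (f (t ^ 2) * t) ^ 2 =
            r ^ 2 * t ^ 2 * (2 * d) / (d ^ 2 + t ^ 2) ^ 2 := by
          simp only [hf]
          field_simp
        rw [h6, h7, div_le_div_iff₀ (by positivity) (by positivity)]
        have h8 : (d ^ 2 + t ^ 2) ≤ 2 * d ^ 2 := by nlinarith
        have h9 : 0 ≤ r ^ 2 * t ^ 2 * (d ^ 2 + t ^ 2) := by positivity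
        nlinarith [mul_le_mul_of_nonneg_left h8 h9]
      · rw [sub_nonneg]
        simp only [hf]
        gcongr
        nlinarith
    have h6 := h1 _ h5
    rw [dist_zero_right, norm_div, Real.norm_eq_abs, Real.norm_of_nonneg htσ.le, hinv]
    have h7 : (f (t ^ 2) * t) ^ (2 * σ) = f (t ^ 2) ^ (2 * σ) * t ^ (2 * σ) := by
      rw [← hratio t h3, div_mul_cancel₀ _ htσ.ne']
    rw [div_lt_iff₀ htσ]
    refine h6.trans_lt ?_
    rw [h7, ← mul_assoc]
    refine mul_lt_mul_of_pos_right ?_ htσ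
    rw [div_mul_eq_mul_div, div_lt_iff₀ (by positivity)]
    nlinarith
  have hsum := (t1.mul hY).add ((t2.add t3).const_mul (f 0 ^ γ))
  refine (hsum.congr fun t => ?_).trans (le_of_eq ?_)
  · have h0 : f ((0 : ℝ) ^ 2) = f 0 := by norm_num
    simp only [_root_.kelvin, hfq, h0, hinv0, ← hγ]
    ring
  · congr 1
    ring

end Solution

section MovingSpheres

variable {n : ℕ} {σ : ℝ} {U : Pt n → ℝ}

theorem sqDist_invPt {c : EuclideanSpace ℝ (Fin n)} {r : ℝ} {X : Pt n} (hX : X ≠ (c, 0)) :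
    sqDist (c, 0) (invPt c r X) = r ^ 2 / sqDist (c, 0) X * r ^ 2 := by
  have hq := sqDist_pos hX
  have h : sqDist (c, 0) (invPt c r X) = (r ^ 2 / sqDist (c, 0) X) ^ 2 * sqDist (c, 0) X := by
    simp only [sqDist, invPt, Prod.fst_add, Prod.snd_add, Prod.smul_fst, Prod.smul_snd,
      Prod.fst_sub, Prod.snd_sub, add_sub_cancel_left, norm_smul, Real.norm_eq_abs, mul_pow, sq_abs,
      smul_eq_mul]
    ring
  rw [h]
  field_simp

theorem sqDist_zero_right (c : EuclideanSpace ℝ (Fin n)) : sqDist (c, 0) 0 = ‖c‖ ^ 2 := by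
  simp [sqDist]

theorem ne_of_sq_le_sqDist {c : EuclideanSpace ℝ (Fin n)} {r : ℝ} (hr : 0 < r) {X : Pt n}
    (hX : r ^ 2 ≤ sqDist (c, 0) X) : X ≠ (c, 0) := by
  rintro rfl
  simp only [sqDist, sub_self, norm_zero] at hX
  nlinarith

theorem sqDist_invPt_le {c : EuclideanSpace ℝ (Fin n)} {r : ℝ} (hr : 0 < r) {X : Pt n}
    (hX : r ^ 2 ≤ sqDist (c, 0) X) : sqDist (c, 0) (invPt c r X) ≤ r ^ 2 := by
  have hne := ne_of_sq_le_sqDist hr hX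
  rw [sqDist_invPt hne]
  exact mul_le_of_le_one_left (sq_nonneg r) ((div_le_one (sqDist_pos hne)).2 hX)

theorem ne_zero_of_sqDist_lt {c : EuclideanSpace ℝ (Fin n)} {X : Pt n}
    (hX : sqDist (c, 0) X < ‖c‖ ^ 2) : X ≠ 0 := by
  rintro rfl
  exact lt_irrefl _ (hX.trans_eq (sqDist_zero_right c).symm)

theorem invPt_ne_zero {c : EuclideanSpace ℝ (Fin n)} {r : ℝ} (hr : 0 < r) (hrc : r < ‖c‖) {X : Pt n}
    (hX : r ^ 2 ≤ sqDist (c, 0) X) : invPt c r X ≠ 0 :=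
  ne_zero_of_sqDist_lt ((sqDist_invPt_le hr hX).trans_lt (by gcongr))

theorem invPt_snd (c : EuclideanSpace ℝ (Fin n)) (r : ℝ) (X : Pt n) :
    (invPt c r X).2 = r ^ 2 / sqDist (c, 0) X * X.2 := by
  simp [invPt]

theorem invPt_snd_nonneg (c : EuclideanSpace ℝ (Fin n)) (r : ℝ) {X : Pt n} (hX : 0 ≤ X.2) :
    0 ≤ (invPt c r X).2 := by
  rw [invPt_snd]
  exact mul_nonneg (div_nonneg (sq_nonneg r) (sqDist_nonneg _ _)) hX

theorem kelvin_eq_self {c : EuclideanSpace ℝ (Fin n)} {r : ℝ} (hr : 0 < r) {X : Pt n}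
    (hX : sqDist (c, 0) X = r ^ 2) : kelvin σ c r U X = U X := by
  have h : r ^ 2 / sqDist (c, 0) X = 1 := by
    rw [hX]
    exact div_self (by positivity)
  simp [kelvin, invPt, h]

theorem GlobalExtSol.hasExtOp_kelvin (hU : GlobalExtSol n σ U) {c : EuclideanSpace ℝ (Fin n)} {r : ℝ}
    (hr : 0 < r) {X : Pt n} (hX : 0 < X.2) : HasExtOp σ (kelvin σ c r U) X 0 := by
  have hXc : X ≠ (c, 0) := by
    rintro rfl
    exact lt_irrefl _ hX
  have h2 : 0 < (invPt c r X).2 := by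
    rw [invPt_snd]
    have := sqDist_pos hXc
    positivity
  have hi := hU.hasExtOp h2
  refine ⟨contDiffAt_kelvin hr hXc hi.1, ?_⟩
  rw [extOp_kelvin hr hX hi.1, hi.2, mul_zero]

theorem GlobalExtSol.continuousWithinAt_kelvin (hU : GlobalExtSol n σ U)
    {c : EuclideanSpace ℝ (Fin n)} {r : ℝ} (hr : 0 < r) {X : Pt n} (hX : X ≠ (c, 0)) (hX2 : 0 ≤ X.2)
    (hX0 : invPt c r X ≠ 0) : ContinuousWithinAt (kelvin σ c r U) {X | 0 ≤ X.2} X := by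
  have hq := sqDist_pos hX
  have h1 : ContinuousAt (fun Z : Pt n => r ^ 2 / sqDist (c, 0) Z) X :=
    continuousAt_const.div (continuous_sqDist _).continuousAt hq.ne'
  have h2 : ContinuousAt (invPt c r) X := by
    unfold invPt
    exact continuousAt_const.add (h1.smul (continuousAt_id.sub continuousAt_const))
  have h3 : ContinuousAt (fun Z : Pt n => (r ^ 2 / sqDist (c, 0) Z) ^ (((n : ℝ) - 2 * σ) / 2)) X :=
    h1.rpow_const (Or.inl (by positivity))
  refine h3.continuousWithinAt.mul ?_
  exact (hU.continuousWithinAt (invPt_snd_nonneg c r hX2) hX0).comp h2.continuousWithinAt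
    fun Z hZ => invPt_snd_nonneg c r hZ

theorem GlobalExtSol.hasNormalQuot_kelvin (hσ : σ ∈ Set.Ioo (0 : ℝ) 1) (hn : 2 * σ < n)
    (hU : GlobalExtSol n σ U) {c x : EuclideanSpace ℝ (Fin n)} (hx : x ≠ c) {r : ℝ} (hr : 0 < r)
    (hx0 : invPt c r (x, 0) ≠ 0) :
    HasNormalQuot σ (kelvin σ c r U) x
      (-(kelvin σ c r U (x, 0) ^ (((n : ℝ) + 2 * σ) / ((n : ℝ) - 2 * σ))) / (2 * σ)) := by
  set p := ((n : ℝ) + 2 * σ) / ((n : ℝ) - 2 * σ) with hp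
  have hi : invPt c r (x, 0) = ((invPt c r (x, 0)).1, 0) := Prod.ext rfl (by simp [invPt_snd])
  have hi0 : (invPt c r (x, 0)).1 ≠ 0 := fun h => hx0 (by rw [hi, h]; rfl)
  have hγ : 0 < (n : ℝ) - 2 * σ := by linarith
  have hp0 : 0 < p := by
    have := hσ.1
    rw [hp]
    positivity
  have hq : 0 < r ^ 2 / sqDist (c, 0) ((x, 0) : Pt n) := by
    have := sqDist_pos (X := (x, 0)) (Y := (c, 0)) fun h => hx (congrArg Prod.fst h)
    positivity
  have h := HasNormalQuot.kelvin hσ hx hr (N := {0}ᶜ) (isOpen_compl_singleton.mem_nhds hx0)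
    (ℓ := fun y => -(U (y, 0) ^ p) / (2 * σ)) (hU.2.1.mono fun Z hZ => ⟨hZ.2, hZ.1⟩)
    (fun Z _ hZ => hU.hasExtOp hZ)
    (fun y hy => hU.hasNormalQuot hσ fun h => hy (by rw [h]; rfl))
    (((hU.continuousAt_trace hi0).rpow_const (Or.inr hp0.le)).neg.div_const _)
  convert h using 1
  rw [kelvin, Real.mul_rpow (by positivity) (hU.1 _ (invPt_snd_nonneg c r le_rfl) hx0),
    ← Real.rpow_mul hq.le, ← Real.rpow_add hq, ← hi]
  have : ((n : ℝ) - 2 * σ) / 2 * p = ((n : ℝ) - 2 * σ) / 2 + 2 * σ := by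
    rw [hp]
    field_simp
    ring
  rw [this]
  ring

theorem rpow_sub_rpow_le_mul_sub {p a b M : ℝ} (hp : 1 ≤ p) (ha : 0 ≤ a) (hab : a < b)
    (hbM : b ≤ M) : b ^ p - a ^ p ≤ p * M ^ (p - 1) * (b - a) := by
  have hb : 0 < b := ha.trans_lt hab
  have h := one_add_mul_self_le_rpow_one_add (s := a / b - 1) (by linarith [div_nonneg ha hb.le]) hp
  rw [add_sub_cancel, Real.div_rpow ha hb.le, le_div_iff₀ (Real.rpow_pos_of_pos hb p)] at h
  have h1 : b ^ p = b ^ (p - 1) * b := by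
    rw [← Real.rpow_add_one hb.ne', sub_add_cancel]
  have h2 : b ^ (p - 1) ≤ M ^ (p - 1) := Real.rpow_le_rpow hb.le hbM (by linarith)
  have h3 : (1 + p * (a / b - 1)) * b ^ p = b ^ p - p * b ^ (p - 1) * (b - a) := by
    rw [h1]
    field_simp
    ring
  have h4 : p * b ^ (p - 1) * (b - a) ≤ p * M ^ (p - 1) * (b - a) := by
    have : 0 ≤ b - a := by linarith
    gcongr
  linarith

/-- Comparison of `U` with its Kelvin transform on a narrow annulus. -/
theorem GlobalExtSol.exists_kelvin_le_of_narrow (hσ : σ ∈ Set.Ioo (0 : ℝ) 1) (hn : 2 * σ < n)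
    (hU : GlobalExtSol n σ U) {c : EuclideanSpace ℝ (Fin n)} {R : ℝ} (hRc : R < ‖c‖) :
    ∃ δ, 0 < δ ∧ ∀ r ρ : ℝ, 0 < r → ρ ≤ R → ρ ^ 2 - r ^ 2 ≤ δ →
      (∀ X, sqDist (c, 0) X = ρ ^ 2 → 0 ≤ X.2 → kelvin σ c r U X ≤ U X) →
      ∀ X, r ^ 2 ≤ sqDist (c, 0) X → sqDist (c, 0) X ≤ ρ ^ 2 → 0 < ρ → 0 ≤ X.2 →
        kelvin σ c r U X ≤ U X := by
  set p := ((n : ℝ) + 2 * σ) / ((n : ℝ) - 2 * σ) with hp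
  have hγ : 0 < (n : ℝ) - 2 * σ := by linarith
  have hσ0 := hσ.1
  have hp1 : 1 ≤ p := by
    rw [hp, le_div_iff₀ hγ]
    linarith
  obtain ⟨M, hM0, hM⟩ : ∃ M, 0 ≤ M ∧ ∀ X, sqDist (c, 0) X ≤ R ^ 2 → 0 ≤ R → 0 ≤ X.2 → U X ≤ M := by
    by_cases hR : 0 ≤ R
    · have hcomp : IsCompact ({X : Pt n | sqDist (c, 0) X ≤ R ^ 2} ∩ {X | 0 ≤ X.2}) :=
        (isCompact_sqDist_le _ _).inter_right isClosed_upper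
      obtain ⟨M, hM⟩ := hcomp.bddAbove_image (f := U) (hU.2.1.mono fun X hX => ⟨hX.2,
        ne_zero_of_sqDist_lt ((show sqDist (c, 0) X ≤ R ^ 2 from hX.1).trans_lt (by gcongr))⟩)
      exact ⟨max M 0, le_max_right _ _, fun X h1 _ h2 =>
        (hM (Set.mem_image_of_mem U ⟨h1, h2⟩)).trans (le_max_left _ _)⟩
    · exact ⟨0, le_rfl, fun X _ h => absurd h hR⟩
  obtain ⟨δ, hδ, H⟩ := exists_narrow_annulus_nonneg n hσ (C0 := p * M ^ (p - 1) / (2 * σ))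
    (by positivity)
  refine ⟨δ, hδ, fun r ρ hr hρR hδρ hb X hX1 hX2 hρ hX3 => ?_⟩
  have hrρ : r ≤ ρ := le_of_sq_le_sq (hX1.trans hX2) hρ.le
  have hrc : r < ‖c‖ := by linarith
  have hZ0 : ∀ Z : Pt n, sqDist (c, 0) Z ≤ ρ ^ 2 → Z ≠ 0 := fun Z hZ =>
    ne_zero_of_sqDist_lt (hZ.trans_lt (by gcongr; linarith))
  have := H c (r ^ 2) (ρ ^ 2) (fun X => U X - kelvin σ c r U X) hδρ ?_ ?_ X hX1 hX2 hX3
  · linarith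
  · intro Z hZ
    exact ((hU.continuousWithinAt hZ.2 (hZ0 Z hZ.1.2)).sub (hU.continuousWithinAt_kelvin hr
      (ne_of_sq_le_sqDist hr hZ.1.1) hZ.2 (invPt_ne_zero hr hrc hZ.1.1))).mono fun W hW => hW.2
  · intro P hP1 hP2 hP3 hwP
    have hP0 := hZ0 P hP2
    have hPi := invPt_ne_zero hr hrc hP1
    refine ⟨lt_of_le_of_ne hP1 fun h => ?_, lt_of_le_of_ne hP2 fun h => ?_, fun hpos => ?_,
      fun hzero => ?_⟩
    · rw [kelvin_eq_self hr h.symm] at hwP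
      linarith
    · linarith [hb P h hP3]
    · exact ⟨0 - 0, (hU.hasExtOp hpos).sub (hU.hasExtOp_kelvin hr hpos), by norm_num⟩
    · have hPe : P = (P.1, 0) := Prod.ext rfl hzero
      have hPc : P.1 ≠ c := fun h => ne_of_sq_le_sqDist hr hP1 (by rw [hPe, h])
      have hPx : P.1 ≠ 0 := fun h => hP0 (by rw [hPe, h]; rfl)
      refine ⟨_, (hU.hasNormalQuot hσ hPx).sub (hU.hasNormalQuot_kelvin hσ hn hPc hr (hPe ▸ hPi)), ?_⟩
      rw [← hPe, ← hp]
      have hle : kelvin σ c r U P ≤ M := by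
        have h1 : U (invPt c r P) ≤ M := hM _ ((sqDist_invPt_le hr hP1).trans (by gcongr; linarith))
          (by linarith) (invPt_snd_nonneg c r hP3)
        have h2 : r ^ 2 / sqDist (c, 0) P ≤ 1 :=
          (div_le_one (sqDist_pos (ne_of_sq_le_sqDist hr hP1))).2 hP1
        have h3 := Real.rpow_le_one (div_nonneg (sq_nonneg r) (sqDist_nonneg _ _)) h2
          (z := ((n : ℝ) - 2 * σ) / 2) (by linarith)
        exact (mul_le_of_le_one_left (hU.1 _ (invPt_snd_nonneg c r hP3) hPi) h3).trans h1
      have hmv := rpow_sub_rpow_le_mul_sub hp1 (hU.1 P hP3 hP0) (sub_neg.1 hwP) hle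
      rw [← sub_div, div_mul_eq_mul_div, ← neg_div]
      gcongr
      linarith

end MovingSpheres

section MovingSpheres

variable {n : ℕ} {σ : ℝ} {U : Pt n → ℝ} {c : EuclideanSpace ℝ (Fin n)}

/-- The Kelvin transform of `U` in the sphere of radius `r` about `(c, 0)` lies below `U` outside
that sphere. -/
def KelvinLe {n : ℕ} (σ : ℝ) (U : Pt n → ℝ) (c : EuclideanSpace ℝ (Fin n)) (r : ℝ) : Prop :=
  ∀ X, r ^ 2 ≤ sqDist (c, 0) X → 0 ≤ X.2 → X ≠ 0 → kelvin σ c r U X ≤ U X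

theorem isPreconnected_exterior (c : EuclideanSpace ℝ (Fin n)) {r : ℝ} (hr : 0 < r) :
    IsPreconnected {X : Pt n | r ^ 2 < sqDist (c, 0) X ∧ 0 < X.2} := by
  have hpos : ∀ y : EuclideanSpace ℝ (Fin n), 0 < √(‖y‖ ^ 2 + 1) := fun y => by positivity
  have hconv : Convex ℝ (Set.univ ×ˢ Set.Ioi r : Set (Pt n)) := convex_univ.prod (convex_Ioi r)
  have hcont : Continuous fun Z : Pt n => ((c, 0) : Pt n) + (Z.2 / √(‖Z.1‖ ^ 2 + 1)) • (Z.1, (1 : ℝ)) :=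
    continuous_const.add (Continuous.smul
      (continuous_snd.div (by fun_prop) fun Z => (hpos Z.1).ne') (by fun_prop))
  convert hconv.isPreconnected.image _ hcont.continuousOn using 1
  ext X
  simp only [Set.mem_ofPred_eq, Set.mem_image, Set.mem_prod, Set.mem_univ, true_and, Set.mem_Ioi]
  constructor
  · rintro ⟨h1, h2⟩
    refine ⟨((1 / X.2) • (X.1 - c), √(sqDist (c, 0) X)), Real.lt_sqrt_of_sq_lt h1, ?_⟩
    have h3 : ‖(1 / X.2) • (X.1 - c)‖ ^ 2 + 1 = sqDist (c, 0) X / X.2 ^ 2 := by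
      simp only [norm_smul, mul_pow, sqDist, Real.norm_eq_abs, sq_abs]
      field_simp
      ring
    have h4 : 0 < √(sqDist (c, 0) X) := Real.sqrt_pos.2 (lt_trans (by positivity) h1)
    have h5 : √(sqDist (c, 0) X) / √(‖(1 / X.2) • (X.1 - c)‖ ^ 2 + 1) = X.2 := by
      rw [h3, Real.sqrt_div' _ (by positivity), Real.sqrt_sq h2.le]
      field_simp
    simp only [h5]
    refine Prod.ext ?_ ?_
    · simp [smul_smul, h2.ne']
    · simp
  · rintro ⟨Z, hZ, rfl⟩
    have h1 : 0 < Z.2 := hr.trans hZ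
    have h2 := hpos Z.1
    refine ⟨?_, by simpa using div_pos h1 h2⟩
    have h3 : sqDist (c, 0) (((c, 0) : Pt n) + (Z.2 / √(‖Z.1‖ ^ 2 + 1)) • (Z.1, (1 : ℝ))) = Z.2 ^ 2 := by
      simp only [sqDist, Prod.fst_add, Prod.snd_add, Prod.smul_fst, Prod.smul_snd,
        add_sub_cancel_left, norm_smul, Real.norm_eq_abs, mul_pow, sq_abs, smul_eq_mul, mul_one,
        div_pow, Real.sq_sqrt (show 0 ≤ ‖Z.1‖ ^ 2 + 1 by positivity), zero_add, sub_zero]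
      field_simp
    rw [h3]
    gcongr

theorem sphereFund_eq (r : ℝ) (X : Pt n) : sphereFund σ c r X =
    (r ^ 2) ^ (((n : ℝ) - 2 * σ) / 2) / sqDist (c, 0) X ^ (((n : ℝ) - 2 * σ) / 2) :=
  Real.div_rpow (sq_nonneg r) (sqDist_nonneg _ _) _

theorem exists_pos_le_on_sphere {r : ℝ} {w : Pt n → ℝ}
    (hw : ∀ X, sqDist (c, 0) X = r ^ 2 → 0 ≤ X.2 →
      ContinuousWithinAt w {X | 0 ≤ X.2} X ∧ 0 < w X) :
    ∃ m, 0 < m ∧ ∀ X, r ^ 2 = sqDist (c, 0) X → 0 ≤ X.2 → X ≠ 0 → m ≤ w X := by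
  obtain ⟨m, hm, h⟩ := (isCompact_annulus (c, 0) (r ^ 2) (r ^ 2)).exists_forall_le' (f := w)
    (a := 0)
    (fun X hX => ((hw X (le_antisymm hX.1.2 hX.1.1) hX.2).1).mono fun Z hZ => hZ.2)
    (fun X hX => (hw X (le_antisymm hX.1.2 hX.1.1) hX.2).2)
  exact ⟨m, hm, fun X h1 h2 _ => h X ⟨⟨h1.le, h1.ge⟩, h2⟩⟩

theorem GlobalExtSol.exists_kelvinLe (hσ : σ ∈ Set.Ioo (0 : ℝ) 1) (hn : 2 * σ < n)
    (hU : GlobalExtSol n σ U) (hnr : NonRemovable U) (hc : c ≠ 0) :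
    ∃ r0, 0 < r0 ∧ ∀ r, 0 < r → r ≤ r0 → KelvinLe σ U c r := by
  have hcn : 0 < ‖c‖ := norm_pos_iff.2 hc
  have hg : 0 < ((n : ℝ) - 2 * σ) / 2 := by linarith
  obtain ⟨δ, hδ, H⟩ := hU.exists_kelvin_le_of_narrow hσ hn (c := c) (R := ‖c‖ / 2) (by linarith)
  set ρ := min (‖c‖ / 2) √δ with hρ
  have hρ0 : 0 < ρ := lt_min (by linarith) (Real.sqrt_pos.2 hδ)
  have hρc : ρ ≤ ‖c‖ / 2 := min_le_left _ _
  have hρδ : ρ ^ 2 ≤ δ := by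
    rw [← Real.sq_sqrt hδ.le]
    exact pow_le_pow_left₀ hρ0.le (min_le_right _ _) 2
  have hZ0 : ∀ Z : Pt n, sqDist (c, 0) Z ≤ ρ ^ 2 → Z ≠ 0 := fun Z hZ =>
    ne_zero_of_sqDist_lt (hZ.trans_lt (by gcongr; linarith))
  obtain ⟨m, hm, hmU⟩ := exists_pos_le_on_sphere (c := c) (r := ρ) (w := U)
    fun X h1 h2 => ⟨hU.continuousWithinAt h2 (hZ0 X h1.le), hU.pos hσ hnr h2 (hZ0 X h1.le)⟩
  obtain ⟨M, hM⟩ := ((isCompact_sqDist_le ((c, 0) : Pt n) (ρ ^ 2)).inter_right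
    isClosed_upper).bddAbove_image (f := U) (hU.2.1.mono fun X hX => ⟨hX.2, hZ0 X hX.1⟩)
  have hMle : ∀ X : Pt n, sqDist (c, 0) X ≤ ρ ^ 2 → 0 ≤ X.2 → U X ≤ M := fun X h1 h2 =>
    hM (Set.mem_image_of_mem U ⟨h1, h2⟩)
  have hlim : Tendsto (fun r : ℝ => (r ^ 2) ^ (((n : ℝ) - 2 * σ) / 2) * M) (𝓝 0) (𝓝 0) := by
    have : ContinuousAt (fun r : ℝ => (r ^ 2) ^ (((n : ℝ) - 2 * σ) / 2) * M) 0 :=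
      ((by fun_prop : ContinuousAt (fun r : ℝ => r ^ 2) 0).rpow_const (Or.inr hg.le)).mul_const M
    simpa [ContinuousAt, Real.zero_rpow hg.ne'] using this
  have hB : 0 < m * (ρ ^ 2) ^ (((n : ℝ) - 2 * σ) / 2) := by positivity
  obtain ⟨η, hη, hball⟩ := Metric.eventually_nhds_iff.1 (hlim.eventually (gt_mem_nhds hB))
  refine ⟨min (η / 2) ρ, lt_min (by linarith) hρ0, fun r hr hr0 => ?_⟩
  have hrη : r ≤ η / 2 := hr0.trans (min_le_left _ _)
  have hrρ : r ≤ ρ := hr0.trans (min_le_right _ _)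
  have hsmall := hball (y := r) (by rw [dist_zero_right, Real.norm_of_nonneg hr.le]; linarith)
  have hext : ∀ X, ρ ^ 2 ≤ sqDist (c, 0) X → 0 ≤ X.2 → X ≠ 0 → kelvin σ c r U X ≤ U X := by
    intro X h1 h2 h3
    have h4 := mul_sphereFund_le_of_super hσ hn hρ0
      (fun Z hZ => (hU.continuousWithinAt hZ.2.1 hZ.2.2).mono fun W hW => hW.2.1)
      (fun Z _ => hU.1 Z) (fun Z _ hZ => ⟨0, hU.hasExtOp hZ, le_rfl⟩)
      (fun x _ hx => ⟨_, hU.hasNormalQuot hσ hx, ?_⟩) hm.le hmU h1 h2 h3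
    · refine le_trans ?_ h4
      have h5 : r ^ 2 ≤ sqDist (c, 0) X := le_trans (by gcongr) h1
      have h6 := hMle _ ((sqDist_invPt_le hr h5).trans (by gcongr)) (invPt_snd_nonneg c r h2)
      have hq := sqDist_pos (ne_of_sq_le_sqDist hr h5)
      rw [sphereFund_eq ρ, kelvin, Real.div_rpow (sq_nonneg r) hq.le, ← mul_div_assoc,
        div_mul_eq_mul_div]
      exact div_le_div_of_nonneg_right (le_trans (mul_le_mul_of_nonneg_left h6 (by positivity))
        hsmall.le) (by positivity)
    · have := Real.rpow_nonneg (hU.1 (x, 0) le_rfl fun h => hx (congrArg Prod.fst h))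
        (((n : ℝ) + 2 * σ) / ((n : ℝ) - 2 * σ))
      exact div_nonpos_of_nonpos_of_nonneg (by linarith) (by linarith [hσ.1])
  intro X h1 h2 h3
  rcases le_total (ρ ^ 2) (sqDist (c, 0) X) with h4 | h4
  · exact hext X h4 h2 h3
  · exact H r ρ hr hρc (by nlinarith) (fun Z h5 h6 => hext Z h5.ge h6 (hZ0 Z h5.le)) X h1 h4 hρ0 h2

/-- Outside the sphere, a solution is strictly above its Kelvin transform as soon as it is weakly
above it. -/
theorem KelvinLe.lt (hσ : σ ∈ Set.Ioo (0 : ℝ) 1) (hn : 2 * σ < n) (hU : GlobalExtSol n σ U)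
    (hnr : NonRemovable U) {r : ℝ} (hr : 0 < r) (hrc : r < ‖c‖) (h : KelvinLe σ U c r) {X : Pt n}
    (hX : r ^ 2 < sqDist (c, 0) X) (hX2 : 0 ≤ X.2) (hX0 : X ≠ 0) : kelvin σ c r U X < U X := by
  have hop : ∀ Z : Pt n, 0 < Z.2 → HasExtOp σ (fun X => U X - kelvin σ c r U X) Z 0 := fun Z hZ => by
    simpa using (hU.hasExtOp hZ).sub (hU.hasExtOp_kelvin hr hZ)
  have hne : ∀ Z : Pt n, 0 < Z.2 → Z ≠ 0 := fun Z hZ h => by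
    rw [h] at hZ
    exact lt_irrefl _ hZ
  have hcu : ∀ Z : Pt n, r ^ 2 < sqDist (c, 0) Z → 0 ≤ Z.2 → Z ≠ 0 →
      ContinuousWithinAt U {X | 0 ≤ X.2} Z ∧
      ContinuousWithinAt (kelvin σ c r U) {X | 0 ≤ X.2} Z := fun Z h1 h2 h3 =>
    ⟨hU.continuousWithinAt h2 h3, hU.continuousWithinAt_kelvin hr
      (ne_of_sq_le_sqDist hr h1.le) h2 (invPt_ne_zero hr hrc h1.le)⟩
  have hopen : IsOpen {X : Pt n | r ^ 2 < sqDist (c, 0) X} :=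
    isOpen_lt continuous_const (continuous_sqDist _)
  have hpos : ∀ Z : Pt n, r ^ 2 < sqDist (c, 0) Z → 0 < Z.2 → 0 < U Z - kelvin σ c r U Z := by
    have := (eq_zero_or_pos_of_super hσ
      (Ω := {X : Pt n | r ^ 2 < sqDist (c, 0) X ∧ 0 < X.2})
      (hopen.inter (isOpen_lt continuous_const continuous_snd))
      (isPreconnected_exterior c hr) (fun Z hZ => hZ.2) (w := fun X => U X - kelvin σ c r U X)
      (fun Z hZ => sub_nonneg.2 (h Z hZ.1.le hZ.2.le (hne Z hZ.2)))
      (fun Z hZ => ⟨0, hop Z hZ.2, le_rfl⟩)).resolve_left fun hz => ?_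
    · exact fun Z h1 h2 => this Z ⟨h1, h2⟩
    · have hsec : Continuous fun x : EuclideanSpace ℝ (Fin n) => ((x, 0) : Pt n) := by fun_prop
      have h0 : ∀ᶠ x : EuclideanSpace ℝ (Fin n) in 𝓝 0, ((x, 0) : Pt n) ∈
          {X : Pt n | r ^ 2 < sqDist (c, 0) X} := by
        refine hsec.continuousAt.eventually_mem (hopen.mem_nhds ?_)
        change r ^ 2 < sqDist (c, 0) (0 : Pt n)
        rw [sqDist_zero_right]
        gcongr
      refine hnr.false_of_eventually_eq (V := fun x => kelvin σ c r U (x, 0)) ?_ ?_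
      · filter_upwards [h0] with x hx
        have hk := hU.continuousWithinAt_kelvin (σ := σ) hr (ne_of_sq_le_sqDist hr (le_of_lt hx))
          (le_refl (0 : ℝ)) (invPt_ne_zero hr hrc (le_of_lt hx))
        exact hk.tendsto.comp (tendsto_nhdsWithin_of_tendsto_nhds_of_eventually_within _
          (hsec.tendsto x) (Eventually.of_forall fun y => le_refl (0 : ℝ)))
      · filter_upwards [h0] with x hx hx0
        obtain ⟨h1, h2⟩ := hcu (x, 0) hx le_rfl fun h => hx0 (congrArg Prod.fst h)
        refine trace_eq_of_vertical h2 h1 ?_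
        have hv := (tendsto_vertical x).mono_right nhdsWithin_le_nhds
        filter_upwards [self_mem_nhdsWithin, hv.eventually (hopen.mem_nhds hx)] with t ht ht2
        exact (sub_eq_zero.1 (hz (x, t) ⟨ht2, ht⟩)).symm
  rcases hX2.lt_or_eq with h2 | h2
  · exact sub_pos.1 (hpos X hX h2)
  · have hXe : X = (X.1, 0) := Prod.ext rfl h2.symm
    have hXc : X.1 ≠ c := fun h => ne_of_sq_le_sqDist hr hX.le (by rw [hXe, h])
    have hXx : X.1 ≠ 0 := fun h => hX0 (by rw [hXe, h]; rfl)
    have hXi := invPt_ne_zero hr hrc hX.le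
    rw [hXe] at hX hX0 hXi ⊢
    refine sub_pos.1 (pos_of_super_boundary hσ
      (N := {X : Pt n | r ^ 2 < sqDist (c, 0) X} ∩ {0}ᶜ)
      (inter_mem (hopen.mem_nhds hX) (isOpen_compl_singleton.mem_nhds hX0))
      (w := fun X => U X - kelvin σ c r U X) ?_ ?_ (fun Z hZ => hpos Z hZ.1)
      (fun Z _ hZ => ⟨0, hop Z hZ, le_rfl⟩)
      ((hU.hasNormalQuot hσ hXx).sub (hU.hasNormalQuot_kelvin hσ hn hXc hr hXi)) ?_)
    · intro Z hZ
      obtain ⟨h3, h4⟩ := hcu Z hZ.1.1 hZ.2 hZ.1.2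
      exact (h3.sub h4).mono fun W hW => hW.2
    · exact fun Z hZ hZ2 => sub_nonneg.2 (h Z (le_of_lt hZ.1) hZ2 hZ.2)
    · have hk0 : 0 ≤ kelvin σ c r U (X.1, 0) := mul_nonneg
        (Real.rpow_nonneg (div_nonneg (sq_nonneg r) (sqDist_nonneg _ _)) _)
        (hU.1 _ (invPt_snd_nonneg c r le_rfl) hXi)
      have h5 := h (X.1, 0) hX.le le_rfl hX0
      have hp : 0 ≤ ((n : ℝ) + 2 * σ) / ((n : ℝ) - 2 * σ) := by
        have := hσ.1
        exact div_nonneg (by positivity) (by linarith)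
      have h6 := Real.rpow_le_rpow hk0 h5 hp
      rw [← sub_div]
      exact div_nonpos_of_nonpos_of_nonneg (by linarith) (by linarith [hσ.1])

end MovingSpheres

section MovingSpheres

variable {n : ℕ} {σ : ℝ} {U : Pt n → ℝ} {c : EuclideanSpace ℝ (Fin n)}

theorem kelvin_eq_div (r : ℝ) (X : Pt n) : kelvin σ c r U X =
    (r ^ 2) ^ (((n : ℝ) - 2 * σ) / 2) *
      U ((c, 0) + r ^ 2 • ((sqDist (c, 0) X)⁻¹ • (X - (c, 0)))) /
      sqDist (c, 0) X ^ (((n : ℝ) - 2 * σ) / 2) := by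
  rw [kelvin, invPt, Real.div_rpow (sq_nonneg r) (sqDist_nonneg _ _), smul_smul, ← div_eq_mul_inv,
    div_mul_eq_mul_div]

theorem sqDist_add_smul (Y : Pt n) (r : ℝ) :
    sqDist (c, 0) ((c, 0) + r ^ 2 • Y) = r ^ 4 * sqDist 0 Y := by
  simp only [sqDist, Prod.fst_add, Prod.snd_add, Prod.smul_fst, Prod.smul_snd,
    add_sub_cancel_left, norm_smul, Real.norm_eq_abs, mul_pow, sq_abs, smul_eq_mul, zero_add,
    sub_zero, Prod.fst_zero, Prod.snd_zero]
  ring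

/-- Kelvin transforms depend continuously on the radius, uniformly outside a fixed sphere. -/
theorem GlobalExtSol.exists_kelvin_sub_lt (hn : 2 * σ < n) (hU : GlobalExtSol n σ U) {r ρ : ℝ}
    (hr : 0 < r) (hrρ : r < ρ) (hρ : ρ < ‖c‖) {ε : ℝ} (hε : 0 < ε) :
    ∃ η, 0 < η ∧ ∀ s, r ≤ s → s ≤ ρ → s - r < η → ∀ X, ρ ^ 2 ≤ sqDist (c, 0) X → 0 ≤ X.2 →
      kelvin σ c s U X ≤ kelvin σ c r U X + ε / sqDist (c, 0) X ^ (((n : ℝ) - 2 * σ) / 2) := by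
  have hg : 0 < ((n : ℝ) - 2 * σ) / 2 := by linarith
  have hρ0 : 0 < ρ := hr.trans hrρ
  set K : Set (ℝ × Pt n) := Set.Icc r ρ ×ˢ ({Y : Pt n | sqDist 0 Y ≤ (ρ ^ 2)⁻¹} ∩ {Y | 0 ≤ Y.2})
  have hK : IsCompact K :=
    isCompact_Icc.prod ((isCompact_sqDist_le _ _).inter_right isClosed_upper)
  set G : ℝ × Pt n → ℝ := fun Z =>
    (Z.1 ^ 2) ^ (((n : ℝ) - 2 * σ) / 2) * U ((c, 0) + Z.1 ^ 2 • Z.2) with hG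
  have hGc : ContinuousOn G K := by
    refine ContinuousOn.mul ?_ ?_
    · exact ((continuous_fst.pow 2).rpow_const fun _ => Or.inr hg.le).continuousOn
    · refine hU.2.1.comp (by fun_prop) fun Z hZ => ⟨?_, ?_⟩
      · have : 0 ≤ Z.1 ^ 2 * Z.2.2 := mul_nonneg (sq_nonneg _) hZ.2.2
        simpa using this
      · refine ne_zero_of_sqDist_lt (c := c) ?_
        rw [sqDist_add_smul]
        have h1 : Z.1 ≤ ρ := hZ.1.2
        have h2 : 0 ≤ Z.1 := hr.le.trans hZ.1.1
        have h3 : sqDist 0 Z.2 ≤ (ρ ^ 2)⁻¹ := hZ.2.1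
        have h4 : 0 ≤ sqDist 0 Z.2 := sqDist_nonneg 0 Z.2
        calc Z.1 ^ 4 * sqDist 0 Z.2 ≤ ρ ^ 4 * (ρ ^ 2)⁻¹ := by gcongr
          _ = ρ ^ 2 := by field_simp
          _ < ‖c‖ ^ 2 := by gcongr
  obtain ⟨η, hη, hdist⟩ := Metric.uniformContinuousOn_iff.1
    (hK.uniformContinuousOn_of_continuous hGc) ε hε
  refine ⟨η, hη, fun s hs1 hs2 hs3 X hX hX2 => ?_⟩
  have hXc := ne_of_sq_le_sqDist hρ0 hX
  have hq := sqDist_pos hXc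
  set Y : Pt n := (sqDist (c, 0) X)⁻¹ • (X - (c, 0)) with hY
  have hY1 : sqDist 0 Y ≤ (ρ ^ 2)⁻¹ := by
    have : sqDist 0 Y = (sqDist (c, 0) X)⁻¹ ^ 2 * sqDist (c, 0) X := by
      simp only [sqDist, hY, Prod.smul_fst, Prod.smul_snd, norm_smul, Real.norm_eq_abs, mul_pow,
        sq_abs, smul_eq_mul, sub_zero, Prod.fst_zero, Prod.snd_zero, Prod.fst_sub, Prod.snd_sub]
      ring
    rw [this, sq, mul_assoc, inv_mul_cancel₀ hq.ne', mul_one]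
    gcongr
  have hY2 : 0 ≤ Y.2 := by
    have : 0 ≤ (sqDist (c, 0) X)⁻¹ * X.2 := by positivity
    simpa [hY] using this
  have h := hdist (s, Y) ⟨⟨hs1, hs2⟩, hY1, hY2⟩ (r, Y) ⟨⟨le_rfl, hrρ.le⟩, hY1, hY2⟩ (by
    rw [Prod.dist_eq, dist_self, max_lt_iff, Real.dist_eq, abs_of_nonneg (by linarith)]
    exact ⟨hs3, hη⟩)
  have h' : G (s, Y) ≤ G (r, Y) + ε := by linarith [(abs_lt.1 (Real.dist_eq _ _ ▸ h)).2]
  rw [kelvin_eq_div, kelvin_eq_div, ← add_div]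
  exact div_le_div_of_nonneg_right h' (by positivity)

theorem KelvinLe.exists_gt (hσ : σ ∈ Set.Ioo (0 : ℝ) 1) (hn : 2 * σ < n) (hU : GlobalExtSol n σ U)
    (hnr : NonRemovable U) {r : ℝ} (hr : 0 < r) (hrc : r < ‖c‖) (h : KelvinLe σ U c r) :
    ∃ r1, r < r1 ∧ ∀ s, r ≤ s → s < r1 → KelvinLe σ U c s := by
  obtain ⟨δ, hδ, H⟩ := hU.exists_kelvin_le_of_narrow hσ hn (c := c) (R := (r + ‖c‖) / 2)
    (by linarith)
  obtain ⟨ρ, hρr, hρc, hρδ⟩ : ∃ ρ, r < ρ ∧ ρ ≤ (r + ‖c‖) / 2 ∧ ρ ^ 2 - r ^ 2 ≤ δ := by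
    have h1 : ContinuousAt (fun ρ : ℝ => ρ ^ 2 - r ^ 2) r := by fun_prop
    have h2 : ∀ᶠ ρ in 𝓝[>] r, ρ ^ 2 - r ^ 2 < δ :=
      (h1.eventually_lt_const (by simpa using hδ)).filter_mono nhdsWithin_le_nhds
    obtain ⟨ρ, h3, h4, h5⟩ := (h2.and (Ioc_mem_nhdsGT (show r < (r + ‖c‖) / 2 by linarith))).exists
    exact ⟨ρ, h4, h5, h3.le⟩
  have hρ0 : 0 < ρ := hr.trans hρr
  have hρc' : ρ < ‖c‖ := by linarith
  have hgt : ∀ {Z : Pt n}, ρ ^ 2 ≤ sqDist (c, 0) Z → r ^ 2 < sqDist (c, 0) Z := fun hZ =>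
    lt_of_lt_of_le (by gcongr) hZ
  have hZ0 : ∀ Z : Pt n, sqDist (c, 0) Z ≤ ρ ^ 2 → Z ≠ 0 := fun Z hZ =>
    ne_zero_of_sqDist_lt (hZ.trans_lt (by gcongr))
  have hcont : ∀ Z : Pt n, ρ ^ 2 ≤ sqDist (c, 0) Z → 0 ≤ Z.2 → Z ≠ 0 →
      ContinuousWithinAt (fun X => U X - kelvin σ c r U X) {X | 0 ≤ X.2} Z := fun Z h1 h2 h3 =>
    (hU.continuousWithinAt h2 h3).sub (hU.continuousWithinAt_kelvin hr
      (ne_of_sq_le_sqDist hρ0 h1) h2 (invPt_ne_zero hr hrc (hgt h1).le))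
  obtain ⟨m, hm, hmw⟩ := exists_pos_le_on_sphere (c := c) (r := ρ)
    (w := fun X => U X - kelvin σ c r U X) fun X h1 h2 => ⟨hcont X h1.ge h2 (hZ0 X h1.le),
      sub_pos.2 (h.lt hσ hn hU hnr hr hrc (hgt h1.ge) h2 (hZ0 X h1.le))⟩
  obtain ⟨η, hη, hclose⟩ := hU.exists_kelvin_sub_lt hn hr hρr hρc'
    (ε := m * (ρ ^ 2) ^ (((n : ℝ) - 2 * σ) / 2)) (by positivity)
  refine ⟨min (r + η) ρ, lt_min (by linarith) hρr, fun s hs1 hs2 => ?_⟩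
  have hsρ : s ≤ ρ := (hs2.trans_le (min_le_right _ _)).le
  have hsη : s - r < η := by linarith [hs2.trans_le (min_le_left _ _)]
  have hs0 : 0 < s := hr.trans_le hs1
  have hext : ∀ X, ρ ^ 2 ≤ sqDist (c, 0) X → 0 ≤ X.2 → X ≠ 0 → kelvin σ c s U X ≤ U X := by
    intro X h1 h2 h3
    have h4 := mul_sphereFund_le_of_super hσ hn hρ0 (w := fun X => U X - kelvin σ c r U X)
      (fun Z hZ => (hcont Z hZ.1 hZ.2.1 hZ.2.2).mono fun W hW => hW.2.1)
      (fun Z h5 h6 h7 => sub_nonneg.2 (h Z (hgt h5).le h6 h7))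
      (fun Z _ hZ => ⟨0 - 0, (hU.hasExtOp hZ).sub (hU.hasExtOp_kelvin hr hZ), by norm_num⟩)
      (fun x hx hx0 => ⟨_, (hU.hasNormalQuot hσ hx0).sub (hU.hasNormalQuot_kelvin hσ hn
        (fun he => ne_of_sq_le_sqDist hρ0 hx.le (by rw [he])) hr
        (invPt_ne_zero hr hrc (hgt hx.le).le)), ?_⟩) hm.le hmw h1 h2 h3
    · have h5 := hclose s hs1 hsρ hsη X h1 h2
      rw [sphereFund_eq, ← mul_div_assoc] at h4
      linarith
    · have hne : ((x, 0) : Pt n) ≠ 0 := fun he => hx0 (congrArg Prod.fst he)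
      have hk0 : 0 ≤ kelvin σ c r U (x, 0) := mul_nonneg
        (Real.rpow_nonneg (div_nonneg (sq_nonneg r) (sqDist_nonneg _ _)) _)
        (hU.1 _ (invPt_snd_nonneg c r le_rfl) (invPt_ne_zero hr hrc (hgt hx.le).le))
      have hp : 0 ≤ ((n : ℝ) + 2 * σ) / ((n : ℝ) - 2 * σ) := by
        have := hσ.1
        exact div_nonneg (by positivity) (by linarith)
      have h6 := Real.rpow_le_rpow hk0 (h (x, 0) (hgt hx.le).le le_rfl hne) hp
      rw [← sub_div]
      exact div_nonpos_of_nonpos_of_nonneg (by linarith) (by linarith [hσ.1])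
  intro X h1 h2 h3
  rcases le_total (ρ ^ 2) (sqDist (c, 0) X) with h4 | h4
  · exact hext X h4 h2 h3
  · exact H s ρ hs0 hρc (by nlinarith) (fun Z h5 h6 => hext Z h5.ge h6 (hZ0 Z h5.le)) X h1 h4 hρ0 h2

theorem GlobalExtSol.continuousAt_kelvin_radius (hn : 2 * σ < n) (hU : GlobalExtSol n σ U)
    {r : ℝ} (hr : 0 < r) (hrc : r < ‖c‖) {X : Pt n} (hX : r ^ 2 ≤ sqDist (c, 0) X)
    (hX2 : 0 ≤ X.2) : ContinuousAt (fun s => kelvin σ c s U X) r := by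
  have hg : 0 < ((n : ℝ) - 2 * σ) / 2 := by linarith
  have h1 : ContinuousAt (fun s : ℝ => s ^ 2 / sqDist (c, 0) X) r := by fun_prop
  refine (h1.rpow_const (Or.inr hg.le)).mul ?_
  have h2 : ContinuousAt (fun s : ℝ => invPt c s X) r := by
    unfold invPt
    exact continuousAt_const.add (h1.smul continuousAt_const)
  exact (hU.continuousWithinAt (invPt_snd_nonneg c r hX2)
    (invPt_ne_zero hr hrc hX)).tendsto.comp
    (tendsto_nhdsWithin_of_tendsto_nhds_of_eventually_within _ h2
      (Eventually.of_forall fun s => invPt_snd_nonneg c s hX2))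

/-- The method of moving spheres: spheres centred on the boundary hyperplane can be inflated until
they touch the origin. -/
theorem GlobalExtSol.kelvinLe (hσ : σ ∈ Set.Ioo (0 : ℝ) 1) (hn : 2 * σ < n)
    (hU : GlobalExtSol n σ U) (hnr : NonRemovable U) {r : ℝ} (hr : 0 < r) (hrc : r < ‖c‖) :
    KelvinLe σ U c r := by
  obtain ⟨r0, hr0, h0⟩ := hU.exists_kelvinLe hσ hn hnr (c := c) (norm_pos_iff.1 (hr.trans hrc))
  rcases le_total r r0 with hle | hle
  · exact h0 r hr hle
  have hsub : Set.Icc r0 r ⊆ {s | KelvinLe σ U c s} := by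
    refine IsClosed.Icc_subset_of_forall_exists_gt ?_ (h0 r0 hr0 le_rfl) ?_
    · refine isClosed_iff_frequently.2 fun s hs => ?_
      have hsI : s ∈ Set.Icc r0 r :=
        isClosed_iff_frequently.1 isClosed_Icc s (hs.mono fun _ h => h.2)
      refine ⟨fun X h1 h2 h3 => ?_, hsI⟩
      have hs0 : 0 < s := hr0.trans_le hsI.1
      rcases h1.lt_or_eq with h4 | h4
      · by_contra! hlt
        have hk := hU.continuousAt_kelvin_radius hn hs0 (hsI.2.trans_lt hrc) h1 h2
        have hsq : ContinuousAt (fun y : ℝ => y ^ 2) s := by fun_prop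
        obtain ⟨y, hy, hy1, hy2⟩ := (hs.and_eventually
          ((hk.eventually_const_lt hlt).and (hsq.eventually_lt_const h4))).exists
        exact absurd (hy.1 X hy2.le h2 h3) (not_le.2 hy1)
      · exact (kelvin_eq_self hs0 h4.symm).le
    · rintro s ⟨hs, hs1, hs2⟩ y hy
      obtain ⟨r1, hr1, h⟩ := KelvinLe.exists_gt hσ hn hU hnr (hr0.trans_le hs1) (hs2.trans hrc) hs
      obtain ⟨z, hz1, hz2⟩ := exists_between (lt_min hr1 hy)
      exact ⟨z, h z hz1.le (hz2.trans_le (min_le_left _ _)), hz1,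
        (hz2.trans_le (min_le_right _ _)).le⟩
  exact hsub ⟨hle, le_rfl⟩

end MovingSpheres

section Reflection

variable {n : ℕ} {σ : ℝ} {U : Pt n → ℝ} {e : EuclideanSpace ℝ (Fin n)} {a : ℝ}

theorem inner_reflPt (he : ‖e‖ = 1) (a : ℝ) (X : Pt n) :
    ⟪e, (reflPt e a X).1⟫ = 2 * a - ⟪e, X.1⟫ := by
  simp only [reflPt, inner_sub_right, inner_smul_right, real_inner_self_eq_norm_sq, he]
  ring

theorem reflPt_ne_zero (he : ‖e‖ = 1) (ha : 0 ≤ a) {X : Pt n} (hX : ⟪e, X.1⟫ < a) :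
    reflPt e a X ≠ 0 := by
  intro h
  have h1 := inner_reflPt he a X
  rw [h, Prod.fst_zero, inner_zero_right] at h1
  linarith

/-- Letting the centres of the spheres tend to infinity yields comparison with reflections in
hyperplanes that do not pass through the origin. -/
theorem GlobalExtSol.comp_reflPt_le_of_pos (hσ : σ ∈ Set.Ioo (0 : ℝ) 1) (hn : 2 * σ < n)
    (hU : GlobalExtSol n σ U) (hnr : NonRemovable U) (he : ‖e‖ = 1) (ha : 0 < a) {X : Pt n}
    (hX : ⟪e, X.1⟫ < a) (hX2 : 0 ≤ X.2) (hX0 : X ≠ 0) : U (reflPt e a X) ≤ U X := by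
  set i := ⟪e, X.1⟫ with hi
  set K := ‖X.1‖ ^ 2 + X.2 ^ 2 with hK
  set D : ℝ → ℝ := fun s => 1 - 2 * s * i + s ^ 2 * K with hD
  set φ : ℝ → ℝ := fun s => (1 - s * a) ^ 2 / D s with hφ
  set ψ : ℝ → ℝ := fun s => (2 * (a - i) + s * (K - a ^ 2)) / D s with hψ
  have hDc : ContinuousAt D 0 := by fun_prop
  have hD0 : D 0 = 1 := by simp [hD]
  have hφc : ContinuousAt φ 0 := ContinuousAt.div (by fun_prop) hDc (by simp [hD0])
  have hψc : ContinuousAt ψ 0 := ContinuousAt.div (by fun_prop) hDc (by simp [hD0])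
  have hφ0 : φ 0 = 1 := by simp [hφ, hD0]
  have hψ0 : ψ 0 = 2 * (a - i) := by simp [hψ, hD0]
  have hkey : ∀ᶠ s in 𝓝[>] (0 : ℝ),
      φ s ^ (((n : ℝ) - 2 * σ) / 2) * U (φ s • X.1 + ψ s • e, φ s * X.2) ≤ U X := by
    have e1 : ∀ᶠ s in 𝓝 (0 : ℝ), 0 < D s := hDc.eventually_const_lt (by simp [hD0])
    have e2 : ∀ᶠ s in 𝓝 (0 : ℝ), 0 < 2 * (a - i) + s * (K - a ^ 2) := by
      have : ContinuousAt (fun s : ℝ => 2 * (a - i) + s * (K - a ^ 2)) 0 := by fun_prop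
      exact this.eventually_const_lt (by simpa using hX)
    have e3 : ∀ᶠ s in 𝓝 (0 : ℝ), 0 < 1 - s * a := by
      have : ContinuousAt (fun s : ℝ => 1 - s * a) 0 := by fun_prop
      exact this.eventually_const_lt (by simp)
    filter_upwards [self_mem_nhdsWithin, e1.filter_mono nhdsWithin_le_nhds,
      e2.filter_mono nhdsWithin_le_nhds, e3.filter_mono nhdsWithin_le_nhds] with s hs h1 h2 h3
    have hs' : 0 < s := hs
    have hr : 0 < (1 - s * a) / s := div_pos h3 hs'
    have hcn : ‖(1 / s) • e‖ = 1 / s := by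
      rw [norm_smul, he, mul_one, Real.norm_of_nonneg (by positivity)]
    have hrc : (1 - s * a) / s < ‖(1 / s) • e‖ := by
      rw [hcn]
      gcongr
      nlinarith
    have hq : sqDist ((1 / s) • e, 0) X = D s / s ^ 2 := by
      simp only [sqDist, norm_sub_sq_real, hcn, inner_smul_right, real_inner_comm e X.1, hD, hK,
        ← hi, sub_zero]
      field_simp
      ring
    have hratio : ((1 - s * a) / s) ^ 2 / sqDist ((1 / s) • e, 0) X = φ s := by
      rw [hq]
      simp only [hφ]
      field_simp
    have hinv : invPt ((1 / s) • e) ((1 - s * a) / s) X =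
        (φ s • X.1 + ψ s • e, φ s * X.2) := by
      have h4 : ψ s = (1 - φ s) * (1 / s) := by
        simp only [hψ, hφ]
        field_simp
        simp only [hD]
        ring
      rw [invPt, hratio, h4]
      refine Prod.ext ?_ ?_
      · simp only [Prod.fst_add, Prod.smul_fst, Prod.fst_sub]
        module
      · simp
    have h5 := hU.kelvinLe hσ hn hnr hr hrc X (by
      rw [hq, div_pow]
      gcongr
      simp only [hD]
      nlinarith) hX2 hX0
    rwa [kelvin, hratio, hinv] at h5
  have hlim : Tendsto (fun s => φ s ^ (((n : ℝ) - 2 * σ) / 2) *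
      U (φ s • X.1 + ψ s • e, φ s * X.2)) (𝓝[>] 0) (𝓝 (U (reflPt e a X))) := by
    have h1 : Tendsto (fun s => φ s ^ (((n : ℝ) - 2 * σ) / 2)) (𝓝[>] 0) (𝓝 1) := by
      have := hφc.rpow_const (p := ((n : ℝ) - 2 * σ) / 2) (Or.inl (by simp [hφ0]))
      simpa [ContinuousAt, hφ0] using this.mono_left nhdsWithin_le_nhds
    have h2 : Tendsto (fun s => ((φ s • X.1 + ψ s • e, φ s * X.2) : Pt n)) (𝓝[>] 0)
        (𝓝[{X | 0 ≤ X.2}] (reflPt e a X)) := by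
      refine tendsto_nhdsWithin_of_tendsto_nhds_of_eventually_within _ ?_ ?_
      · have h3 : ContinuousAt (fun s => ((φ s • X.1 + ψ s • e, φ s * X.2) : Pt n)) 0 :=
          ((hφc.smul continuousAt_const).add (hψc.smul continuousAt_const)).prodMk
            (hφc.mul continuousAt_const)
        have h4 : ((φ 0 • X.1 + ψ 0 • e, φ 0 * X.2) : Pt n) = reflPt e a X := by
          rw [hφ0, hψ0, reflPt, ← hi]
          refine Prod.ext ?_ ?_
          · simp only
            module
          · simp
        rw [← h4]
        exact h3.tendsto.mono_left nhdsWithin_le_nhds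
      · have : ∀ᶠ s in 𝓝 (0 : ℝ), 0 < φ s := hφc.eventually_const_lt (by simp [hφ0])
        filter_upwards [this.filter_mono nhdsWithin_le_nhds] with s h using mul_nonneg h.le hX2
    simpa using h1.mul ((hU.continuousWithinAt (show 0 ≤ (reflPt e a X).2 from hX2)
      (reflPt_ne_zero he ha.le hX)).tendsto.comp h2)
  exact le_of_tendsto hlim hkey

theorem GlobalExtSol.comp_reflPt_le (hσ : σ ∈ Set.Ioo (0 : ℝ) 1) (hn : 2 * σ < n)
    (hU : GlobalExtSol n σ U) (hnr : NonRemovable U) (he : ‖e‖ = 1) (ha : 0 ≤ a) {X : Pt n}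
    (hX : ⟪e, X.1⟫ < a) (hX2 : 0 ≤ X.2) (hX0 : X ≠ 0) : U (reflPt e a X) ≤ U X := by
  have hc : Continuous fun b : ℝ => reflPt e b X := by
    unfold reflPt
    fun_prop
  have h1 : Tendsto (fun b : ℝ => reflPt e b X) (𝓝[>] a) (𝓝[{X | 0 ≤ X.2}] (reflPt e a X)) :=
    tendsto_nhdsWithin_of_tendsto_nhds_of_eventually_within _
      ((hc.tendsto a).mono_left nhdsWithin_le_nhds) (Eventually.of_forall fun b => hX2)
  refine le_of_tendsto ((hU.continuousWithinAt (show 0 ≤ (reflPt e a X).2 from hX2)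
    (reflPt_ne_zero he ha hX)).tendsto.comp h1) ?_
  filter_upwards [self_mem_nhdsWithin] with b hb
  exact hU.comp_reflPt_le_of_pos hσ hn hnr he (ha.trans_lt hb) (hX.trans hb) hX2 hX0

theorem GlobalExtSol.comp_reflPt_lt (hσ : σ ∈ Set.Ioo (0 : ℝ) 1) (hn : 2 * σ < n)
    (hU : GlobalExtSol n σ U) (hnr : NonRemovable U) (he : ‖e‖ = 1) (ha : 0 < a) {X : Pt n}
    (hX : ⟪e, X.1⟫ < a) (hX2 : 0 ≤ X.2) (hX0 : X ≠ 0) : U (reflPt e a X) < U X := by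
  have hne : ∀ Z : Pt n, 0 < Z.2 → Z ≠ 0 := fun Z hZ h => by
    rw [h] at hZ
    exact lt_irrefl _ hZ
  have hle : ∀ Z : Pt n, ⟪e, Z.1⟫ < a → 0 ≤ Z.2 → Z ≠ 0 → 0 ≤ U Z - U (reflPt e a Z) :=
    fun Z h1 h2 h3 => sub_nonneg.2 (hU.comp_reflPt_le hσ hn hnr he ha.le h1 h2 h3)
  have hrc : Continuous (reflPt (n := n) e a) := (contDiff_reflPt e a (k := 0)).continuous
  have hop : ∀ Z : Pt n, 0 < Z.2 → HasExtOp σ (fun X => U X - U (reflPt e a X)) Z 0 := by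
    intro Z hZ
    have h1 := hU.hasExtOp (X := reflPt e a Z) hZ
    have h2 : HasExtOp σ (fun X => U (reflPt e a X)) Z 0 :=
      ⟨h1.1.comp Z (contDiff_reflPt e a).contDiffAt, by rw [extOp_comp_reflPt he a h1.1, h1.2]⟩
    simpa using (hU.hasExtOp hZ).sub h2
  have hcr : ∀ Z : Pt n, ⟪e, Z.1⟫ < a → 0 ≤ Z.2 →
      ContinuousWithinAt (fun X => U (reflPt e a X)) {X | 0 ≤ X.2} Z := fun Z h1 h2 =>
    (hU.continuousWithinAt (show 0 ≤ (reflPt e a Z).2 from h2) (reflPt_ne_zero he ha.le h1)).comp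
      hrc.continuousWithinAt fun W hW => hW
  have hopen : IsOpen {X : Pt n | ⟪e, X.1⟫ < a} :=
    isOpen_lt (by fun_prop) continuous_const
  have hconv : Convex ℝ {X : Pt n | ⟪e, X.1⟫ < a} := (convex_Iio a).linear_preimage
    ((innerSL ℝ e).toLinearMap ∘ₗ LinearMap.fst ℝ (EuclideanSpace ℝ (Fin n)) ℝ)
  have hpos : ∀ Z : Pt n, ⟪e, Z.1⟫ < a → 0 < Z.2 → 0 < U Z - U (reflPt e a Z) := by
    have := (eq_zero_or_pos_of_super hσ (Ω := {X : Pt n | ⟪e, X.1⟫ < a} ∩ {X | 0 < X.2})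
      (hopen.inter (isOpen_lt continuous_const continuous_snd))
      (hconv.inter convex_halfSpace).isPreconnected (fun Z hZ => hZ.2)
      (fun Z hZ => hle Z hZ.1 (le_of_lt hZ.2) (hne Z hZ.2))
      (fun Z hZ => ⟨0, hop Z hZ.2, le_rfl⟩)).resolve_left fun hz => ?_
    · exact fun Z h1 h2 => this Z ⟨h1, h2⟩
    · have hsec : Continuous fun x : EuclideanSpace ℝ (Fin n) => ((x, 0) : Pt n) := by fun_prop
      have h0 : ∀ᶠ x : EuclideanSpace ℝ (Fin n) in 𝓝 0, ((x, 0) : Pt n) ∈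
          {X : Pt n | ⟪e, X.1⟫ < a} :=
        hsec.continuousAt.eventually_mem (hopen.mem_nhds (by simpa using ha))
      refine hnr.false_of_eventually_eq (V := fun x => U (reflPt e a (x, 0))) ?_ ?_
      · filter_upwards [h0] with x hx
        exact (hcr (x, 0) hx le_rfl).tendsto.comp
          (tendsto_nhdsWithin_of_tendsto_nhds_of_eventually_within _ (hsec.tendsto x)
            (Eventually.of_forall fun y => le_refl (0 : ℝ)))
      · filter_upwards [h0] with x hx hx0
        refine trace_eq_of_vertical (V := fun X => U (reflPt e a X)) (hcr (x, 0) hx le_rfl)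
          (hU.continuousWithinAt le_rfl fun h => hx0 (congrArg Prod.fst h)) ?_
        filter_upwards [self_mem_nhdsWithin] with t ht
        exact (sub_eq_zero.1 (hz (x, t) ⟨hx, ht⟩)).symm
  rcases hX2.lt_or_eq with h2 | h2
  · exact sub_pos.1 (hpos X hX h2)
  · have hXe : X = (X.1, 0) := Prod.ext rfl h2.symm
    have hXx : X.1 ≠ 0 := fun h => hX0 (by rw [hXe, h]; rfl)
    have hR0 := reflPt_ne_zero he ha.le hX
    rw [hXe] at hX hX0 hR0 ⊢
    have hRx : (reflPt e a (X.1, 0)).1 ≠ 0 := fun h => hR0 (Prod.ext h rfl)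
    refine sub_pos.1 (pos_of_super_boundary hσ (N := {X : Pt n | ⟪e, X.1⟫ < a} ∩ {0}ᶜ)
      (inter_mem (hopen.mem_nhds hX) (isOpen_compl_singleton.mem_nhds hX0))
      (w := fun X => U X - U (reflPt e a X)) ?_ (fun Z hZ hZ2 => hle Z hZ.1 hZ2 hZ.2)
      (fun Z hZ => hpos Z hZ.1) (fun Z _ hZ => ⟨0, hop Z hZ, le_rfl⟩)
      ((hU.hasNormalQuot hσ hXx).sub (hasNormalQuot_comp_reflPt (hU.hasNormalQuot hσ hRx))) ?_)
    · intro Z hZ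
      exact ((hU.continuousWithinAt hZ.2 hZ.1.2).sub (hcr Z hZ.1.1 hZ.2)).mono fun W hW => hW.2
    · have hp : 0 ≤ ((n : ℝ) + 2 * σ) / ((n : ℝ) - 2 * σ) := by
        have := hσ.1
        exact div_nonneg (by positivity) (by linarith)
      have h5 := hle (X.1, 0) hX le_rfl hX0
      have h6 := Real.rpow_le_rpow (hU.1 (reflPt e a (X.1, 0)) le_rfl hR0) (sub_nonneg.1 h5) hp
      have h7 : reflPt e a (X.1, 0) = ((reflPt e a (X.1, 0)).1, 0) := rfl
      rw [← h7, ← sub_div]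
      exact div_nonpos_of_nonpos_of_nonneg (by linarith) (by linarith [hσ.1])

theorem exists_reflPt_eq {x x' : EuclideanSpace ℝ (Fin n)} (h : x ≠ x') :
    ∃ (e : EuclideanSpace ℝ (Fin n)) (a : ℝ), ‖e‖ = 1 ∧ ⟪e, x⟫ < a ∧
      a * (2 * ‖x' - x‖) = ‖x'‖ ^ 2 - ‖x‖ ^ 2 ∧ ∀ t, reflPt e a (x, t) = (x', t) := by
  have hd : 0 < ‖x' - x‖ := norm_pos_iff.2 (sub_ne_zero.2 h.symm)
  have hi : ⟪‖x' - x‖⁻¹ • (x' - x), x⟫ =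
      (‖x'‖ ^ 2 - ‖x‖ ^ 2) / (2 * ‖x' - x‖) - ‖x' - x‖ / 2 := by
    rw [inner_smul_left, inner_sub_left, real_inner_self_eq_norm_sq]
    have h1 := norm_sub_sq_real x' x
    simp only [conj_trivial]
    field_simp
    linarith
  refine ⟨‖x' - x‖⁻¹ • (x' - x), (‖x'‖ ^ 2 - ‖x‖ ^ 2) / (2 * ‖x' - x‖), ?_, ?_, ?_, fun t => ?_⟩
  · rw [norm_smul, norm_inv, norm_norm, inv_mul_cancel₀ hd.ne']
  · rw [hi]
    linarith
  · field_simp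
  · simp only [reflPt, hi, smul_smul]
    have h2 : 2 * ((‖x'‖ ^ 2 - ‖x‖ ^ 2) / (2 * ‖x' - x‖) - ‖x' - x‖ / 2 -
        (‖x'‖ ^ 2 - ‖x‖ ^ 2) / (2 * ‖x' - x‖)) * ‖x' - x‖⁻¹ = -1 := by
      field_simp
      ring
    rw [h2]
    simp

theorem GlobalExtSol.le_of_norm_eq (hσ : σ ∈ Set.Ioo (0 : ℝ) 1) (hn : 2 * σ < n)
    (hU : GlobalExtSol n σ U) (hnr : NonRemovable U) {x x' : EuclideanSpace ℝ (Fin n)} {t : ℝ}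
    (h : ‖x‖ = ‖x'‖) (ht : 0 ≤ t) : U (x', t) ≤ U (x, t) := by
  by_cases hxx : x = x'
  · rw [hxx]
  obtain ⟨e, a, he, hx, ha, hr⟩ := exists_reflPt_eq hxx
  have hd : 0 < ‖x' - x‖ := norm_pos_iff.2 (sub_ne_zero.2 (Ne.symm hxx))
  have ha0 : a = 0 := by
    rw [h, sub_self] at ha
    exact (mul_eq_zero.1 ha).resolve_right (by positivity)
  rw [← hr t]
  refine hU.comp_reflPt_le hσ hn hnr he ha0.ge hx ht fun h0 => ?_
  rw [show x = 0 from congrArg Prod.fst h0, inner_zero_right] at hx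
  exact hx.ne' ha0

end Reflection

/-- If the origin is a non-removable singularity of a nonnegative
global solution `U`, then `U` is cylindrically symmetric and strictly decreasing in
the radial horizontal variable. -/
theorem stmt_3 (n : ℕ) (hn : 2 ≤ n) (σ : ℝ) (hσ : σ ∈ Set.Ioo (0 : ℝ) 1)
    (U : Pt n → ℝ) (hU : GlobalExtSol n σ U)
    (hnonrem : ¬ ∃ ε : ℝ, 0 < ε ∧ ∃ v : EuclideanSpace ℝ (Fin n) → ℝ,
      ContinuousOn v {x : EuclideanSpace ℝ (Fin n) | ‖x‖ < ε} ∧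
      ∀ x : EuclideanSpace ℝ (Fin n), ‖x‖ < ε → x ≠ 0 → v x = U (x, 0)) :
    (∀ (x x' : EuclideanSpace ℝ (Fin n)) (t : ℝ), ‖x‖ = ‖x'‖ → 0 ≤ t →
      U (x, t) = U (x', t)) ∧
    (∀ (x x' : EuclideanSpace ℝ (Fin n)) (t : ℝ), 0 < ‖x‖ → ‖x‖ < ‖x'‖ → 0 ≤ t →
      U (x', t) < U (x, t)) := by
  have h2 : 2 * σ < n := by
    have : (2 : ℝ) ≤ n := by exact_mod_cast hn
    linarith [hσ.2]
  refine ⟨fun x x' t h ht => le_antisymm (hU.le_of_norm_eq hσ h2 hnonrem h.symm ht)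
    (hU.le_of_norm_eq hσ h2 hnonrem h ht), fun x x' t hx hxx ht => ?_⟩
  have hne : x ≠ x' := fun h => hxx.ne (by rw [h])
  obtain ⟨e, a, he, hxa, ha, hr⟩ := exists_reflPt_eq hne
  rw [← hr t]
  refine hU.comp_reflPt_lt hσ h2 hnonrem he ?_ hxa ht fun h => ?_
  · have hd : 0 < ‖x' - x‖ := norm_pos_iff.2 (sub_ne_zero.2 hne.symm)
    refine pos_of_mul_pos_left (b := 2 * ‖x' - x‖) ?_ (by positivity)
    rw [ha]
    nlinarith
  · exact norm_pos_iff.1 hx (congrArg Prod.fst h)
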